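/- Let m >= 5 be an integer and let q be an odd prime power. Then the weak normal covering number of PSp_{2m}(q) is at least 3: for any two proper subgroups H and K of PSp_{2m}(q) there exists an element g of PSp_{2m}(q) such that phi(g) lies in neither H nor K for every automorphism phi of PSp_{2m}(q). -/

import Mathlib

/-- The projective symplectic group `PSp_{2m}(F)`: the quotient of the symplectic group
`Sp_{2m}(F)` by its center. -/
abbrev ProjSp (m : ℕ) (F : Type*) [Field F] : Type _ :=
  ↥(Matrix.symplecticGroup (Fin m) F) ⧸
    Subgroup.center ↥(Matrix.symplecticGroup (Fin m) F)

class Symp (F V : Type*) [Field F] [AddCommGroup V] [Module F V] where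
  ω : V →ₗ[F] V →ₗ[F] F
  alt : ∀ v, ω v v = 0
  nd : ∀ v, (∀ w, ω v w = 0) → v = 0

set_option linter.unusedSectionVars false
set_option linter.unusedSimpArgs false
set_option linter.unusedVariables false

section P0
variable {F V : Type*} [Field F] [AddCommGroup V] [Module F V]
@[simp] theorem inv_ap (g : V ≃ₗ[F] V) (v : V) : g⁻¹ (g v) = v := g.symm_apply_apply v
@[simp] theorem ap_inv (g : V ≃ₗ[F] V) (v : V) : g (g⁻¹ v) = v := g.apply_symm_apply v
@[simp] theorem mul_ap (g h : V ≃ₗ[F] V) (v : V) : (g * h) v = g (h v) := rfl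
@[simp] theorem one_ap (v : V) : (1 : V ≃ₗ[F] V) v = v := rfl

theorem inv_ap_iff {g : V ≃ₗ[F] V} {v w : V} : g⁻¹ v = w ↔ v = g w := by
  constructor
  · rintro rfl; simp
  · rintro rfl; simp

def fx (g : V ≃ₗ[F] V) : Submodule F V := LinearMap.ker (g.toLinearMap - LinearMap.id)
theorem mem_fx {g : V ≃ₗ[F] V} {v : V} : v ∈ fx g ↔ g v = v := by
  simp [fx, sub_eq_zero]

theorem two_nonzero {U : Submodule F V} {f g : V →ₗ[F] F} (hf : ∃ u ∈ U, f u ≠ 0)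
    (hg : ∃ u ∈ U, g u ≠ 0) : ∃ u ∈ U, f u ≠ 0 ∧ g u ≠ 0 := by
  obtain ⟨a, ha, hfa⟩ := hf
  obtain ⟨b, hb, hgb⟩ := hg
  by_cases h1 : g a = 0
  · by_cases h2 : f b = 0
    · exact ⟨a + b, U.add_mem ha hb, by simp [h2, hfa], by simp [h1, hgb]⟩
    · exact ⟨b, hb, h2, hgb⟩
  · exact ⟨a, ha, hfa, h1⟩

end P0

section P1
open Module
variable {F V : Type*} [Field F] [AddCommGroup V] [Module F V] [Symp F V]
local notation "ω" => Symp.ω (F := F) (V := V)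

theorem om_self (v : V) : ω v v = 0 := Symp.alt v
theorem om_neg (v w : V) : ω w v = - ω v w := by
  have h := Symp.alt (F := F) (v + w)
  simp only [map_add, LinearMap.add_apply, om_self] at h
  linear_combination h
theorem om_zero_comm {v w : V} : ω v w = 0 ↔ ω w v = 0 := by
  rw [om_neg w v]; simp
theorem om_nd {v : V} (h : v ≠ 0) : ∃ w, ω v w ≠ 0 := by
  by_contra hh; push Not at hh; exact h (Symp.nd v hh)

def perp (U : Submodule F V) : Submodule F V := LinearMap.BilinForm.orthogonal (ω) U
theorem mem_perp {U : Submodule F V} {v : V} : v ∈ perp U ↔ ∀ u ∈ U, ω u v = 0 := Iff.rfl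
theorem mem_perp' {U : Submodule F V} {v : V} : v ∈ perp U ↔ ∀ u ∈ U, ω v u = 0 := by
  rw [mem_perp]; exact forall₂_congr fun u _ => om_zero_comm
theorem om_nondeg : LinearMap.BilinForm.Nondegenerate (ω) :=
  ⟨fun v h => Symp.nd v h, fun v h => Symp.nd v fun w => om_zero_comm.1 (h w)⟩
theorem om_refl : LinearMap.BilinForm.IsRefl (ω) := fun _ _ h => om_zero_comm.1 h
theorem perp_anti {U W : Submodule F V} (h : U ≤ W) : perp W ≤ perp U :=
  fun _ hv u hu => hv u (h hu)
theorem finrank_perp [FiniteDimensional F V] (U : Submodule F V) :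
    finrank F (perp U) + finrank F U = finrank F V := by
  have := LinearMap.BilinForm.finrank_orthogonal (om_nondeg (F := F) (V := V)) U
  have h2 := U.finrank_le
  unfold perp; omega
theorem perp_perp [FiniteDimensional F V] (U : Submodule F V) : perp (perp U) = U :=
  LinearMap.BilinForm.orthogonal_orthogonal om_nondeg om_refl U

def Sp (F V : Type*) [Field F] [AddCommGroup V] [Module F V] [Symp F V] :
    Subgroup (V ≃ₗ[F] V) where
  carrier := {g | ∀ v w, Symp.ω (F := F) (g v) (g w) = Symp.ω (F := F) v w}
  one_mem' := fun _ _ => rfl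
  mul_mem' := fun {a b} ha hb v w => by
    rw [LinearEquiv.mul_apply, LinearEquiv.mul_apply, ha, hb]
  inv_mem' := fun {a} ha v w => by
    rw [← ha]
    have h : ∀ v, a (a⁻¹ v) = v := fun v => a.apply_symm_apply v
    rw [h, h]

theorem mem_Sp {g : V ≃ₗ[F] V} : g ∈ Sp F V ↔ ∀ v w, ω (g v) (g w) = ω v w := Iff.rfl

theorem Sp_inv_om {g : V ≃ₗ[F] V} (hg : g ∈ Sp F V) (v w : V) :
    ω (g⁻¹ v) w = ω v (g w) := by
  rw [← hg]; simp

def tv (x : V) (c : F) : V ≃ₗ[F] V where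
  toFun v := v + (c * ω x v) • x
  invFun v := v + (-c * ω x v) • x
  map_add' v w := by simp only [map_add]; module
  map_smul' a v := by simp only [map_smul, smul_eq_mul, RingHom.id_apply]; module
  left_inv v := by
    simp only [map_add, map_smul, om_self, smul_eq_mul]; module
  right_inv v := by
    simp only [map_add, map_smul, om_self, smul_eq_mul]; module

theorem tv_ap (x : V) (c : F) (v : V) : tv x c v = v + (c * ω x v) • x := rfl
theorem tv_inv (x : V) (c : F) : (tv x c)⁻¹ = tv x (-c) := by
  ext v; rfl
theorem tv_zero (x : V) : tv x (0:F) = 1 := by ext v; simp [tv_ap]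
theorem tv_add (x : V) (c d : F) : tv x c * tv x d = tv x (c + d) := by
  ext v; simp only [mul_ap, tv_ap, map_add, map_smul, om_self, smul_eq_mul]; module
theorem tv_smul (x : V) (a c : F) : tv (a • x) c = tv x (a * a * c) := by
  ext v; simp only [tv_ap, map_smul, LinearMap.smul_apply, smul_eq_mul]; module
theorem tv_pow (x : V) (c : F) (n : ℕ) : tv x c ^ n = tv x (n * c) := by
  induction n with
  | zero => simp [tv_zero]
  | succ n ih => rw [pow_succ, ih, tv_add]; congr 1; push_cast; ring
theorem tv_mem (x : V) (c : F) : tv x c ∈ Sp F V := by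
  intro v w
  simp only [tv_ap, map_add, map_smul, LinearMap.add_apply, LinearMap.smul_apply, smul_eq_mul,
    om_self, om_neg x v]
  ring
theorem tv_conj {g : V ≃ₗ[F] V} (hg : g ∈ Sp F V) (x : V) (c : F) :
    g * tv x c * g⁻¹ = tv (g x) c := by
  ext v
  simp only [mul_ap, tv_ap, map_add, map_smul, ap_inv]
  rw [om_neg, Sp_inv_om hg, ← om_neg]

theorem not_mem_perp {U : Submodule F V} {v : V} (h : v ∉ perp U) : ∃ u ∈ U, ω v u ≠ 0 := by
  rw [mem_perp'] at h; push Not at h; exact h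

theorem L1 [FiniteDimensional F V] {X : Subgroup (V ≃ₗ[F] V)} (hX : ∀ x c, tv x c ∈ X) :
    Sp F V ≤ X := by
  have key : ∀ n : ℕ, ∀ g ∈ Sp F V, finrank F V - finrank F (fx g) = n → g ∈ X := by
    intro n
    induction n using Nat.strong_induction_on with
    | _ n ih =>
    intro g hg hn
    by_cases h1 : ∀ v, g v = v
    · have : g = 1 := by ext v; exact h1 v
      rw [this]; exact X.one_mem
    push Not at h1
    obtain ⟨v, hv⟩ := h1
    suffices h : ∃ t ∈ X, t ∈ Sp F V ∧ (∀ f ∈ fx g, t f = f) ∧ t v = g v by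
      obtain ⟨t, htX, htS, htf, htv⟩ := h
      have hlt : fx g < fx (t⁻¹ * g) := by
        refine lt_of_le_of_ne (fun f hf => ?_) (fun he => ?_)
        · rw [mem_fx, mul_ap, mem_fx.1 hf, inv_ap_iff, htf f hf]
        · have : v ∈ fx (t⁻¹ * g) := by rw [mem_fx, mul_ap, inv_ap_iff, htv]
          rw [← he, mem_fx] at this; exact hv this
      have h2 := Submodule.finrank_lt_finrank_of_lt hlt
      have h3 := (fx (t⁻¹ * g)).finrank_le
      have := ih _ (by omega) (t⁻¹ * g) (mul_mem (inv_mem htS) hg) rfl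
      have h4 := X.mul_mem htX this
      simpa using h4
    have hpf : ∀ f ∈ fx g, ω (g v - v) f = 0 := by
      intro f hf
      have := hg v f
      rw [mem_fx.1 hf] at this
      simp [this]
    by_cases h2 : ω (g v) v = 0
    · have e1 : ∃ u ∈ perp (fx g), ω v u ≠ 0 := by
        apply not_mem_perp; rw [perp_perp]; exact fun h => hv (mem_fx.1 h)
      have e2 : ∃ u ∈ perp (fx g), ω (g v) u ≠ 0 := by
        apply not_mem_perp; rw [perp_perp]; intro h
        exact hv (g.injective (mem_fx.1 h))
      obtain ⟨k, hk, hk1, hk2⟩ := two_nonzero e1 e2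
      rw [mem_perp'] at hk
      refine ⟨tv (g v - v - k) (ω (g v) k)⁻¹ * tv k (- (ω v k)⁻¹), X.mul_mem (hX _ _) (hX _ _),
        mul_mem (tv_mem _ _) (tv_mem _ _), ?_, ?_⟩
      · intro f hf
        rw [mul_ap, tv_ap k, hk f hf, mul_zero, zero_smul, add_zero, tv_ap]
        have := hpf f hf
        rw [map_sub, LinearMap.sub_apply, this, hk f hf]; simp
      · have h3 : tv k (-(ω v k)⁻¹) v = v + k := by
          rw [tv_ap, om_neg v k, neg_mul_neg, inv_mul_cancel₀ hk1, one_smul]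
        rw [mul_ap, h3, tv_ap]
        have : ω (g v - v - k) (v + k) = ω (g v) k := by
          simp only [map_add, map_sub, LinearMap.sub_apply, om_self, h2, om_neg v k]; ring
        rw [this, inv_mul_cancel₀ hk2]; module
    · refine ⟨tv (g v - v) (ω (g v) v)⁻¹, hX _ _, tv_mem _ _, ?_, ?_⟩
      · intro f hf; rw [tv_ap, hpf f hf]; simp
      · rw [tv_ap, map_sub, LinearMap.sub_apply, om_self, sub_zero, inv_mul_cancel₀ h2]; module
  exact fun g hg => key _ g hg rfl

end P1

set_option linter.unusedSectionVars false
set_option linter.unusedSimpArgs false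
set_option linter.unusedVariables false
set_option autoImplicit false
section P2
open Module
variable {F V : Type*} [Field F] [AddCommGroup V] [Module F V] [Symp F V]
local notation "ω" => Symp.ω (F := F) (V := V)

def Irr (X : Subgroup (V ≃ₗ[F] V)) : Prop :=
  ∀ U : Submodule F V, (∀ g ∈ X, ∀ u ∈ U, g u ∈ U) → U = ⊥ ∨ U = ⊤

structure Split (r : ℕ) (s : V ≃ₗ[F] V) (F0 W : Submodule F V) : Prop where
  prm : r.Prime
  sp : s ∈ Sp F V
  pw : s ^ r = 1
  perpW : perp W = F0
  perpF : perp F0 = W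
  inf : ∀ v, v ∈ F0 → v ∈ W → v = 0
  dec : ∀ v, ∃ f ∈ F0, ∃ w ∈ W, v = f + w
  fix : ∀ v ∈ F0, s v = v
  inv : ∀ v ∈ W, s v ∈ W
  irr : ∀ Y : AddSubgroup V, (∀ y ∈ Y, y ∈ W) → (∀ y ∈ Y, s y ∈ Y) →
    (∀ y ∈ Y, y = 0) ∨ (∀ w ∈ W, w ∈ Y)
  lt : finrank F F0 < finrank F W
  fix' : ∀ v, s v = v → v ∈ F0

theorem Split.om {r : ℕ} {s : V ≃ₗ[F] V} {F0 W : Submodule F V} (h : Split r s F0 W) {f w : V}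
    (hf : f ∈ F0) (hw : w ∈ W) : ω f w = 0 := by
  rw [← h.perpF] at hw; exact hw f hf

theorem Split.om' {r : ℕ} {s : V ≃ₗ[F] V} {F0 W : Submodule F V} (h : Split r s F0 W) {f w : V}
    (hf : f ∈ F0) (hw : w ∈ W) : ω w f = 0 := om_zero_comm.1 (h.om hf hw)

theorem Split.nd {r : ℕ} {s : V ≃ₗ[F] V} {F0 W : Submodule F V} (h : Split r s F0 W) {w : V}
    (hw : w ∈ W) (h0 : w ≠ 0) : ∃ w' ∈ W, ω w w' ≠ 0 := by
  apply not_mem_perp; rw [h.perpW]; exact fun hf => h0 (h.inf _ hf hw)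

theorem pow_inv_mem {s : V ≃ₗ[F] V} {W : Submodule F V} (h : ∀ v ∈ W, s v ∈ W) (i : ℕ) :
    ∀ v ∈ W, (s ^ i) v ∈ W := by
  induction i with
  | zero => intro v hv; simpa using hv
  | succ n ih => intro v hv; rw [pow_succ, mul_ap]; exact ih _ (h v hv)

theorem L5 {r : ℕ} {s : V ≃ₗ[F] V} {F0 W : Submodule F V} (h : Split r s F0 W) {w : V}
    (hw : w ∈ W) (h0 : w ≠ 0) {F' : Submodule F V} (hwF : w ∈ F')
    (hi : ∀ i : ℕ, (s ^ i) w ∈ F' ∨ (s ^ i) w ∈ perp F') : W ≤ F' := by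
  obtain ⟨i, hne⟩ : ∃ i : ℕ, ω w ((s ^ i) w) ≠ 0 := by
    by_contra hc
    push Not at hc
    let Y : AddSubgroup V :=
      { carrier := {y | y ∈ W ∧ ∀ i : ℕ, ω w ((s ^ i) y) = 0}
        zero_mem' := ⟨W.zero_mem, by simp⟩
        add_mem' := fun {a b} ha hb => ⟨W.add_mem ha.1 hb.1, fun i => by
          simp [ha.2 i, hb.2 i]⟩
        neg_mem' := fun {a} ha => ⟨W.neg_mem ha.1, fun i => by simp [ha.2 i]⟩ }
    rcases h.irr Y (fun y hy => hy.1) (fun y hy => ⟨h.inv y hy.1, fun i => by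
      rw [← mul_ap, ← pow_succ]; exact hy.2 _⟩) with h1 | h1
    · exact h0 (h1 w ⟨hw, hc⟩)
    · obtain ⟨w', hw', hn⟩ := h.nd hw h0
      exact hn (by simpa using (h1 w' hw').2 0)
  have hri : ¬ r ∣ i := by
    rintro ⟨t, rfl⟩
    rw [pow_mul, h.pw, one_pow] at hne
    exact hne (om_self w)
  have hk : ∀ k : ℕ, (s ^ (i * k)) w ∈ F' := by
    intro k
    induction k with
    | zero => simpa using hwF
    | succ k ih =>
      refine (hi (i * (k + 1))).resolve_right fun hp => hne ?_
      have := hp _ ih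
      rwa [mul_add, mul_one, pow_add, mul_ap, (pow_mem h.sp (i * k) : _ ∈ Sp F V)] at this
  have hj : ∀ j : ℕ, (s ^ j) w ∈ F' := by
    intro j
    obtain ⟨k, -, hk'⟩ := Nat.exists_mul_mod_eq_one_of_coprime
      (Nat.Coprime.symm ((h.prm.coprime_iff_not_dvd).2 hri)) h.prm.one_lt
    have hm : i * (k * j) % r = j % r := by
      rw [← mul_assoc, Nat.mul_mod, hk', one_mul, Nat.mod_mod]
    have hpm : ∀ a : ℕ, s ^ a = s ^ (a % r) := fun a => by
      conv_lhs => rw [← Nat.div_add_mod a r, pow_add, pow_mul, h.pw, one_pow, one_mul]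
    rw [hpm, ← hm, ← hpm]; exact hk _
  let Y : AddSubgroup V :=
    { carrier := {y | y ∈ W ∧ ∀ i : ℕ, (s ^ i) y ∈ F'}
      zero_mem' := ⟨W.zero_mem, by simp⟩
      add_mem' := fun {a b} ha hb => ⟨W.add_mem ha.1 hb.1, fun i => by
        rw [map_add]; exact F'.add_mem (ha.2 i) (hb.2 i)⟩
      neg_mem' := fun {a} ha => ⟨W.neg_mem ha.1, fun i => by
        rw [map_neg]; exact F'.neg_mem (ha.2 i)⟩ }
  rcases h.irr Y (fun y hy => hy.1) (fun y hy => ⟨h.inv y hy.1, fun i => by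
      rw [← mul_ap, ← pow_succ]; exact hy.2 _⟩) with h1 | h1
  · exact absurd (h1 w ⟨hw, hj⟩) h0
  · intro w' hw'; simpa using (h1 w' hw').2 0

def Om (X : Subgroup (V ≃ₗ[F] V)) : Set V := {x | ∀ c : F, tv x c ∈ X}

section
variable {X : Subgroup (V ≃ₗ[F] V)} (hX : X ≤ Sp F V)
include hX
theorem Om_ap {g : V ≃ₗ[F] V} (hg : g ∈ X) {x : V} (hx : x ∈ Om X) : g x ∈ Om X := fun c => by
  rw [← tv_conj (hX hg)]; exact X.mul_mem (X.mul_mem hg (hx c)) (X.inv_mem hg)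
theorem Om_smul {x : V} (hx : x ∈ Om X) (a : F) : a • x ∈ Om X := fun c => by
  rw [tv_smul]; exact hx _
theorem Om_neg {x : V} (hx : x ∈ Om X) : -x ∈ Om X := by
  simpa using Om_smul hX hx (-1)
theorem Om_add {x y : V} (hx : x ∈ Om X) (hy : y ∈ Om X) (h : ω x y ≠ 0) : x + y ∈ Om X := by
  have := Om_ap hX (hx (ω x y)⁻¹) hy
  rw [tv_ap, inv_mul_cancel₀ h, one_smul, add_comm] at this
  exact this
/-- the span of an invariant set containing a nonzero vector is everything -/
theorem span_top (hI : Irr X) {S : Set V} (hS : ∀ g ∈ X, ∀ x ∈ S, g x ∈ S) {x : V} (hx : x ∈ S)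
    (h0 : x ≠ 0) : Submodule.span F S = ⊤ := by
  refine (hI (Submodule.span F S) fun g hg u hu => ?_).resolve_left fun h => h0 ?_
  · have : Submodule.span F S ≤ (Submodule.span F S).comap g.toLinearMap :=
      Submodule.span_le.2 fun y hy => Submodule.subset_span (hS g hg y hy)
    exact this hu
  · have := Submodule.subset_span (R := F) hx
    rw [h] at this; exact this
end

theorem le_or_le {A S T : Submodule F V} (h : ∀ a ∈ A, a ∈ S ∨ a ∈ T) : A ≤ S ∨ A ≤ T := by
  by_contra hc
  push Not at hc
  obtain ⟨h1, h2⟩ := hc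
  obtain ⟨a, ha, ha'⟩ := Set.not_subset.1 h1
  obtain ⟨b, hb, hb'⟩ := Set.not_subset.1 h2
  have haT := (h a ha).resolve_left ha'
  have hbS := (h b hb).resolve_right hb'
  rcases h (a + b) (A.add_mem ha hb) with h3 | h3
  · exact ha' ((S.add_mem_iff_left hbS).1 h3)
  · exact hb' ((T.add_mem_iff_right haT).1 h3)

theorem L2 [FiniteDimensional F V] (h2 : (2 : F) ≠ 0) {X : Subgroup (V ≃ₗ[F] V)} (hX : X ≤ Sp F V)
    (hI : Irr X) {Q R : Submodule F V} (hR : perp Q = R) (hQ : ∀ v, v ∈ Q → v ∈ R → v = 0)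
    (hd : ∀ v, ∃ a ∈ Q, ∃ b ∈ R, v = a + b) (hO : ∀ a ∈ Q, a ∈ Om X)
    (hlt : finrank F R < finrank F Q) : Sp F V ≤ X := by
  have om0 : ∀ a ∈ Q, ∀ b ∈ R, ω a b = 0 := fun a ha b hb => by rw [← hR] at hb; exact hb a ha
  have om0' : ∀ a ∈ Q, ∀ b ∈ R, ω b a = 0 := fun a ha b hb => om_zero_comm.1 (om0 a ha b hb)
  have Qnd : ∀ a ∈ Q, a ≠ 0 → ∃ a' ∈ Q, ω a a' ≠ 0 := fun a ha h0 => by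
    apply not_mem_perp; rw [hR]; exact fun h => h0 (hQ a ha h)
  obtain ⟨q0, hq0, hq0n⟩ : ∃ q ∈ Q, q ≠ 0 := by
    apply Q.exists_mem_ne_zero_of_ne_bot; rintro rfl; simp at hlt
  have tr1 : ∀ a ∈ Q, ∀ a' ∈ Q, ∀ b ∈ R, ω a a' ≠ 0 → a + b ∈ Om X → a' + b ∈ Om X := by
    intro a ha a' ha' b hb hne h
    have := Om_ap hX (hO _ (Q.sub_mem ha' ha) (ω a' a)⁻¹) h
    rw [tv_ap] at this
    have e : ω (a' - a) (a + b) = ω a' a := by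
      simp [om_self, om0 _ ha _ hb, om0 _ ha' _ hb]
    rw [e, inv_mul_cancel₀ (fun hh => hne (om_zero_comm.1 hh))] at this
    convert this using 1; module
  have tr : ∀ a ∈ Q, a ≠ 0 → ∀ a' ∈ Q, a' ≠ 0 → ∀ b ∈ R, a + b ∈ Om X → a' + b ∈ Om X := by
    intro a ha h0 a' ha' h0' b hb h
    obtain ⟨c, hc, h3, h4⟩ := two_nonzero (Qnd a ha h0) (Qnd a' ha' h0')
    exact tr1 c hc a' ha' b hb (fun hh => h4 (om_zero_comm.1 hh)) (tr1 a ha c hc b hb h3 h)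
  have ex : ∀ b ∈ R, (∃ a ∈ Q, a ≠ 0 ∧ a + b ∈ Om X) → ∀ a ∈ Q, a ≠ 0 → a + b ∈ Om X := by
    rintro b hb ⟨a, ha, h0, h⟩ a' ha' h0'
    exact tr a ha h0 a' ha' h0' b hb h
  let B : Submodule F V :=
    { carrier := {b | b ∈ R ∧ ∀ a ∈ Q, a ≠ 0 → a + b ∈ Om X}
      zero_mem' := ⟨R.zero_mem, fun a ha _ => by simpa using hO a ha⟩
      add_mem' := by
        rintro b1 b2 ⟨hb1, h1⟩ ⟨hb2, h2'⟩
        refine ⟨R.add_mem hb1 hb2, ex _ (R.add_mem hb1 hb2) ?_⟩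
        obtain ⟨q1, hq1, hn⟩ := Qnd q0 hq0 hq0n
        have hq1n : q1 ≠ 0 := by rintro rfl; simp at hn
        have hcase : ∀ q ∈ Q, q ≠ 0 → ω q0 q ≠ 0 → ω q0 q + ω b1 b2 ≠ 0 →
            ∃ a ∈ Q, a ≠ 0 ∧ a + (b1 + b2) ∈ Om X := by
          intro q hq hq' hqq hs
          refine ⟨q0 + q, Q.add_mem hq0 hq, ?_, ?_⟩
          · intro h; apply hqq
            rw [eq_neg_of_add_eq_zero_right h]; simp [om_self]
          · have := Om_add hX (h1 q0 hq0 hq0n) (h2' q hq hq') (by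
              simpa [om0 _ hq0 _ hb2, om0' _ hq _ hb1] using hs)
            convert this using 1; abel
        by_cases hs : ω q0 q1 + ω b1 b2 = 0
        · refine hcase (-q1) (Q.neg_mem hq1) (neg_ne_zero.2 hq1n) (by simpa using hn) ?_
          intro h; apply hn
          have : (2:F) * ω q0 q1 = 0 := by
            rw [map_neg] at h; linear_combination hs - h
          exact (mul_eq_zero.1 this).resolve_left h2
        · exact hcase q1 hq1 hq1n hn hs
      smul_mem' := by
        rintro c b ⟨hb, h1⟩
        refine ⟨R.smul_mem c hb, ?_⟩
        by_cases hc : c = 0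
        · subst hc; intro a ha _; simpa using hO a ha
        · refine ex _ (R.smul_mem c hb) ⟨c • q0, Q.smul_mem c hq0, smul_ne_zero hc hq0n, ?_⟩
          rw [← smul_add]; exact Om_smul hX (h1 _ hq0 hq0n) c }
  have hOS : ∀ x ∈ Om X, x ∈ Q ⊔ B ∨ x ∈ R := by
    intro x hx
    obtain ⟨a, ha, b, hb, rfl⟩ := hd x
    by_cases h0 : a = 0
    · right; simpa [h0] using hb
    · left; exact Submodule.add_mem_sup ha ⟨hb, ex b hb ⟨a, ha, h0, hx⟩⟩
  have hS : Q ⊔ B = ⊤ := by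
    rw [eq_top_iff, ← span_top hX hI (S := {x | ∃ g ∈ X, ∃ y ∈ Q, x = g y}) ?_
      (x := q0) ⟨1, X.one_mem, q0, hq0, rfl⟩ hq0n, Submodule.span_le]
    · rintro _ ⟨g, hg, y, hy, rfl⟩
      have : Q.map g.toLinearMap ≤ Q ⊔ B ∨ Q.map g.toLinearMap ≤ R := by
        apply le_or_le
        rintro _ ⟨z, hz, rfl⟩
        exact hOS _ (Om_ap hX hg (hO z hz))
      rcases this with h | h
      · exact h ⟨y, hy, rfl⟩
      · have h3 := Submodule.finrank_mono h
        have h4 : finrank F (Q.map g.toLinearMap) = finrank F Q := LinearEquiv.finrank_map_eq g Q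
        omega
    · rintro g hg _ ⟨g', hg', y, hy, rfl⟩
      exact ⟨g * g', X.mul_mem hg hg', y, hy, rfl⟩
  have hnR : ∀ x, x ∉ R → x ∈ Om X := by
    intro x hx
    have : x ∈ Q ⊔ B := by rw [hS]; trivial
    obtain ⟨a, ha, b, hb, rfl⟩ := Submodule.mem_sup.1 this
    refine hb.2 a ha ?_
    rintro rfl; apply hx; simpa using hb.1
  apply L1
  intro x
  show x ∈ Om X
  by_cases hx : x ∈ R
  · by_cases h0 : x = 0
    · subst h0; exact hO 0 Q.zero_mem
    obtain ⟨c, hcR, hc⟩ : ∃ c, c ∉ R ∧ ω c x ≠ 0 := by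
      obtain ⟨c, hc⟩ := om_nd (F := F) h0
      have hc : ω c x ≠ 0 := fun h => hc (om_zero_comm.1 h)
      by_cases hcR : c ∈ R
      · refine ⟨c + q0, fun h => hq0n (hQ _ hq0 ((R.add_mem_iff_right hcR).1 h)), ?_⟩
        simpa [om0 _ hq0 _ hx] using hc
      · exact ⟨c, hcR, hc⟩
    have := Om_add hX (hnR c hcR) (hnR (x - c) fun h => hcR ((R.sub_mem_iff_right hx).1 h))
      (by simpa [om_self] using hc)
    simpa using this
  · exact hnR x hx

def Th (X : Subgroup (V ≃ₗ[F] V)) (u w : V) (c : F) : Prop :=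
  ∃ g ∈ X, ∀ v, g v = v + ω u v • w + ω w v • u + (c * ω u v) • u

theorem L3 [FiniteDimensional F V] (h2 : (2 : F) ≠ 0) {X : Subgroup (V ≃ₗ[F] V)} (hX : X ≤ Sp F V)
    (hI : Irr X) {r : ℕ} {s : V ≃ₗ[F] V} {F0 W : Submodule F V} (h : Split r s F0 W) (hs : s ∈ X)
    {u w : V} (hu : u ∈ F0) (hu0 : u ≠ 0) (hw : w ∈ W) (hw0 : w ≠ 0) {c : F} (ht : Th X u w c) :
    Sp F V ≤ X := by
  have hmul : ∀ w1 ∈ W, ∀ w2 ∈ W, ∀ c1 c2, Th X u w1 c1 → Th X u w2 c2 →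
      Th X u (w1 + w2) (c1 + c2 + ω w1 w2) := by
    rintro w1 hw1 w2 hw2 c1 c2 ⟨g1, hg1, e1⟩ ⟨g2, hg2, e2⟩
    refine ⟨g1 * g2, X.mul_mem hg1 hg2, fun v => ?_⟩
    rw [mul_ap, e1, e2]
    simp only [map_add, map_smul, LinearMap.add_apply, smul_eq_mul, om_self, h.om hu hw1,
      h.om hu hw2, h.om' hu hw1, h.om' hu hw2]
    module
  have hneg : ∀ w1 ∈ W, ∀ c1, Th X u w1 c1 → Th X u (-w1) (-c1) := by
    rintro w1 hw1 c1 ⟨g1, hg1, e1⟩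
    refine ⟨g1⁻¹, X.inv_mem hg1, fun v => ?_⟩
    rw [inv_ap_iff, e1]
    simp only [map_add, map_neg, map_smul, LinearMap.neg_apply, LinearMap.add_apply, smul_eq_mul,
      om_self, h.om hu hw1, h.om' hu hw1]
    module
  let Y : AddSubgroup V :=
    { carrier := {y | y ∈ W ∧ ∃ c, Th X u y c}
      zero_mem' := ⟨W.zero_mem, 0, 1, X.one_mem, fun v => by simp⟩
      add_mem' := by
        rintro a b ⟨ha, c1, h1⟩ ⟨hb, c2, h2⟩
        exact ⟨W.add_mem ha hb, _, hmul a ha b hb c1 c2 h1 h2⟩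
      neg_mem' := by
        rintro a ⟨ha, c1, h1⟩
        exact ⟨W.neg_mem ha, _, hneg a ha c1 h1⟩ }
  have hall : ∀ w ∈ W, ∃ c, Th X u w c := by
    have := (h.irr Y (fun y hy => hy.1) ?_).resolve_left fun h => hw0 (h w ⟨hw, c, ht⟩)
    · exact fun w hw => (this w hw).2
    · rintro y ⟨hy, c, g, hg, e⟩
      refine ⟨h.inv y hy, c, s * g * s⁻¹, X.mul_mem (X.mul_mem hs hg) (X.inv_mem hs), fun v => ?_⟩
      have e1 : ω u (s⁻¹ v) = ω u v := by
        rw [om_neg, Sp_inv_om h.sp, h.fix u hu, ← om_neg]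
      have e2 : ω y (s⁻¹ v) = ω (s y) v := by
        rw [om_neg, Sp_inv_om h.sp, ← om_neg]
      simp only [mul_ap, e, map_add, map_smul, ap_inv, h.fix u hu, e1, e2]
  have huO : u ∈ Om X := by
    intro d
    obtain ⟨w', hw', hn⟩ := h.nd hw hw0
    obtain ⟨a, ha⟩ : ∃ a, d = 2 * (a * ω w w') := ⟨d / 2 / ω w w', by field_simp⟩
    obtain ⟨c1, h1⟩ := hall (a • w) (W.smul_mem _ hw)
    obtain ⟨c2, h2'⟩ := hall w' hw'
    have hw1 := W.smul_mem a hw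
    obtain ⟨g1, hg1, e1⟩ := hmul _ hw1 _ hw' _ _ h1 h2'
    obtain ⟨g2, hg2, e2⟩ := hmul _ hw' _ hw1 _ _ h2' h1
    have : tv u d = g1 * g2⁻¹ := by
      rw [eq_mul_inv_iff_mul_eq]
      ext v
      rw [mul_ap, tv_ap, e1, e2]
      simp only [map_add, map_smul, LinearMap.add_apply, LinearMap.smul_apply, smul_eq_mul,
        om_self, h.om hu hw, h.om hu hw', om_neg w w']
      subst ha
      module
    rw [this]; exact X.mul_mem hg1 (X.inv_mem hg2)
  obtain ⟨v, hvO, hv⟩ : ∃ v ∈ Om X, ω u v ≠ 0 := by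
    by_contra hc
    push Not at hc
    obtain ⟨z, hz⟩ := om_nd (F := F) hu0
    have h1 := span_top hX hI (S := Om X) (fun g hg x hx => Om_ap hX hg hx) huO hu0
    have h3 : Submodule.span F (Om X) ≤ LinearMap.ker (ω u) := Submodule.span_le.2 hc
    rw [h1] at h3
    exact hz (h3 (Submodule.mem_top (x := z)))
  obtain ⟨f, hf, w0, hw0', rfl⟩ := h.dec v
  have huf : ω u f ≠ 0 := by simpa [h.om hu hw0'] using hv
  have hfW : ∀ w1 ∈ W, f + w1 ∈ Om X := by
    intro w1 hw1
    have hm : (ω u f)⁻¹ • (w1 - w0) ∈ W := W.smul_mem _ (W.sub_mem hw1 hw0')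
    obtain ⟨c1, g, hg, e⟩ := hall _ hm
    have h3 := Om_ap hX hg hvO
    rw [e] at h3
    have e4 : ω u (f + w0) = ω u f := by simp [h.om hu hw0']
    rw [e4, smul_smul, mul_inv_cancel₀ huf, one_smul] at h3
    generalize ω ((ω u f)⁻¹ • (w1 - w0)) (f + w0) = k at h3
    have h4 := Om_ap hX (huO (-(k + c1 * ω u f) / ω u f)) h3
    rw [tv_ap] at h4
    have e5 : ω u (f + w0 + (w1 - w0) + k • u + (c1 * ω u f) • u) = ω u f := by
      simp [h.om hu hw0', h.om hu hw1, om_self]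
    rw [e5, div_mul_cancel₀ _ huf] at h4
    convert h4 using 1; module
  refine L2 h2 hX hI h.perpW (fun v h1 h2 => h.inf v h2 h1) ?_ ?_ h.lt
  · intro v; obtain ⟨f, hf, w, hw, e⟩ := h.dec v
    exact ⟨w, hw, f, hf, by rw [e, add_comm]⟩
  · intro a ha
    by_cases h0 : a = 0
    · subst h0; intro c; rw [show tv (0:V) c = 1 by ext v; simp [tv_ap]]; exact X.one_mem
    obtain ⟨w1, hw1, hn⟩ := h.nd ha h0
    have := Om_add hX (hfW w1 hw1) (Om_neg hX (hfW (w1 - a) (W.sub_mem hw1 ha))) (by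
      have : ω (f + w1) (-(f + (w1 - a))) = - ω a w1 := by
        have e : -(f + (w1 - a)) = a - (f + w1) := by abel
        rw [e, map_sub, om_self, map_add, LinearMap.add_apply, h.om hf ha, om_neg a w1]; ring
      rw [this]; simpa using hn)
    convert this using 1; abel

theorem L4 [FiniteDimensional F V] (h2 : (2 : F) ≠ 0) {X : Subgroup (V ≃ₗ[F] V)} (hX : X ≤ Sp F V)
    (hI : Irr X) {r : ℕ} {s : V ≃ₗ[F] V} {F0 W : Submodule F V} (h : Split r s F0 W) (hs : s ∈ X) (hne : F0 ≠ ⊥)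
    {σ : V ≃ₗ[F] V} (hσ : σ ∈ X) (hσF : ∀ v ∈ F0, σ v = v) (hσW : ∀ v ∈ W, σ v = -v)
    {x : V} {c : F} (hx : x ≠ 0) (hc : c ≠ 0) (ht : tv x c ∈ X) : Sp F V ≤ X := by
  let O : Set V := {y | ∃ g ∈ X, y = g x}
  have hOt : ∀ y ∈ O, tv y c ∈ X := by
    rintro _ ⟨g, hg, rfl⟩
    rw [← tv_conj (hX hg)]; exact X.mul_mem (X.mul_mem hg ht) (X.inv_mem hg)
  have hOinv : ∀ g ∈ X, ∀ y ∈ O, g y ∈ O := by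
    rintro g hg _ ⟨g', hg', rfl⟩
    exact ⟨g * g', X.mul_mem hg hg', rfl⟩
  have hO0 : ∀ y ∈ O, y ≠ 0 := by
    rintro _ ⟨g, hg, rfl⟩ h
    exact hx ((LinearEquiv.map_eq_zero_iff g).1 h)
  have hsp : Submodule.span F O = ⊤ := span_top hX hI hOinv ⟨1, X.one_mem, rfl⟩ hx
  by_cases hcase : ∃ y ∈ O, y ∉ F0 ∧ y ∉ W
  · obtain ⟨y, hyO, hyF, hyW⟩ := hcase
    obtain ⟨u, hu, w, hw, rfl⟩ := h.dec y
    have hw0 : w ≠ 0 := by rintro rfl; apply hyF; simpa using hu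
    have hu0 : u ≠ 0 := by rintro rfl; apply hyW; simpa using hw
    have h1 := hOt _ hyO
    have h3 := hOt _ (hOinv σ hσ _ hyO)
    rw [map_add, hσF u hu, hσW w hw] at h3
    refine L3 h2 hX hI h hs hu hu0 (w := (2 * c) • w) (W.smul_mem _ hw)
      (smul_ne_zero (mul_ne_zero h2 hc) hw0) (c := 0)
      ⟨_, X.mul_mem h1 (X.inv_mem h3), fun v => ?_⟩
    rw [mul_ap, tv_inv, tv_ap, tv_ap]
    simp only [map_add, map_neg, map_smul, LinearMap.add_apply, LinearMap.neg_apply,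
      LinearMap.smul_apply, smul_eq_mul, om_self, h.om hu hw, h.om' hu hw]
    module
  · push Not at hcase
    have e1 : ∃ y ∈ O, y ∈ F0 := by
      by_contra hn
      push Not at hn
      have : Submodule.span F O ≤ W := Submodule.span_le.2 fun y hy => hcase y hy (hn y hy)
      rw [hsp, top_le_iff] at this
      apply hne; rw [← h.perpW, this]
      rw [eq_bot_iff]; intro v hv; exact Symp.nd v fun w => (mem_perp'.1 hv) w trivial
    have e2 : ∃ y ∈ O, y ∈ W := by
      by_contra hn
      push Not at hn
      have : Submodule.span F O ≤ F0 := Submodule.span_le.2 fun y hy => by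
        by_contra hh; exact hn y hy (hcase y hy hh)
      rw [hsp] at this
      have h5 := Submodule.finrank_mono this
      have h6 := W.finrank_le
      have h7 := h.lt
      rw [finrank_top] at h5
      omega
    obtain ⟨x', ⟨g1, hg1, rfl⟩, hx'⟩ := e1
    obtain ⟨y, ⟨g2, hg2, rfl⟩, hy⟩ := e2
    have hW : W ≤ F0.map (g2 * g1⁻¹).toLinearMap := by
      refine L5 h hy (hO0 _ ⟨g2, hg2, rfl⟩) ⟨g1 x, hx', ?_⟩ fun i => ?_
      · simp
      · have hg : g2 * g1⁻¹ ∈ X := X.mul_mem hg2 (X.inv_mem hg1)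
        have hyi : (s ^ i) (g2 x) ∈ O := hOinv _ (X.pow_mem hs i) _ ⟨g2, hg2, rfl⟩
        have hz := hOinv _ (X.inv_mem hg) _ hyi
        by_cases hzF : (g2 * g1⁻¹)⁻¹ ((s ^ i) (g2 x)) ∈ F0
        · left; exact ⟨_, hzF, ap_inv _ _⟩
        · right
          have hzW := hcase _ hz hzF
          rintro _ ⟨f, hf, rfl⟩
          have := h.om hf hzW
          rw [← hX hg, ap_inv] at this
          exact this
    have h5 := Submodule.finrank_mono hW
    have h6 : finrank F (F0.map (g2 * g1⁻¹).toLinearMap) = finrank F F0 :=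
      LinearEquiv.finrank_map_eq (g2 * g1⁻¹) F0
    have h7 := h.lt
    omega
end P2

set_option autoImplicit false
section P3
open Polynomial

def Zs (p N r : ℕ) : Prop := r.Prime ∧ orderOf (p : ZMod r) = N

theorem Zs_cases {p N r : ℕ} (hN : 3 ≤ N) (hr : r.Prime)
    (hd : (r : ℤ) ∣ (cyclotomic N ℤ).eval (p : ℤ)) (hn : ¬ Zs p N r) :
    ∃ k m, N = r ^ k * m ∧ 0 < k ∧ m ∣ r - 1 ∧ (p : ZMod r) ^ m = 1 := by
  have : Fact r.Prime := ⟨hr⟩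
  obtain ⟨k, m, hm, hNm⟩ := Nat.exists_eq_pow_mul_and_not_dvd (n := N) (by omega) r hr.ne_one
  have : NeZero (m : ZMod r) := ⟨fun h => hm ((ZMod.natCast_eq_zero_iff _ _).1 h)⟩
  have hroot : (cyclotomic N (ZMod r)).IsRoot (p : ZMod r) := by
    rw [IsRoot.def, ← map_cyclotomic_int, eval_map]
    have h2 := Polynomial.eval₂_at_apply (p := cyclotomic N ℤ) (Int.castRingHom (ZMod r)) (p : ℤ)
    simp only [eq_intCast, Int.cast_natCast] at h2
    rw [h2, (ZMod.intCast_zmod_eq_zero_iff_dvd _ r)]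
    exact hd
  rw [hNm, isRoot_cyclotomic_prime_pow_mul_iff_of_charP] at hroot
  refine ⟨k, m, hNm, ?_, ?_, hroot.pow_eq_one⟩
  · rcases Nat.eq_zero_or_pos k with h | h
    · exfalso; apply hn; refine ⟨hr, ?_⟩
      rw [← hroot.eq_orderOf, hNm, h]; simp
    · exact h
  · rw [hroot.eq_orderOf]
    apply ZMod.orderOf_dvd_card_sub_one
    intro h0
    have h1 := hroot.pow_eq_one
    have hm0 : m ≠ 0 := by rintro rfl; exact hm (dvd_zero _)
    rw [h0, zero_pow hm0] at h1
    exact zero_ne_one h1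

theorem not_sq_dvd {r : ℕ} (hr : r.Prime) (x : ℤ) (hx : (r : ℤ) ∣ x - 1) (h2 : r = 2 → (4 : ℤ) ∣ x - 1) :
    ¬ (r : ℤ) ^ 2 ∣ ∑ i ∈ Finset.range r, x ^ i := by
  intro hc
  rcases hr.eq_two_or_odd' with rfl | ho
  · have h3 := h2 rfl
    simp [Finset.sum_range_succ] at hc
    omega
  · obtain ⟨b, hb⟩ := hx
    have := odd_sq_dvd_geom_sum₂_sub (R := ℤ) (a := 1) (b := b) ho
    rw [← hb] at this
    simp only [add_sub_cancel, one_pow, mul_one] at this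
    have h4 := (Int.dvd_iff_dvd_of_dvd_sub this).1 hc
    rw [pow_two] at h4
    have h5 : r * r ∣ r := by exact_mod_cast h4
    have := Nat.le_of_dvd hr.pos h5
    nlinarith [hr.two_le]

theorem zsig {p N : ℕ} (hp3 : 3 ≤ p) (ho : Odd p) (hN : 3 ≤ N) : ∃ r, Zs p N r := by
  by_contra hc
  push Not at hc
  have hbig := sub_one_pow_totient_lt_natAbs_cyclotomic_eval (n := N) (q := p) (by omega) (by omega)
  set Φ := (cyclotomic N ℤ).eval (p : ℤ) with hΦ
  have h1 : 1 < Φ.natAbs := lt_of_le_of_lt (Nat.one_le_pow _ _ (by omega)) hbig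
  set r := Φ.natAbs.minFac
  have hr : r.Prime := Nat.minFac_prime h1.ne'
  have hdv : ∀ {d : ℕ}, d ∣ Φ.natAbs → (d : ℤ) ∣ Φ := fun h => Int.natCast_dvd.2 h
  obtain ⟨k, m, hNm, hk, hm, hpm⟩ := Zs_cases hN hr (hdv (Nat.minFac_dvd _)) (hc r)
  have : Fact r.Prime := ⟨hr⟩
  have huniq : ∀ {d : ℕ}, d.Prime → d ∣ Φ.natAbs → d = r := by
    intro d hd hdd
    obtain ⟨k', m', hNm', hk', hm', -⟩ := Zs_cases hN hd (hdv hdd) (hc d)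
    by_contra hne
    have a1 : d ∣ m := by
      have : d ∣ r ^ k * m := by rw [← hNm, hNm']; exact (dvd_pow_self d hk'.ne').mul_right _
      refine (hd.dvd_mul.1 this).resolve_left fun h => hne ?_
      exact (Nat.prime_dvd_prime_iff_eq hd hr).1 (hd.dvd_of_dvd_pow h)
    have a2 : r ∣ m' := by
      have : r ∣ d ^ k' * m' := by rw [← hNm', hNm]; exact (dvd_pow_self r hk.ne').mul_right _
      refine (hr.dvd_mul.1 this).resolve_left fun h => hne ?_
      exact ((Nat.prime_dvd_prime_iff_eq hr hd).1 (hr.dvd_of_dvd_pow h)).symm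
    have b1 := Nat.le_of_dvd (by have := hr.two_le; omega) (a1.trans hm)
    have b2 := Nat.le_of_dvd (by have := hd.two_le; omega) (a2.trans hm')
    omega
  have hpow := Nat.eq_prime_pow_of_unique_prime_dvd (by omega) huniq
  obtain ⟨n, hn⟩ : r ∣ N := by rw [hNm]; exact (dvd_pow_self r hk.ne').mul_right _
  have hn0 : n ≠ 0 := by rintro rfl; omega
  have hmn : m ∣ n := by
    obtain ⟨k', rfl⟩ : ∃ k', k = k' + 1 := ⟨k - 1, by omega⟩
    have : r * n = r * (r ^ k' * m) := by rw [← hn, hNm]; ring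
    rw [Nat.eq_of_mul_eq_mul_left hr.pos this]; exact dvd_mul_left _ _
  have hxr : (r : ℤ) ∣ (p : ℤ) ^ n - 1 := by
    rw [← ZMod.intCast_zmod_eq_zero_iff_dvd]
    obtain ⟨t, rfl⟩ := hmn
    push_cast
    rw [pow_mul, hpm]; simp
  have hnsq : ¬ (r : ℤ) ^ 2 ∣ Φ := by
    intro hh
    refine not_sq_dvd hr ((p : ℤ) ^ n) hxr ?_ (hh.trans ?_)
    · intro hr2
      have hm1 : m = 1 := by rw [hr2] at hm; simpa using hm
      have hn2 : 2 ∣ n := by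
        have hn' : N = 2 * n := by rw [← hr2]; exact hn
        rw [hr2, hm1] at hNm
        obtain ⟨k', rfl⟩ : ∃ k', k = k' + 1 := ⟨k - 1, by omega⟩
        cases k' with
        | zero => simp at hNm; omega
        | succ k' => rw [pow_succ, pow_succ] at hNm; omega
      obtain ⟨t, rfl⟩ := hn2
      rw [pow_mul]
      obtain ⟨a, rfl⟩ := ho
      have : (4 : ℤ) ∣ ((2 * a + 1 : ℕ) : ℤ) ^ 2 - 1 := ⟨a * a + a, by push_cast; ring⟩
      exact this.trans (by simpa using sub_dvd_pow_sub_pow (((2 * a + 1 : ℕ) : ℤ) ^ 2) 1 t)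
    · have h7 := X_pow_sub_one_mul_cyclotomic_dvd_X_pow_sub_one_of_dvd ℤ (d := n) (n := N)
        (Nat.mem_properDivisors.2 ⟨⟨r, by rw [hn, mul_comm]⟩, by
          rw [hn]; have := hr.two_le; nlinarith [Nat.pos_of_ne_zero hn0]⟩)
      have h8 := eval_dvd (x := (p : ℤ)) h7
      simp only [eval_mul, eval_sub, eval_pow, eval_X, eval_one] at h8
      rw [← hΦ, hn, mul_comm r n, pow_mul, ← mul_geom_sum ((p : ℤ) ^ n) r] at h8
      refine (mul_dvd_mul_iff_left ?_).1 h8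
      have : 1 < (p : ℤ) ^ n := one_lt_pow₀ (by exact_mod_cast (by omega)) hn0
      omega
  have hlen : Φ.natAbs = r := by
    rcases Nat.lt_or_ge (Φ.natAbs.primeFactorsList.length) 2 with h | h
    · interval_cases hl : Φ.natAbs.primeFactorsList.length
      · rw [pow_zero] at hpow; omega
      · rw [pow_one] at hpow; exact hpow
    · exfalso; apply hnsq
      have : r ^ 2 ∣ Φ.natAbs := by
        conv_rhs => rw [hpow]
        exact pow_dvd_pow r h
      exact_mod_cast hdv this
  have htot : r - 1 ≤ N.totient := by
    rw [← Nat.totient_prime hr]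
    exact Nat.le_of_dvd (Nat.totient_pos.2 (by omega)) (Nat.totient_dvd_of_dvd ⟨n, hn⟩)
  have h9 : 2 ^ (r - 1) ≤ (p - 1) ^ N.totient :=
    (Nat.pow_le_pow_left (by omega) _).trans (Nat.pow_le_pow_right (by omega) htot)
  have h10 : r - 1 < 2 ^ (r - 1) := Nat.lt_two_pow_self
  omega

theorem Zs.dvd_iff {p N r : ℕ} (h : Zs p N r) (hp : 0 < p) (k : ℕ) : r ∣ p ^ k - 1 ↔ N ∣ k := by
  rw [← h.2, orderOf_dvd_iff_pow_eq_one, ← Nat.cast_pow, ← sub_eq_zero, ← ZMod.natCast_eq_zero_iff,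
    Nat.cast_sub (Nat.one_le_pow _ _ hp)]
  simp

theorem Zs.lt {p N r : ℕ} (h : Zs p N r) (hN : 0 < N) : N < r := by
  have : Fact r.Prime := ⟨h.1⟩
  have h1 : N ∣ r - 1 := by
    rw [← h.2]; apply ZMod.orderOf_dvd_card_sub_one
    intro h0
    have h2 := h.2
    have h3 := pow_orderOf_eq_one (p : ZMod r)
    rw [h2, h0, zero_pow hN.ne'] at h3
    exact zero_ne_one h3
  have := Nat.le_of_dvd (by have := h.1.two_le; omega) h1
  have := h.1.two_le; omega

theorem Zs.ne {p N r : ℕ} (h : Zs p N r) (hN : 0 < N) : r ≠ p := by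
  rintro rfl
  have : Fact r.Prime := ⟨h.1⟩
  have h3 := pow_orderOf_eq_one (r : ZMod r)
  rw [h.2] at h3
  simp [zero_pow hN.ne'] at h3
end P3

set_option linter.unusedSectionVars false
set_option linter.unusedSimpArgs false
set_option linter.unusedVariables false
set_option autoImplicit false
section P4
open Module
variable {F V : Type*} [Field F] [AddCommGroup V] [Module F V]

theorem card_fix [Finite V] {ℓ n : ℕ} (hl : ℓ.Prime) (g : V ≃ₗ[F] V) (hg : g ^ ℓ ^ n = 1)
    (Y Z : AddSubgroup V) (hY : ∀ y ∈ Y, g y ∈ Y) (hZ : ∀ z, z ∈ Z ↔ z ∈ Y ∧ g z = z) :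
    Nat.card Y ≡ Nat.card Z [MOD ℓ] := by
  classical
  have : Fact ℓ.Prime := ⟨hl⟩
  have : Fintype V := Fintype.ofFinite V
  let f : Function.End Y := fun y => ⟨g y, hY y y.2⟩
  have hf : ∀ k : ℕ, ∀ y : Y, ((f ^ k) y : V) = (g ^ k) (y : V) := by
    intro k
    induction k with
    | zero => intro y; rfl
    | succ k ih =>
      intro y
      rw [pow_succ, pow_succ, mul_ap]
      exact ih (f y)
  have h1 := Equiv.Perm.card_fixedPoints_modEq (f := f) (p := ℓ) (n := n) (by
    funext y; apply Subtype.ext; rw [hf, hg]; rfl)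
  rw [← Nat.card_eq_fintype_card, ← Nat.card_eq_fintype_card] at h1
  have e : f.fixedPoints ≃ Z :=
    { toFun := fun y => ⟨y.1.1, (hZ _).2 ⟨y.1.2, congrArg Subtype.val y.2⟩⟩
      invFun := fun z => ⟨⟨z.1, ((hZ _).1 z.2).1⟩, Subtype.ext ((hZ _).1 z.2).2⟩
      left_inv := fun y => rfl
      right_inv := fun y => rfl }
  rwa [Nat.card_congr e] at h1

variable [Symp F V] [Finite F] [FiniteDimensional F V]
local notation "ω" => Symp.ω (F := F) (V := V)

theorem lemZ {p e a m r : ℕ} (hp : p.Prime) [CharP F p] (hq : Nat.card F = p ^ e) (he : 0 < e)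
    (ha : 0 < a) (hm : m < 2 * a)
    (hr : Zs p (2 * a * e) r) (hV : finrank F V = 2 * m) {ρ : V ≃ₗ[F] V} (hρ : ρ ∈ Sp F V)
    (h1 : ρ ≠ 1) (hpw : ρ ^ r = 1) :
    Split r ρ (fx ρ) (perp (fx ρ)) ∧ finrank F (fx ρ) + 2 * a = 2 * m := by
  have : Finite V := Module.finite_of_finite F
  have hae : 0 < 2 * a * e := by positivity
  have hcardV : Nat.card V = p ^ (e * (2 * m)) := by
    rw [Module.natCard_eq_pow_finrank (K := F) (V := V), hq, hV, ← pow_mul]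
  have hrF : (r : F) ≠ 0 := by
    rw [Ne, CharP.cast_eq_zero_iff F p]
    intro h
    exact hr.ne hae ((Nat.prime_dvd_prime_iff_eq hp hr.1).1 h).symm
  have hperp : perp (fx ρ) = LinearMap.range (ρ.toLinearMap - LinearMap.id) := by
    symm
    apply Submodule.eq_of_le_of_finrank_eq
    · rintro _ ⟨v, rfl⟩
      rw [mem_perp']
      intro f hf
      have := hρ v f
      rw [mem_fx.1 hf] at this
      simp [this]
    · have h2 := LinearMap.finrank_range_add_finrank_ker (ρ.toLinearMap - LinearMap.id)
      have h3 := finrank_perp (fx ρ)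
      unfold fx at h3 ⊢
      omega
  have hinf : ∀ v, v ∈ fx ρ → v ∈ perp (fx ρ) → v = 0 := by
    intro v hv hv'
    rw [hperp] at hv'
    obtain ⟨z, hz⟩ := hv'
    have hz : ρ z = z + v := by rw [← hz]; simp
    have : ∀ k : ℕ, (ρ ^ k) z = z + (k : F) • v := by
      intro k
      induction k with
      | zero => simp
      | succ k ih => rw [pow_succ', mul_ap, ih, map_add, map_smul, hz, mem_fx.1 hv]; push_cast; module
    have h2 := this r
    rw [hpw, one_ap] at h2
    exact (smul_eq_zero.1 (left_eq_add.1 h2)).resolve_left hrF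
  have hdisj : Disjoint (fx ρ) (perp (fx ρ)) := Submodule.disjoint_def.2 fun v h h' => hinf v h h'
  have hsum := finrank_perp (fx ρ)
  have hsup : fx ρ ⊔ perp (fx ρ) = ⊤ := by
    apply Submodule.eq_top_of_finrank_eq
    have := Submodule.finrank_sup_add_finrank_inf_eq (fx ρ) (perp (fx ρ))
    rw [hdisj.eq_bot, finrank_bot] at this
    omega
  have hinv : ∀ v ∈ perp (fx ρ), ρ v ∈ perp (fx ρ) := by
    intro v hv f hf
    rw [← mem_fx.1 hf, hρ]; exact hv f hf
  have hY : ∀ Y : AddSubgroup V, (∀ y ∈ Y, y ∈ perp (fx ρ)) → (∀ y ∈ Y, ρ y ∈ Y) →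
      ∃ k, Nat.card Y = p ^ (2 * a * e * k) := by
    intro Y hYW hYi
    have h2 := card_fix hr.1 ρ (n := 1) (by rwa [pow_one]) Y ⊥ hYi (fun z => by
      rw [AddSubgroup.mem_bot]
      constructor
      · rintro rfl; exact ⟨Y.zero_mem, map_zero _⟩
      · rintro ⟨h3, h4⟩; exact hinf z (mem_fx.2 h4) (hYW z h3))
    have h3 := AddSubgroup.card_addSubgroup_dvd_card Y
    rw [hcardV, Nat.dvd_prime_pow hp] at h3
    obtain ⟨k, -, hk⟩ := h3
    rw [AddSubgroup.card_bot, hk] at h2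
    have h4 := (Nat.modEq_iff_dvd' (Nat.one_le_pow _ _ hp.pos)).1 h2.symm
    rw [hr.dvd_iff hp.pos] at h4
    obtain ⟨k', rfl⟩ := h4
    exact ⟨k', hk⟩
  have hcW : Nat.card (perp (fx ρ)) = p ^ (e * finrank F (perp (fx ρ))) := by
    rw [Module.natCard_eq_pow_finrank (K := F) (V := perp (fx ρ)), hq, pow_mul]
  have hdim : finrank F (perp (fx ρ)) = 2 * a := by
    obtain ⟨k, hk⟩ := hY (perp (fx ρ)).toAddSubgroup (fun y hy => hy) hinv
    have h5 : p ^ (e * finrank F (perp (fx ρ))) = p ^ (2 * a * e * k) := by rw [← hk, ← hcW]; rfl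
    have h6 := Nat.pow_right_injective hp.two_le h5
    have h7 : finrank F (perp (fx ρ)) = 2 * a * k :=
      Nat.eq_of_mul_eq_mul_left he (by rw [h6]; ring)
    have hk0 : k ≠ 0 := by
      rintro rfl
      apply h1
      have : fx ρ = ⊤ := Submodule.eq_top_of_finrank_eq (by omega)
      ext v; exact mem_fx.1 (this ▸ Submodule.mem_top)
    have hk2 : k < 2 := by
      by_contra hc
      push Not at hc
      have : 2 * a * 2 ≤ 2 * a * k := Nat.mul_le_mul_left _ hc
      omega
    have : k = 1 := by omega
    rw [h7, this, mul_one]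
  refine ⟨⟨hr.1, hρ, hpw, perp_perp _, rfl, hinf, ?_, fun v hv => mem_fx.1 hv, hinv, ?_, by omega,
    fun v hv => mem_fx.2 hv⟩, by omega⟩
  · intro v
    have : v ∈ fx ρ ⊔ perp (fx ρ) := by rw [hsup]; trivial
    obtain ⟨f, hf, w, hw, e⟩ := Submodule.mem_sup.1 this
    exact ⟨f, hf, w, hw, e.symm⟩
  · intro Y hYW hYi
    obtain ⟨k, hk⟩ := hY Y hYW hYi
    have hle : Y ≤ (perp (fx ρ)).toAddSubgroup := hYW
    have hcc : Nat.card (perp (fx ρ)).toAddSubgroup = p ^ (2 * a * e) := by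
      show Nat.card (perp (fx ρ)) = _
      rw [hcW, hdim]; congr 1; ring
    rcases Nat.eq_zero_or_pos k with rfl | hk0
    · left
      rw [mul_zero, pow_zero, AddSubgroup.card_eq_one] at hk
      rw [hk]; intro y hy; exact hy
    · right
      have : Y = (perp (fx ρ)).toAddSubgroup := by
        apply AddSubgroup.eq_of_le_of_card_ge hle
        rw [hk, hcc]
        exact Nat.pow_le_pow_right hp.pos (Nat.le_mul_of_pos_right _ hk0)
      rw [this]; intro w hw; exact hw

theorem triv_W {p k r : ℕ} (hp : p.Prime) [CharP F p] {s : V ≃ₗ[F] V} {F0 W : Submodule F V}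
    (h : Split r s F0 W) {g : V ≃ₗ[F] V} (hc : Commute g s) (hg : g ∈ Sp F V)
    (hpk : g ^ p ^ k = 1) : ∀ w ∈ W, g w = w := by
  have : Finite V := Module.finite_of_finite F
  have hcv : ∀ v, g (s v) = s (g v) := fun v => by rw [← mul_ap, hc.eq, mul_ap]
  have hcF : ∀ f ∈ F0, g⁻¹ f ∈ F0 := fun f hf => h.fix' _ (by
    have := hcv (g⁻¹ f)
    rw [ap_inv, h.fix f hf] at this
    exact (inv_ap_iff.2 this.symm).symm)
  have hgW : ∀ w ∈ W, g w ∈ W := fun w hw => by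
    rw [← h.perpF, mem_perp]
    intro f hf
    have := h.om (hcF f hf) hw
    rwa [Sp_inv_om hg] at this
  let Y : AddSubgroup V :=
    { carrier := {y | y ∈ W ∧ g y = y}
      zero_mem' := ⟨W.zero_mem, map_zero _⟩
      add_mem' := fun {a b} ha hb => ⟨W.add_mem ha.1 hb.1, by rw [map_add, ha.2, hb.2]⟩
      neg_mem' := fun {a} ha => ⟨W.neg_mem ha.1, by rw [map_neg, ha.2]⟩ }
  rcases h.irr Y (fun y hy => hy.1) (fun y hy => ⟨h.inv y hy.1, by rw [hcv, hy.2]⟩) with h1 | h1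
  · exfalso
    have h2 := card_fix hp g hpk W.toAddSubgroup Y hgW (fun z => Iff.rfl)
    have hb : Y = ⊥ := (AddSubgroup.eq_bot_iff_forall Y).2 h1
    rw [hb, AddSubgroup.card_bot] at h2
    have h3 : Nat.card W.toAddSubgroup = Nat.card F ^ finrank F W :=
      Module.natCard_eq_pow_finrank (K := F) (V := W)
    have h4 : p ∣ Nat.card F := by
      rw [← CharP.cast_eq_zero_iff F p]
      have := Fintype.ofFinite F
      rw [Nat.card_eq_fintype_card]; exact FiniteField.cast_card_eq_zero F
    have h5 : p ∣ Nat.card W.toAddSubgroup := by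
      rw [h3]; exact dvd_pow h4 (by have := h.lt; omega)
    have h6 := (Nat.modEq_zero_iff_dvd.2 h5).symm.trans h2
    exact hp.ne_one (Nat.dvd_one.1 ((Nat.modEq_zero_iff_dvd).1 h6.symm))
  · exact fun w hw => (h1 w hw).2
end P4

set_option linter.unusedSectionVars false
set_option linter.unusedSimpArgs false
set_option linter.unusedVariables false
set_option autoImplicit false
section P5
open Module

section
variable {F V : Type*} [Field F] [AddCommGroup V] [Module F V] [Symp F V]
local notation "ω" => Symp.ω (F := F) (V := V)

def HF {ι : Type} [DecidableEq ι] (x y : ι → V) : Prop :=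
  ∀ i j, ω (x i) (x j) = 0 ∧ ω (y i) (y j) = 0 ∧ ω (x i) (y j) = if i = j then (1 : F) else 0

theorem HF.yx {ι : Type} [DecidableEq ι] {x y : ι → V} (h : HF (F := F) x y) (i j : ι) :
    ω (y i) (x j) = if i = j then (-1 : F) else 0 := by
  rw [om_neg, (h j i).2.2]
  by_cases hij : i = j
  · simp [hij]
  · rw [if_neg hij, if_neg (Ne.symm hij)]; simp

theorem HF.coef {ι : Type} [Fintype ι] [DecidableEq ι] {x y : ι → V} (h : HF (F := F) x y)
    (c d : ι → F) (j : ι) : ω (∑ i, c i • x i + ∑ i, d i • y i) (y j) = c j ∧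
    ω (x j) (∑ i, c i • x i + ∑ i, d i • y i) = d j := by
  constructor
  · simp [map_sum, LinearMap.sum_apply, (h _ j).2.1, (h _ j).2.2]
  · simp [map_sum, LinearMap.sum_apply, (h j _).1, (h j _).2.2]

theorem HF.li {ι : Type} [Fintype ι] [DecidableEq ι] {x y : ι → V} (h : HF (F := F) x y) :
    LinearIndependent F (Sum.elim x y) := by
  rw [Fintype.linearIndependent_iff]
  intro g hg
  rw [Fintype.sum_sum_type] at hg
  simp only [Sum.elim_inl, Sum.elim_inr] at hg
  have h1 := fun j => h.coef (fun i => g (.inl i)) (fun i => g (.inr i)) j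
  rw [hg] at h1
  rintro (i | i)
  · rw [← (h1 i).1]; simp
  · rw [← (h1 i).2]; simp

theorem HF.exists [FiniteDimensional F V] (k : ℕ) : 2 * k ≤ finrank F V + 1 →
    ∃ (ι : Type) (_ : Fintype ι) (_ : DecidableEq ι) (x y : ι → V), Fintype.card ι = k ∧
      HF (F := F) x y := by
  induction k with
  | zero => intro _; exact ⟨Empty, inferInstance, inferInstance, nofun, nofun, by simp, nofun⟩
  | succ k ih =>
    intro hk
    obtain ⟨ι, hι, hd, x, y, hc, h⟩ := ih (by omega)
    let S := Submodule.span F (Set.range (Sum.elim x y))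
    have hS : finrank F S ≤ 2 * k := by
      have := finrank_range_le_card (R := F) (Sum.elim x y)
      rw [Fintype.card_sum, hc] at this
      unfold Set.finrank at this
      change finrank F S ≤ _ at this
      omega
    have hxS : ∀ i, x i ∈ S := fun i => Submodule.subset_span ⟨.inl i, rfl⟩
    have hyS : ∀ i, y i ∈ S := fun i => Submodule.subset_span ⟨.inr i, rfl⟩
    have hp := finrank_perp S
    obtain ⟨v, hv, hv0⟩ : ∃ v ∈ perp S, v ≠ 0 := by
      apply Submodule.exists_mem_ne_zero_of_ne_bot
      intro hb; rw [hb, finrank_bot] at hp; omega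
    obtain ⟨w, hw, hvw⟩ : ∃ w ∈ perp S, ω v w ≠ 0 := by
      apply not_mem_perp
      rw [perp_perp]
      intro hvS
      obtain ⟨c, hcv⟩ := (Submodule.mem_span_range_iff_exists_fun F).1 hvS
      rw [Fintype.sum_sum_type] at hcv
      simp only [Sum.elim_inl, Sum.elim_inr] at hcv
      have h1 := fun j => h.coef (fun i => c (.inl i)) (fun i => c (.inr i)) j
      rw [hcv] at h1
      apply hv0
      rw [← hcv]
      have e1 : ∀ i, c (.inl i) = 0 := fun i => by rw [← (h1 i).1]; exact mem_perp'.1 hv _ (hyS i)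
      have e2 : ∀ i, c (.inr i) = 0 := fun i => by rw [← (h1 i).2]; exact mem_perp.1 hv _ (hxS i)
      simp [e1, e2]
    refine ⟨Option ι, inferInstance, inferInstance, fun o => o.elim v x,
      fun o => o.elim ((ω v w)⁻¹ • w) y, by simp [hc], ?_⟩
    rintro (_ | i) (_ | j)
    · simp [om_self, inv_mul_cancel₀ hvw]
    · simp [mem_perp'.1 hv _ (hxS j), mem_perp'.1 hv _ (hyS j), mem_perp'.1 hw _ (hyS j)]
    · simp [mem_perp.1 hv _ (hxS i), mem_perp.1 hw _ (hxS i), mem_perp.1 hw _ (hyS i)]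
    · simpa using h i j
end

theorem exists_isom {F V V' : Type*} [Field F] [AddCommGroup V] [Module F V] [Symp F V]
    [AddCommGroup V'] [Module F V'] [Symp F V'] [FiniteDimensional F V] [FiniteDimensional F V']
    (h : finrank F V = finrank F V') : ∃ e : V ≃ₗ[F] V',
    ∀ v w, Symp.ω (F := F) (e v) (e w) = Symp.ω (F := F) v w := by
  obtain ⟨ι, _, _, x, y, hc, hxy⟩ := HF.exists (F := F) (V := V) ((finrank F V + 1) / 2) (by omega)
  obtain ⟨ι', _, _, x', y', hc', hxy'⟩ :=
    HF.exists (F := F) (V := V') ((finrank F V + 1) / 2) (by omega)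
  have h1 := hxy.li.fintype_card_le_finrank
  rw [Fintype.card_sum] at h1
  have hb : Fintype.card (ι ⊕ ι) = finrank F V := by rw [Fintype.card_sum]; omega
  have hb' : Fintype.card (ι' ⊕ ι') = finrank F V' := by rw [Fintype.card_sum]; omega
  let b := basisOfLinearIndependentOfCardEqFinrank' _ hxy.li hb
  let b' := basisOfLinearIndependentOfCardEqFinrank' _ hxy'.li hb'
  have hbx : ∀ i, b i = Sum.elim x y i := fun i => by simp [b]
  have hbx' : ∀ i, b' i = Sum.elim x' y' i := fun i => by simp [b']
  let s : ι ≃ ι' := Fintype.equivOfCardEq (by omega)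
  let e := b.equiv b' (Equiv.sumCongr s s)
  have he : ∀ i, e (b i) = b' (Equiv.sumCongr s s i) := fun i => Basis.equiv_apply _ _ _ _
  have hω : (Symp.ω (F := F) (V := V')).compl₁₂ e.toLinearMap e.toLinearMap
      = Symp.ω (F := F) (V := V) := by
    apply LinearMap.ext_basis b b
    intro i j
    rw [LinearMap.compl₁₂_apply, LinearEquiv.coe_coe, he, he, hbx', hbx', hbx, hbx]
    rcases i with i | i <;> rcases j with j | j
    · simp [(hxy _ _).1, (hxy' _ _).1]
    · simp [(hxy _ _).2.2, (hxy' _ _).2.2]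
    · simp [hxy.yx, hxy'.yx]
    · simp [(hxy _ _).2.1, (hxy' _ _).2.1]
  refine ⟨e, fun v w => ?_⟩
  rw [← hω]; rfl

instance stdSymp (b : ℕ) (F : Type*) [Field F] : Symp F (Fin b ⊕ Fin b → F) where
  ω := LinearMap.mk₂ F (fun v w => ∑ i, (v (.inr i) * w (.inl i) - v (.inl i) * w (.inr i)))
    (fun a b c => by
      rw [← Finset.sum_add_distrib]
      refine Finset.sum_congr rfl fun i _ => ?_
      simp only [Pi.add_apply]
      ring)
    (fun a b c => by
      rw [smul_eq_mul, Finset.mul_sum]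
      refine Finset.sum_congr rfl fun i _ => ?_
      simp only [Pi.smul_apply, smul_eq_mul]
      ring)
    (fun a b c => by
      rw [← Finset.sum_add_distrib]
      refine Finset.sum_congr rfl fun i _ => ?_
      simp only [Pi.add_apply]
      ring)
    (fun a b c => by
      rw [smul_eq_mul, Finset.mul_sum]
      refine Finset.sum_congr rfl fun i _ => ?_
      simp only [Pi.smul_apply, smul_eq_mul]
      ring)
  alt v := by
    rw [LinearMap.mk₂_apply]; exact Finset.sum_eq_zero fun i _ => by ring
  nd v h := by
    funext i
    rcases i with i | i
    · have := h (Pi.single (.inr i) 1)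
      rw [LinearMap.mk₂_apply] at this
      simpa [Pi.single_apply] using this
    · have := h (Pi.single (.inl i) 1)
      rw [LinearMap.mk₂_apply] at this
      simpa [Pi.single_apply] using this

theorem std_om (b : ℕ) (F : Type*) [Field F] (v w : Fin b ⊕ Fin b → F) :
    Symp.ω (F := F) v w = ∑ i, (v (.inr i) * w (.inl i) - v (.inl i) * w (.inr i)) := rfl

instance prodSymp (F V V' : Type*) [Field F] [AddCommGroup V] [Module F V] [Symp F V]
    [AddCommGroup V'] [Module F V'] [Symp F V'] : Symp F (V × V') where
  ω := (Symp.ω (F := F) (V := V)).compl₁₂ (LinearMap.fst F V V') (LinearMap.fst F V V') +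
    (Symp.ω (F := F) (V := V')).compl₁₂ (LinearMap.snd F V V') (LinearMap.snd F V V')
  alt v := by simp [om_self]
  nd v h := by
    apply Prod.ext
    · exact Symp.nd (F := F) _ fun w => by simpa using h (w, 0)
    · exact Symp.nd (F := F) _ fun w => by simpa using h (0, w)

theorem prod_om {F V V' : Type*} [Field F] [AddCommGroup V] [Module F V] [Symp F V]
    [AddCommGroup V'] [Module F V'] [Symp F V'] (v w : V × V') :
    Symp.ω (F := F) v w = Symp.ω (F := F) v.1 w.1 + Symp.ω (F := F) v.2 w.2 := rfl

section
variable {F M V : Type*} [Field F] [AddCommGroup M] [Module F M] [AddCommGroup V] [Module F V]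

/-- transport along a linear equivalence -/
def trp (e : M ≃ₗ[F] V) : (M ≃ₗ[F] M) →* (V ≃ₗ[F] V) where
  toFun g := (e.symm.trans g).trans e
  map_one' := by ext v; simp
  map_mul' g h := by ext v; simp

theorem trp_ap (e : M ≃ₗ[F] V) (g : M ≃ₗ[F] M) (x : M) : trp e g (e x) = e (g x) := by
  simp [trp]
theorem trp_mem [Symp F M] [Symp F V] {e : M ≃ₗ[F] V}
    (he : ∀ v w, Symp.ω (F := F) (e v) (e w) = Symp.ω (F := F) v w) {g : M ≃ₗ[F] M}
    (hg : g ∈ Sp F M) : trp e g ∈ Sp F V := by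
  intro v w
  obtain ⟨v, rfl⟩ := e.surjective v
  obtain ⟨w, rfl⟩ := e.surjective w
  rw [trp_ap, trp_ap, he, he, hg]
theorem trp_inj (e : M ≃ₗ[F] V) {g : M ≃ₗ[F] M} (h : trp e g = 1) : g = 1 := by
  ext x
  apply e.injective
  rw [← trp_ap, h]; rfl

variable {M' : Type*} [AddCommGroup M'] [Module F M']
def pr (g : M ≃ₗ[F] M) (h : M' ≃ₗ[F] M') : (M × M') ≃ₗ[F] (M × M') := LinearEquiv.prodCongr g h
@[simp] theorem pr_ap (g : M ≃ₗ[F] M) (h : M' ≃ₗ[F] M') (x : M × M') : pr g h x = (g x.1, h x.2) := rfl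
theorem pr_mul (g g' : M ≃ₗ[F] M) (h h' : M' ≃ₗ[F] M') : pr g h * pr g' h' = pr (g * g') (h * h') := rfl
theorem pr_one : pr (1 : M ≃ₗ[F] M) (1 : M' ≃ₗ[F] M') = 1 := rfl
theorem pr_pow (g : M ≃ₗ[F] M) (h : M' ≃ₗ[F] M') (n : ℕ) : pr g h ^ n = pr (g ^ n) (h ^ n) := by
  induction n with
  | zero => rfl
  | succ n ih => rw [pow_succ, ih, pr_mul]; rfl
theorem pr_mem [Symp F M] [Symp F M'] {g : M ≃ₗ[F] M} {h : M' ≃ₗ[F] M'} (hg : g ∈ Sp F M)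
    (hh : h ∈ Sp F M') : pr g h ∈ Sp F (M × M') := fun v w => by
  rw [pr_ap, pr_ap, prod_om, prod_om, hg, hh]
end
end P5

set_option linter.unusedSectionVars false
set_option linter.unusedSimpArgs false
set_option linter.unusedVariables false
set_option autoImplicit false
section P6
open Module

section
variable {F K : Type*} [Field F] [Field K] [Algebra F K]
/-- multiplication by a unit -/
def mu (F : Type*) {K : Type*} [Field F] [Field K] [Algebra F K] : Kˣ →* (K ≃ₗ[F] K) := DistribMulAction.toModuleAut F K
theorem mu_ap (u : Kˣ) (x : K) : mu F u x = u * x := rfl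

variable [Finite F] [FiniteDimensional F K]
theorem tr_nd (x : K) (h : ∀ y, Algebra.trace F K (x * y) = 0) : x = 0 := by
  have h1 := traceForm_nondegenerate F K
  exact h1.1 x fun y => by rw [Algebra.traceForm_apply]; exact h y

@[reducible] noncomputable def hermSymp (h2 : (2 : F) ≠ 0) (c : K ≃ₐ[F] K) (hc : ∀ x, c (c x) = x) (δ : K) (hδ : δ ≠ 0)
    (hcδ : c δ = -δ) : Symp F K where
  ω := LinearMap.mk₂ F (fun x y => Algebra.trace F K (δ * x * c y))
    (fun a b d => by rw [← map_add]; congr 1; ring)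
    (fun a b d => by rw [← map_smul]; congr 1; rw [mul_smul_comm, smul_mul_assoc])
    (fun a b d => by rw [← map_add, map_add]; congr 1; ring)
    (fun a b d => by rw [← map_smul, map_smul]; congr 1; rw [mul_smul_comm])
  alt v := by
    rw [LinearMap.mk₂_apply]
    have h := Algebra.trace_eq_of_algEquiv c (δ * v * c v)
    rw [map_mul c, map_mul c, hc, hcδ, show -δ * c v * v = -(δ * v * c v) by ring, map_neg] at h
    have : (2 : F) * Algebra.trace F K (δ * v * c v) = 0 := by linear_combination - h
    exact (mul_eq_zero.1 this).resolve_left h2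
  nd v h := by
    have : δ * v = 0 := tr_nd (F := F) _ fun y => by
      have := h (c y)
      rwa [LinearMap.mk₂_apply, hc] at this
    exact (mul_eq_zero.1 this).resolve_left hδ

@[reducible] noncomputable def hypSymp (c : K ≃ₐ[F] K) (hc : ∀ x, c (c x) = x) : Symp F (K × K) where
  ω := LinearMap.mk₂ F (fun x y => Algebra.trace F K (x.1 * c y.2 - c x.2 * y.1))
    (fun a b d => by rw [← map_add]; congr 1; simp; ring)
    (fun a b d => by rw [← map_smul]; congr 1; simp [smul_sub])
    (fun a b d => by rw [← map_add]; congr 1; simp; ring)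
    (fun a b d => by rw [← map_smul]; congr 1; simp [smul_sub])
  alt v := by
    rw [LinearMap.mk₂_apply, map_sub]
    have h := Algebra.trace_eq_of_algEquiv c (v.1 * c v.2)
    rw [map_mul c, hc] at h
    rw [mul_comm (c v.2) v.1, ← h, mul_comm (c v.1), sub_self]
  nd v h := by
    apply Prod.ext
    · exact tr_nd (F := F) _ fun y => by
        have := h (0, c y)
        rw [LinearMap.mk₂_apply, hc] at this
        simpa using this
    · have : c v.2 = 0 := tr_nd (F := F) _ fun y => by
        have := h (y, 0)
        rw [LinearMap.mk₂_apply] at this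
        simpa using this
      simpa using this
end

section
variable {F : Type*} [Field F] [Finite F] {p : ℕ} [CharP F p]
theorem exK (hp : p.Prime) (n i : ℕ) (hn : 0 < n) : ∃ (K : Type) (_ : Field K) (_ : Algebra F K)
    (_ : FiniteDimensional F K) (_ : Finite K), finrank F K = n ∧ (∃ g : Kˣ, orderOf g = Nat.card F ^ n - 1) ∧
      ∃ c : K ≃ₐ[F] K, (∀ x, c x = x ^ Nat.card F ^ i) ∧ (n = 2 * i → ∀ x, c (c x) = x) := by
  have : Fact p.Prime := ⟨hp⟩
  have : NeZero n := ⟨hn.ne'⟩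
  refine ⟨FiniteField.Extension F p n, inferInstance, inferInstance, inferInstance, inferInstance,
    FiniteField.finrank_extension F p n, ?_, FiniteField.Extension.frob F p n ^ i, ?_, ?_⟩
  · obtain ⟨g, hg⟩ := IsCyclic.exists_ofOrder_eq_natCard (α := (FiniteField.Extension F p n)ˣ)
    exact ⟨g, by rw [hg, Nat.card_units, FiniteField.natCard_extension]⟩
  · intro x; exact FiniteField.Extension.frob_iterate_apply F p n i
  · intro h x
    rw [FiniteField.Extension.frob_iterate_apply, FiniteField.Extension.frob_iterate_apply, ← pow_mul, ← pow_add, ← two_mul, ← h]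
    rw [← FiniteField.natCard_extension F p n]
    have : Fintype (FiniteField.Extension F p n) := Fintype.ofFinite _
    rw [Nat.card_eq_fintype_card]
    exact FiniteField.pow_card x

variable {V : Type*} [AddCommGroup V] [Module F V] [Symp F V] [FiniteDimensional F V]

theorem q_odd (hp : p.Prime) (h2 : (2 : F) ≠ 0) : Odd (Nat.card F) ∧ 3 ≤ Nat.card F := by
  have : Fintype F := Fintype.ofFinite _
  have h0 : 1 < Nat.card F := Finite.one_lt_card
  have h1 : Odd (Nat.card F) := by
    rw [Nat.card_eq_fintype_card]
    rw [Nat.odd_iff]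
    apply FiniteField.odd_card_of_char_ne_two
    rw [ringChar.eq_iff.2 (inferInstance : CharP F p)]
    rintro rfl
    exact h2 (by exact_mod_cast CharP.cast_eq_zero F 2)
  refine ⟨h1, ?_⟩
  obtain ⟨k, hk⟩ := h1
  omega

theorem ML1 (hp : p.Prime) (h2 : (2 : F) ≠ 0) {a : ℕ} (ha : 0 < a) (hV : finrank F V = 2 * a) :
    ∃ s ∈ Sp F V, s ^ (Nat.card F ^ a + 1) = 1 ∧ ∀ (k : ℕ) (v : V) (c : F), v ≠ 0 → (s ^ k) v = c • v →
      Nat.card F ^ a + 1 ∣ 2 * k ∧ (c = 1 → Nat.card F ^ a + 1 ∣ k) := by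
  obtain ⟨K, _, _, _, _, hK, ⟨g, hg⟩, c, hc, hcc⟩ := exK (F := F) hp (2 * a) a (by omega)
  replace hcc := hcc rfl
  obtain ⟨hodd, hq3⟩ := q_odd (F := F) hp h2
  set q := Nat.card F with hq
  have hqa : 3 ≤ q ^ a := le_trans hq3 (Nat.le_self_pow ha.ne' q)
  have hfac : q ^ (2 * a) - 1 = (q ^ a + 1) * (q ^ a - 1) := by
    rw [mul_comm 2 a, pow_mul, ← one_pow 2, Nat.sq_sub_sq, one_pow]
  let z := g ^ (q ^ a - 1)
  have hz : orderOf z = q ^ a + 1 := by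
    have hpos : 0 < q ^ a - 1 := by omega
    rw [orderOf_pow_of_dvd (by omega) (by rw [hg, hfac]; exact dvd_mul_left _ _), hg, hfac,
      Nat.mul_div_cancel _ hpos]
  have hcz : c (z : K) * z = 1 := by
    rw [hc, ← pow_succ]
    have := pow_orderOf_eq_one z
    rw [hz] at this
    rw [← Units.val_pow_eq_pow_val, this, Units.val_one]
  have hcg : c (g : K) ≠ g := by
    rw [hc]
    intro h
    have h1 : g ^ q ^ a = g := by exact_mod_cast h
    have h3 : g ^ (q ^ a - 1) = 1 := by
      have : g ^ (q ^ a - 1) * g = 1 * g := by rw [← pow_succ, one_mul, Nat.sub_add_cancel (by omega), h1]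
      exact mul_right_cancel this
    have : orderOf z = 1 := by rw [orderOf_eq_one_iff]; exact h3
    omega
  let S : Symp F K := hermSymp h2 c hcc ((g : K) - c g) (sub_ne_zero.2 (Ne.symm hcg)) (by simp [hcc])
  obtain ⟨e, he⟩ := exists_isom (F := F) (V := K) (V' := V) (by omega)
  refine ⟨trp e (mu F z), trp_mem he ?_, ?_, ?_⟩
  · intro v w
    change Algebra.trace F K _ = Algebra.trace F K _
    congr 1
    rw [mu_ap, mu_ap, map_mul]
    linear_combination ((g : K) - c g) * v * c w * hcz
  · rw [← map_pow, ← map_pow, ← hz, pow_orderOf_eq_one, map_one, map_one]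
  · intro k v d hv h
    obtain ⟨x, rfl⟩ := e.surjective v
    have hx : x ≠ 0 := by rintro rfl; simp at hv
    rw [← map_pow, trp_ap, ← map_smul, ← map_pow] at h
    have h := e.injective h
    rw [mu_ap, Algebra.smul_def] at h
    have h := mul_right_cancel₀ hx h
    rw [Units.val_pow_eq_pow_val] at h
    rw [← hz]
    refine ⟨?_, ?_⟩
    · apply orderOf_dvd_of_pow_eq_one
      have h3 := congrArg c h
      rw [AlgEquiv.commutes, ← h, map_pow] at h3
      apply Units.ext
      rw [mul_comm, pow_mul, Units.val_pow_eq_pow_val, Units.val_pow_eq_pow_val, Units.val_one, pow_two]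
      nth_rewrite 1 [← h3]
      rw [← mul_pow, hcz, one_pow]
    · rintro rfl
      apply orderOf_dvd_of_pow_eq_one
      apply Units.ext
      rw [Units.val_pow_eq_pow_val, h, map_one, Units.val_one]

theorem ML2 (hp : p.Prime) {m : ℕ} (hm : 0 < m) (hV : finrank F V = 2 * m) :
    ∃ s ∈ Sp F V, ∀ (k : ℕ) (v : V) (c : F), v ≠ 0 → (s ^ k) v = c • v →
      Nat.card F ^ m - 1 ∣ k * (Nat.card F - 1) := by
  obtain ⟨K, _, _, _, _, hK, ⟨g, hg⟩, -, -⟩ := exK (F := F) hp m 0 hm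
  let S : Symp F (K × K) := hypSymp AlgEquiv.refl (fun _ => rfl)
  obtain ⟨e, he⟩ := exists_isom (F := F) (V := K × K) (V' := V) (by rw [finrank_prod]; omega)
  refine ⟨trp e (pr (mu F g) (mu F g⁻¹)), trp_mem he ?_, ?_⟩
  · intro v w
    change Algebra.trace F K _ = Algebra.trace F K _
    congr 1
    simp only [pr_ap, mu_ap, AlgEquiv.coe_refl, id_eq]
    have : (g : K) * (g⁻¹ : Kˣ) = 1 := by simp
    linear_combination (v.1 * w.2 - v.2 * w.1) * this
  · intro k v d hv h
    obtain ⟨x, rfl⟩ := e.surjective v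
    have hx : x ≠ 0 := by rintro rfl; simp at hv
    rw [← map_pow, trp_ap, ← map_smul, pr_pow, ← map_pow, ← map_pow] at h
    have h := e.injective h
    rw [pr_ap, Prod.ext_iff] at h
    simp only [mu_ap, Prod.smul_fst, Prod.smul_snd, Algebra.smul_def] at h
    have key : ∀ u : Kˣ, (u : K) = algebraMap F K d → u ^ (Nat.card F - 1) = 1 := by
      intro u hu
      have : Fintype F := Fintype.ofFinite _
      have hd : d ≠ 0 := by rintro rfl; simp at hu
      apply Units.ext
      rw [Units.val_pow_eq_pow_val, hu, ← map_pow, Nat.card_eq_fintype_card, FiniteField.pow_card_sub_one_eq_one _ hd]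
      simp
    rw [← hg]
    apply orderOf_dvd_of_pow_eq_one
    rw [pow_mul]
    by_cases h1 : x.1 = 0
    · have h3 : x.2 ≠ 0 := fun h3 => hx (Prod.ext h1 h3)
      have := key _ (mul_right_cancel₀ h3 h.2)
      rwa [inv_pow, inv_pow, inv_eq_one] at this
    · exact key _ (mul_right_cancel₀ h1 h.1)

theorem ML3 (hp : p.Prime) (h2 : (2 : F) ≠ 0) (hV : finrank F V = 4) :
    ∃ u ∈ Sp F V, ∃ z ∈ Sp F V, Commute u z ∧ u ^ p = 1 ∧ u ≠ 1 ∧ z ^ (Nat.card F + 1) = 1 ∧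
      (∀ (v : V) (c : F), v ≠ 0 → z v ≠ c • v) ∧ (∀ v, Symp.ω (F := F) v (u v) = 0 → u v = v) ∧
      (∀ v w, u v = v → u w = w → Symp.ω (F := F) v w = 0) := by
  obtain ⟨K, _, _, _, _, hK, ⟨g, hg⟩, c, hc, hcc⟩ := exK (F := F) hp (2 * 1) 1 (by omega)
  replace hcc := hcc rfl
  obtain ⟨hodd, hq3⟩ := q_odd (F := F) hp h2
  rw [pow_one] at hc
  have htr : ∀ x : K, algebraMap F K (Algebra.trace F K x) = x + c x := by
    intro x
    have := FiniteField.algebraMap_trace_eq_sum_pow F K x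
    rw [this, hK, hc]
    simp [Finset.sum_range_succ]
  have h2K : (2 : K) ≠ 0 := by
    have := (map_ne_zero (algebraMap F K)).2 h2
    rwa [map_ofNat] at this
  set q := Nat.card F with hq
  have hfac : q ^ (2 * 1) - 1 = (q + 1) * (q - 1) := by
    rw [mul_comm 2 1, pow_mul, ← one_pow 2, Nat.sq_sub_sq, one_pow, pow_one]
  let z := g ^ (q - 1)
  have hz : orderOf z = q + 1 := by
    have hpos : 0 < q - 1 := by omega
    rw [orderOf_pow_of_dvd (by omega) (by rw [hg, hfac]; exact dvd_mul_left _ _), hg, hfac,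
      Nat.mul_div_cancel _ hpos]
  have hcz : c (z : K) * z = 1 := by
    rw [hc, ← pow_succ]
    have := pow_orderOf_eq_one z
    rw [hz] at this
    rw [← Units.val_pow_eq_pow_val, this, Units.val_one]
  have hzd : ∀ d : F, (z : K) ≠ algebraMap F K d := by
    intro d h
    have h3 : c (z : K) = z := by rw [h, AlgEquiv.commutes]
    rw [h3] at hcz
    have h4 : z ^ 2 = 1 := by
      apply Units.ext
      rw [Units.val_pow_eq_pow_val, Units.val_one, pow_two, hcz]
    have := Nat.le_of_dvd (by omega) (orderOf_dvd_of_pow_eq_one h4)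
    omega
  let S : Symp F (K × K) := hypSymp c hcc
  have hS : ∀ x y : K × K, Symp.ω (F := F) x y = Algebra.trace F K (x.1 * c y.2 - c x.2 * y.1) :=
    fun _ _ => rfl
  obtain ⟨e, he⟩ := exists_isom (F := F) (V := K × K) (V' := V) (by rw [finrank_prod]; omega)
  let u : (K × K) ≃ₗ[F] (K × K) :=
    { toFun := fun x => (x.1 + x.2, x.2)
      map_add' := fun x y => by ext <;> simp; ring
      map_smul' := fun d x => by ext <;> simp
      invFun := fun x => (x.1 - x.2, x.2)
      left_inv := fun x => by simp
      right_inv := fun x => by simp }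
  have hu : ∀ x, u x = (x.1 + x.2, x.2) := fun _ => rfl
  have huk : ∀ k : ℕ, ∀ x, (u ^ k) x = (x.1 + k * x.2, x.2) := by
    intro k
    induction k with
    | zero => intro x; simp
    | succ k ih =>
      intro x
      rw [pow_succ, mul_ap, ih, hu]
      ext
      · simp only; push_cast; ring
      · rfl
  have hpK : (p : K) = 0 := by
    have := congrArg (algebraMap F K) (CharP.cast_eq_zero F p)
    rwa [map_natCast, map_zero] at this
  refine ⟨trp e u, trp_mem he ?_, trp e (pr (mu F z) (mu F z)), trp_mem he ?_, ?_, ?_, ?_, ?_, ?_, ?_, ?_⟩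
  · intro v w
    rw [hS, hS, hu, hu]
    apply (algebraMap F K).injective
    rw [htr, htr]
    simp only [map_sub, map_mul, map_add, hcc]
    ring
  · intro v w
    rw [hS, hS]
    congr 1
    simp only [pr_ap, mu_ap, map_mul]
    linear_combination (v.1 * c w.2 - c v.2 * w.1) * hcz
  · refine Commute.map ?_ (trp e)
    change u * _ = _ * u
    ext x
    · simp only [mul_ap, hu, pr_ap, mu_ap]; ring
    · simp only [mul_ap, hu, pr_ap, mu_ap]
  · rw [← map_pow, ← map_one (trp e)]
    congr 1
    ext x
    · rw [huk, hpK]; simp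
    · rw [huk]; rfl
  · intro h
    have := DFunLike.congr_fun (trp_inj e h) (0, 1)
    rw [hu, one_ap, Prod.ext_iff] at this
    simp at this
  · rw [← map_pow, pr_pow, ← map_pow, ← hz, pow_orderOf_eq_one, map_one, pr_one, map_one]
  · intro v d hv h
    obtain ⟨x, rfl⟩ := e.surjective v
    have hx : x ≠ 0 := by rintro rfl; simp at hv
    rw [trp_ap, ← map_smul] at h
    have h := e.injective h
    rw [pr_ap, Prod.ext_iff] at h
    simp only [mu_ap, Prod.smul_fst, Prod.smul_snd, Algebra.smul_def] at h
    by_cases h1 : x.1 = 0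
    · have h3 : x.2 ≠ 0 := fun h3 => hx (Prod.ext h1 h3)
      exact hzd d (mul_right_cancel₀ h3 h.2)
    · exact hzd d (mul_right_cancel₀ h1 h.1)
  · intro v h
    obtain ⟨x, rfl⟩ := e.surjective v
    rw [trp_ap, he, hS, hu] at h
    rw [trp_ap, hu]
    have h3 := congrArg (algebraMap F K) h
    rw [htr, map_zero] at h3
    simp only [map_sub, map_mul, map_add, hcc] at h3
    have h4 : 2 * (x.2 * c x.2) = 0 := by linear_combination -h3
    have h5 : x.2 = 0 := by simpa [h2K] using h4
    congr 1
    ext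
    · simp [h5]
    · rfl
  · intro v w hv hw
    obtain ⟨x, rfl⟩ := e.surjective v
    obtain ⟨y, rfl⟩ := e.surjective w
    rw [trp_ap, hu] at hv hw
    have hv := e.injective hv
    have hw := e.injective hw
    rw [Prod.ext_iff] at hv hw
    have hx : x.2 = 0 := by simpa using hv.1
    have hy : y.2 = 0 := by simpa using hw.1
    rw [he, hS, hx, hy]
    simp

theorem ML4 (hp : p.Prime) (hV : finrank F V = 4) :
    ∃ n ∈ Sp F V, n ^ p ^ 4 = 1 ∧ ∃ v0, v0 ≠ 0 ∧ ∀ v, n v = v → ∃ c : F, v = c • v0 := by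
  let S0 : Symp F (F × F) := hypSymp (AlgEquiv.refl (R := F) (A₁ := F)) (fun _ => rfl)
  have hS0 : ∀ x y : F × F, Symp.ω (F := F) x y = x.1 * y.2 - x.2 * y.1 := fun x y => by
    change Algebra.trace F F _ = _
    rw [Algebra.trace_self_apply]; rfl
  obtain ⟨e, he⟩ := exists_isom (F := F) (V := (F × F) × (F × F)) (V' := V) (by simp [finrank_prod]; omega)
  let n : ((F × F) × (F × F)) ≃ₗ[F] ((F × F) × (F × F)) :=
    { toFun := fun x => ((x.1.1 + x.2.1 + x.2.2, x.1.2), (x.2.1 + x.2.2, x.2.2 - x.1.2))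
      map_add' := fun x y => by ext <;> simp <;> ring
      map_smul' := fun d x => by ext <;> simp <;> ring
      invFun := fun x => ((x.1.1 - x.2.1, x.1.2), (x.2.1 - x.2.2 - x.1.2, x.2.2 + x.1.2))
      left_inv := fun x => by ext <;> simp <;> ring
      right_inv := fun x => by ext <;> simp <;> ring }
  have hn : ∀ x, n x = ((x.1.1 + x.2.1 + x.2.2, x.1.2), (x.2.1 + x.2.2, x.2.2 - x.1.2)) := fun _ => rfl
  refine ⟨trp e n, trp_mem he ?_, ?_, e ((1, 0), (0, 0)), ?_, ?_⟩
  · intro v w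
    rw [prod_om, prod_om, hS0, hS0, hS0, hS0, hn, hn]
    ring
  · rw [← map_pow, ← map_one (trp e)]
    congr 1
    have : Fact p.Prime := ⟨hp⟩
    let N : Module.End F ((F × F) × (F × F)) := n.toLinearMap - 1
    have hN : ∀ x, N x = ((x.2.1 + x.2.2, 0), (x.2.2, - x.1.2)) := by
      intro x; simp only [N, LinearMap.sub_apply, LinearEquiv.coe_coe, hn, Module.End.one_apply]
      ext <;> simp <;> ring
    have hN4 : N ^ 4 = 0 := by
      apply LinearMap.ext
      intro x
      simp only [pow_succ, pow_zero, one_mul, Module.End.mul_apply, hN, LinearMap.zero_apply]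
      ext <;> simp
    have hNp : N ^ p ^ 4 = 0 := pow_eq_zero_of_le (Nat.lt_pow_self hp.one_lt).le hN4
    have hc : CharP (Module.End F ((F × F) × (F × F))) p := by
      apply charP_of_injective_algebraMap (algebraMap F (Module.End F ((F × F) × (F × F)))).injective
    have h1 : (N + 1) ^ p ^ 4 = 1 := by
      rw [add_pow_char_pow_of_commute p 4 (Commute.one_right N), hNp]; simp
    have h3 : ∀ k : ℕ, ∀ x, (n ^ k) x = ((N + 1) ^ k) x := by
      intro k
      induction k with
      | zero => intro x; rfl
      | succ k ih => intro x; rw [pow_succ, pow_succ, mul_ap, ih]; simp [N]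
    apply LinearEquiv.ext
    intro x
    rw [h3, h1]; rfl
  · intro h
    have := e.map_eq_zero_iff.1 h
    simp at this
  · intro v hv
    obtain ⟨x, rfl⟩ := e.surjective v
    rw [trp_ap] at hv
    have hv := e.injective hv
    rw [hn] at hv
    simp only [Prod.ext_iff] at hv
    obtain ⟨⟨h1, -⟩, h3, h4⟩ := hv
    refine ⟨x.1.1, ?_⟩
    rw [← map_smul]
    congr 1
    have h5 : x.2.2 = 0 := by linear_combination h3
    have h6 : x.1.2 = 0 := by linear_combination -h4
    have h7 : x.2.1 = 0 := by linear_combination h1 - h3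
    ext <;> simp [h5, h6, h7]
end
end P6

set_option linter.unusedSectionVars false
set_option linter.unusedSimpArgs false
set_option linter.unusedVariables false
set_option autoImplicit false
section P7
open Module
section
variable {F V : Type*} [Field F] [AddCommGroup V] [Module F V] [Symp F V]
local notation "ω" => Symp.ω (F := F) (V := V)

/-- minus identity -/
def ng (F V : Type*) [Field F] [AddCommGroup V] [Module F V] : V ≃ₗ[F] V := LinearEquiv.neg F
@[simp] theorem ng_ap (v : V) : ng F V v = -v := rfl
theorem ng_mem : ng F V ∈ Sp F V := fun v w => by simp
theorem ng_mul_ng : ng F V * ng F V = 1 := by ext v; simp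
theorem ng_comm (g : V ≃ₗ[F] V) : Commute (ng F V) g := by
  change _ * _ = _ * _
  ext v; simp
theorem ng_pow_odd {k : ℕ} (hk : Odd k) : ng F V ^ k = ng F V := by
  obtain ⟨j, rfl⟩ := hk
  rw [pow_succ, pow_mul, pow_two, ng_mul_ng, one_pow, one_mul]

structure Ctx (F V : Type*) [Field F] [AddCommGroup V] [Module F V] [Symp F V] (p e m : ℕ) : Prop where
  hp : p.Prime
  h2 : (2 : F) ≠ 0
  hq : Nat.card F = p ^ e
  he : 0 < e
  hm : 5 ≤ m
  hV : finrank F V = 2 * m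

variable [Finite F] [FiniteDimensional F V]

section
variable {p e m : ℕ} [CharP F p] (hC : Ctx F V p e m)
include hC
theorem Ctx.ntv : Nontrivial V := by
  have := hC.hV
  have := hC.hm
  exact Module.nontrivial_of_finrank_pos (R := F) (by omega)
theorem Ctx.ng_ne : ng F V ≠ 1 := by
  have := hC.ntv
  obtain ⟨v, hv⟩ := exists_ne (0 : V)
  intro h
  have := DFunLike.congr_fun h v
  rw [ng_ap, one_ap] at this
  have h3 : (2 : F) • v = 0 := by rw [two_smul]; nth_rewrite 1 [← this]; simp
  exact hv ((smul_eq_zero.1 h3).resolve_left hC.h2)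
theorem Ctx.p3 : 3 ≤ p := by
  have h1 := hC.hp.two_le
  rcases h1.lt_or_eq with h | rfl
  · exact h
  · exact absurd (by exact_mod_cast CharP.cast_eq_zero F 2) hC.h2
theorem Ctx.podd : Odd p := hC.hp.odd_of_ne_two (by have := hC.p3; omega)

theorem Ctx.zs (a : ℕ) (ha : 2 ≤ a) : ∃ r, Zs p (2 * a * e) r :=
  zsig hC.p3 hC.podd (by have := hC.he; nlinarith)

theorem Ctx.dvd {a r : ℕ} (ha : 0 < a) (hr : Zs p (2 * a * e) r) : r ∣ Nat.card F ^ a + 1 := by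
  have hp := hC.hp.pos
  rw [hC.hq, ← pow_mul]
  have h1 := (hr.dvd_iff hp (2 * a * e)).2 dvd_rfl
  have h3 : p ^ (2 * a * e) - 1 = (p ^ (e * a) + 1) * (p ^ (e * a) - 1) := by
    rw [show 2 * a * e = (e * a) * 2 by ring, pow_mul, ← one_pow 2, Nat.sq_sub_sq, one_pow]
  rw [h3] at h1
  refine (hr.1.dvd_mul.1 h1).resolve_right fun h => ?_
  have := Nat.le_of_dvd (Nat.mul_pos hC.he ha) ((hr.dvd_iff hp _).1 h)
  have := Nat.mul_pos hC.he ha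
  nlinarith

theorem Ctx.r_odd {a r : ℕ} (ha : 0 < a) (hr : Zs p (2 * a * e) r) : Odd r := by
  apply hr.1.odd_of_ne_two
  have h0 : 0 < 2 * a * e := by have := hC.he; positivity
  have := hr.lt h0
  have h1 : 0 < a * e := by have := hC.he; positivity
  have : 2 * a * e = 2 * (a * e) := by ring
  omega

theorem Ctx.iso {b : ℕ} (hb : b ≤ m) : ∃ ε : ((Fin b ⊕ Fin b → F) × (Fin (m - b) ⊕ Fin (m - b) → F)) ≃ₗ[F] V,
    ∀ v w, ω (ε v) (ε w) = Symp.ω (F := F) v w := by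
  apply exists_isom
  rw [finrank_prod, hC.hV]; simp; omega

theorem Ctx.trans {x y : V} (hx : x ≠ 0) (hy : y ≠ 0) : ∃ g ∈ Sp F V, g x = y := by
  have key : ∀ x y : V, ω x y ≠ 0 → ∃ g ∈ Sp F V, g x = y := by
    intro x y h
    refine ⟨tv (y - x) (ω y x)⁻¹, tv_mem _ _, ?_⟩
    have h' : ω y x ≠ 0 := fun h' => h (om_zero_comm.1 h')
    rw [tv_ap, map_sub, LinearMap.sub_apply, om_self, sub_zero, inv_mul_cancel₀ h']
    simp
  obtain ⟨z, -, h1, h3⟩ := two_nonzero (U := (⊤ : Submodule F V)) (f := ω x) (g := ω y)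
    (by obtain ⟨w, hw⟩ := om_nd (F := F) hx; exact ⟨w, trivial, hw⟩)
    (by obtain ⟨w, hw⟩ := om_nd (F := F) hy; exact ⟨w, trivial, hw⟩)
  obtain ⟨g, hg, e1⟩ := key x z h1
  obtain ⟨g', hg', e2⟩ := key z y fun h => h3 (om_zero_comm.1 h)
  exact ⟨g' * g, mul_mem hg' hg, by rw [mul_ap, e1, e2]⟩

/-- element of order r -/
theorem Ctx.exR {a r : ℕ} (ha : 0 < a) (ham : a ≤ m) (hr : Zs p (2 * a * e) r) :
    ∃ ρ ∈ Sp F V, ρ ^ r = 1 ∧ ρ ≠ 1 := by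
  obtain ⟨ε, hε⟩ := hC.iso ham
  obtain ⟨s, hs, h1, h3⟩ := ML1 (V := Fin a ⊕ Fin a → F) hC.hp hC.h2 ha (by simp; ring)
  obtain ⟨k, hk⟩ := hC.dvd ha hr
  have hk0 : 0 < k := by
    rcases Nat.eq_zero_or_pos k with rfl | h
    · simp at hk
    · exact h
  refine ⟨trp ε (pr (s ^ k) 1), trp_mem hε (pr_mem (pow_mem hs k) (one_mem _)), ?_, ?_⟩
  · rw [← map_pow, pr_pow, ← pow_mul, mul_comm k, ← hk, h1, one_pow, pr_one, map_one]
  · intro h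
    have h := trp_inj _ h
    have h4 : s ^ k = 1 := by
      ext x : 1
      have := DFunLike.congr_fun h (x, 0)
      rw [pr_ap] at this
      exact congrArg Prod.fst this
    have : Nontrivial (Fin a ⊕ Fin a → F) := by
      have : Nonempty (Fin a) := ⟨⟨0, ha⟩⟩
      infer_instance
    obtain ⟨v, hv⟩ := exists_ne (0 : Fin a ⊕ Fin a → F)
    have h5 := (h3 k v 1 hv (by rw [h4]; simp)).2 rfl
    have h6 := Nat.le_of_dvd hk0 h5
    have h7 := hr.1.two_le
    rw [hk] at h6
    nlinarith

/-- g trivial on perp of a 2-space, p-element: transvection -/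
theorem Ctx.is_tv {k r : ℕ} (hr : Zs p (2 * (m - 1) * e) r) {ρ g : V ≃ₗ[F] V} (hρ : ρ ∈ Sp F V) (hρ1 : ρ ≠ 1)
    (hρr : ρ ^ r = 1) (hg : g ∈ Sp F V) (hg1 : g ≠ 1) (hgp : g ^ p ^ k = 1) (hc : Commute g ρ) :
    ∃ x c, x ≠ 0 ∧ c ≠ 0 ∧ g = tv x c := by
  have hm := hC.hm
  obtain ⟨hS, hd⟩ := lemZ hC.hp hC.hq hC.he (by omega) (by omega) hr hC.hV hρ hρ1 hρr
  have hW := triv_W hC.hp hS hc hg hgp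
  have : Finite V := Module.finite_of_finite F
  have hd2 : finrank F (fx ρ) = 2 := by omega
  obtain ⟨x, hx, hgx, hx0⟩ : ∃ x ∈ fx ρ, g x = x ∧ x ≠ 0 := by
    let Z : AddSubgroup V := (fx ρ ⊓ fx g).toAddSubgroup
    have h1 := card_fix hC.hp g hgp (fx ρ).toAddSubgroup Z (fun y hy => by
      change g y ∈ fx ρ
      have hy : ρ y = y := mem_fx.1 hy
      rw [mem_fx, ← mul_ap, ← hc.eq, mul_ap, hy])
      (fun z => by
        change z ∈ fx ρ ⊓ fx g ↔ z ∈ fx ρ ∧ _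
        rw [Submodule.mem_inf, mem_fx (g := g)])
    have h3 : Nat.card (fx ρ).toAddSubgroup = p ^ (e * 2) := by
      change Nat.card (fx ρ) = _
      rw [Module.natCard_eq_pow_finrank (K := F), hC.hq, hd2, pow_mul]
    rw [h3] at h1
    have h4 : p ∣ Nat.card Z := (Nat.modEq_zero_iff_dvd.1 (h1.symm.trans
      (Nat.modEq_zero_iff_dvd.2 (dvd_pow_self p (by have := hC.he; omega)))))
    have : Nontrivial Z := by
      apply Finite.one_lt_card_iff_nontrivial.1
      have := Nat.le_of_dvd Nat.card_pos h4
      have := hC.p3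
      omega
    obtain ⟨⟨z, hz⟩, hz0⟩ := exists_ne (0 : Z)
    have hz : z ∈ fx ρ ⊓ fx g := hz
    exact ⟨z, hz.1, mem_fx.1 hz.2, fun h => hz0 (Subtype.ext h)⟩
  have key : ∀ v, ∃ d : F, g v = v + d • x := by
    intro v
    have h1 : g v - v ∈ fx ρ := by
      rw [← hS.perpW, mem_perp]
      intro w hw
      rw [map_sub, ← hg w v, hW w hw, sub_self]
    have h3 : ω x (g v - v) = 0 := by
      rw [map_sub, ← hg x v, hgx, sub_self]
    by_contra hcon
    push Not at hcon
    have hli : LinearIndependent F ![x, g v - v] := by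
      rw [LinearIndependent.pair_iff' hx0]
      intro a ha
      exact hcon a (by rw [ha]; abel)
    have hsp : Submodule.span F (Set.range ![x, g v - v]) = fx ρ := by
      apply Submodule.eq_of_le_of_finrank_eq
      · rw [Submodule.span_le]
        rintro _ ⟨i, rfl⟩
        fin_cases i
        · exact hx
        · exact h1
      · rw [finrank_span_eq_card hli, hd2]; rfl
    have hperp : x ∈ perp (fx ρ) := by
      rw [← hsp, mem_perp']
      intro u hu
      induction hu using Submodule.span_induction with
      | mem y hy =>
        obtain ⟨i, rfl⟩ := hy
        fin_cases i
        · exact om_self x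
        · exact h3
      | zero => simp
      | add a b _ _ ha hb => rw [map_add, ha, hb, add_zero]
      | smul a b _ hb => rw [map_smul, hb, smul_zero]
    exact hx0 (hS.inf x hx hperp)
  choose f hf using key
  obtain ⟨y, hy⟩ := om_nd (F := F) hx0
  refine ⟨x, f y * (ω x y)⁻¹, hx0, ?_, ?_⟩
  · have h3 : ∀ v, f v * ω x y = f y * ω x v := by
      intro v
      have := hg v y
      rw [hf, hf] at this
      simp only [map_add, map_smul, LinearMap.add_apply, LinearMap.smul_apply, smul_eq_mul, om_self,
        om_neg x v] at this
      linear_combination this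
    intro h0
    apply hg1
    have hy0 : f y = 0 := (mul_eq_zero.1 h0).resolve_right (inv_ne_zero hy)
    ext v
    have := h3 v
    rw [hy0, zero_mul] at this
    rw [hf, (mul_eq_zero.1 this).resolve_right hy]; simp
  · ext v
    have := hg v y
    rw [hf, hf] at this
    simp only [map_add, map_smul, LinearMap.add_apply, LinearMap.smul_apply, smul_eq_mul, om_self,
      om_neg x v] at this
    rw [hf, tv_ap]
    congr 2
    field_simp
    linear_combination this
end
end
end P7

set_option linter.unusedSectionVars false
set_option linter.unusedSimpArgs false
set_option linter.unusedVariables false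
set_option autoImplicit false
section P8
open Module
section
variable {F V : Type*} [Field F] [AddCommGroup V] [Module F V] [Symp F V]
local notation "ω" => Symp.ω (F := F) (V := V)

/-- correspondence induced by an automorphism modulo signs -/
structure Cor (R : (V ≃ₗ[F] V) → (V ≃ₗ[F] V) → Prop) : Prop where
  mem : ∀ {g g'}, R g g' → g ∈ Sp F V ∧ g' ∈ Sp F V
  ex : ∀ {g}, g ∈ Sp F V → ∃ g', R g g'
  ex' : ∀ {g'}, g' ∈ Sp F V → ∃ g, R g g'
  mul : ∀ {g g' h h'}, R g g' → R h h' → R (g * h) (g' * h')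
  inv : ∀ {g g'}, R g g' → R g⁻¹ g'⁻¹
  one : ∀ {g}, R 1 g ↔ g = 1 ∨ g = ng F V
  one' : ∀ {g}, R g 1 ↔ g = 1 ∨ g = ng F V

variable {R : (V ≃ₗ[F] V) → (V ≃ₗ[F] V) → Prop} (hR : Cor R)
include hR
theorem Cor.symm : Cor fun g g' => R g' g :=
  ⟨fun h => (hR.mem h).symm, hR.ex', hR.ex, hR.mul, hR.inv, hR.one', hR.one⟩
theorem Cor.pow {g g' : V ≃ₗ[F] V} (h : R g g') (k : ℕ) : R (g ^ k) (g' ^ k) := by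
  induction k with
  | zero => exact hR.one.2 (.inl rfl)
  | succ k ih => rw [pow_succ, pow_succ]; exact hR.mul ih h
theorem Cor.neg {g g' : V ≃ₗ[F] V} (h : R g g') : R g (ng F V * g') := by
  have := hR.mul (hR.one.2 (.inr rfl)) h
  rwa [one_mul] at this
theorem Cor.odd {g g' : V ≃ₗ[F] V} (h : R g g') {k : ℕ} (hk : Odd k) (hg : g ^ k = 1) :
    ∃ g'', (g'' = g' ∨ g'' = ng F V * g') ∧ R g g'' ∧ g'' ^ k = 1 := by
  have h1 := hR.pow h k
  rw [hg] at h1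
  rcases hR.one.1 h1 with h3 | h3
  · exact ⟨g', .inl rfl, h, h3⟩
  · exact ⟨_, .inr rfl, hR.neg h, by rw [(ng_comm g').mul_pow, h3, ng_pow_odd hk, ng_mul_ng]⟩
theorem Cor.comm (hn : ng F V ≠ 1) {g g' h h' : V ≃ₗ[F] V} (h1 : R g g') (h3 : R h h') (hc : Commute g h)
    {k : ℕ} (hk : Odd k) (hh : h' ^ k = 1) : Commute g' h' := by
  have h4 := hR.mul (hR.mul (hR.mul h1 h3) (hR.inv h1)) (hR.inv h3)
  rw [hc.eq, mul_inv_cancel_right, mul_inv_cancel] at h4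
  rcases hR.one.1 h4 with h5 | h5
  · rw [mul_inv_eq_one, mul_inv_eq_iff_eq_mul] at h5; exact h5
  · exfalso
    apply hn
    rw [mul_inv_eq_iff_eq_mul] at h5
    have h6 := congrArg (· ^ k) h5
    rw [conj_pow, hh, (ng_comm h').mul_pow, hh, ng_pow_odd hk] at h6
    simpa using h6.symm
theorem Cor.ne_one (hn : ng F V ≠ 1) {g g' : V ≃ₗ[F] V} (h1 : R g g') {k : ℕ} (hk : Odd k) (hg : g ^ k = 1)
    (h : g ≠ 1) : g' ≠ 1 := by
  rintro rfl
  rcases hR.one'.1 h1 with h3 | h3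
  · exact h h3
  · rw [h3, ng_pow_odd hk] at hg; exact hn hg
omit hR

/-- induced relation on nonzero vectors -/
def Tr (R : (V ≃ₗ[F] V) → (V ≃ₗ[F] V) → Prop) (x x' : V) : Prop :=
  x ≠ 0 ∧ x' ≠ 0 ∧ ∃ c c' : F, c ≠ 0 ∧ c' ≠ 0 ∧ R (tv x c) (tv x' c')

theorem Tr.symm {x x' : V} (h : Tr R x x') : Tr (fun g g' => R g' g) x' x := by
  obtain ⟨h1, h2, c, c', h3, h4, h5⟩ := h
  exact ⟨h2, h1, c', c, h4, h3, h5⟩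

theorem tv_ne {x : V} {c : F} (hx : x ≠ 0) (hc : c ≠ 0) : tv x c ≠ 1 := by
  obtain ⟨y, hy⟩ := om_nd (F := F) hx
  intro h
  have := DFunLike.congr_fun h y
  rw [tv_ap, one_ap, add_eq_left] at this
  simp [hx, hc, hy] at this

theorem tv_comm {x y : V} {c d : F} (hx : x ≠ 0) (hc : c ≠ 0) (hy : y ≠ 0) (hd : d ≠ 0) :
    Commute (tv x c) (tv y d) ↔ ω x y = 0 := by
  constructor
  · intro h
    by_contra hne
    have h1 := DFunLike.congr_fun h.eq x
    simp only [mul_ap, tv_ap, map_add, map_smul, om_self, smul_eq_mul, mul_zero, zero_smul, add_zero] at h1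
    have h4 : ω y x ≠ 0 := fun h => hne (om_zero_comm.1 h)
    simp [hc, hd, hx, hne, h4] at h1
  · intro h
    have h' := om_zero_comm.1 h
    change _ * _ = _ * _
    ext v
    simp only [mul_ap, tv_ap, map_add, map_smul, h, h', smul_eq_mul]
    module

variable [Finite F] [FiniteDimensional F V]
variable {p e m : ℕ} [CharP F p] (hC : Ctx F V p e m)

theorem tv_p (x : V) (c : F) : tv x c ^ p = 1 := by
  rw [tv_pow, CharP.cast_eq_zero, zero_mul, tv_zero]

include hC hR
theorem Cor.tv {x : V} {c : F} (hx : x ≠ 0) (hc : c ≠ 0) : ∃ x' c', x' ≠ 0 ∧ c' ≠ 0 ∧ R (tv x c) (tv x' c') := by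
  have hm := hC.hm
  obtain ⟨r, hr⟩ := hC.zs (m - 1) (by omega)
  obtain ⟨ρ, hρ, hρr, hρ1⟩ := hC.exR (by omega) (by omega) hr
  obtain ⟨hS, hd⟩ := lemZ hC.hp hC.hq hC.he (by omega) (by omega) hr hC.hV hρ hρ1 hρr
  obtain ⟨y, hy, hy0⟩ := Submodule.exists_mem_ne_zero_of_ne_bot (p := fx ρ) (by
    intro h; rw [h, finrank_bot] at hd; omega)
  obtain ⟨g, hg, rfl⟩ := hC.trans hy0 hx
  have hro := hC.r_odd (by omega) hr
  have hn := hC.ng_ne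
  have hgS : g * ρ * g⁻¹ ∈ Sp F V := mul_mem (mul_mem hg hρ) (inv_mem hg)
  have hgr : (g * ρ * g⁻¹) ^ r = 1 := by rw [conj_pow, hρr]; simp
  obtain ⟨ρ', h1⟩ := hR.ex hgS
  obtain ⟨ρ'', -, h3, h4⟩ := hR.odd h1 hro hgr
  obtain ⟨t', h5⟩ := hR.ex (tv_mem (g y) c)
  obtain ⟨t'', -, h6, h7⟩ := hR.odd h5 hC.podd (tv_p (p := p) _ _)
  have hcomm : Commute (_root_.tv (g y) c) (g * ρ * g⁻¹) := by
    have : g * ρ * g⁻¹ * _root_.tv (g y) c * (g * ρ * g⁻¹)⁻¹ = _root_.tv (g y) c := by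
      rw [tv_conj hgS]
      congr 1
      simp only [mul_ap, inv_ap, mem_fx.1 hy]
    rw [mul_inv_eq_iff_eq_mul] at this
    exact this.symm
  obtain ⟨x', c', e1, e2, e3⟩ := hC.is_tv (k := 1) hr (hR.mem h3).2 (hR.ne_one hn h3 hro hgr (by
      intro h; apply hρ1; rwa [mul_inv_eq_one, mul_eq_left] at h)) h4
    (hR.mem h6).2 (hR.ne_one hn h6 hC.podd (tv_p (p := p) _ _) (tv_ne hx hc)) (by rwa [pow_one])
    (hR.comm hn h6 h3 hcomm hro h4)
  exact ⟨x', c', e1, e2, e3 ▸ h6⟩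

theorem Cor.T {x : V} (hx : x ≠ 0) : ∃ x', Tr R x x' := by
  obtain ⟨x', c', h1, h2, h3⟩ := hR.tv hC hx one_ne_zero
  exact ⟨x', hx, h1, 1, c', one_ne_zero, h2, h3⟩
theorem Cor.T' {x' : V} (hx : x' ≠ 0) : ∃ x, Tr R x x' := by
  obtain ⟨x, h⟩ := hR.symm.T hC hx
  exact ⟨x, h.symm⟩
theorem Cor.perp1 {x x' y y' : V} (h : Tr R x x') (h' : Tr R y y') (h0 : ω x y = 0) : ω x' y' = 0 := by
  obtain ⟨h1, h2, c, c', h3, h4, h5⟩ := h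
  obtain ⟨k1, k2, d, d', k3, k4, k5⟩ := h'
  rw [← tv_comm h2 h4 k2 k4]
  exact hR.comm hC.ng_ne h5 k5 ((tv_comm h1 h3 k1 k3).2 h0) hC.podd (tv_p (p := p) _ _)
theorem Cor.perp {x x' y y' : V} (h : Tr R x x') (h' : Tr R y y') : ω x y = 0 ↔ ω x' y' = 0 :=
  ⟨hR.perp1 hC h h', hR.symm.perp1 hC h.symm h'.symm⟩
omit hC in
theorem Cor.ap {x x' : V} {g g' : V ≃ₗ[F] V} (h : Tr R x x') (hg : R g g') : Tr R (g x) (g' x') := by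
  obtain ⟨h1, h2, c, c', h3, h4, h5⟩ := h
  refine ⟨by simpa using h1, by simpa using h2, c, c', h3, h4, ?_⟩
  rw [← tv_conj (hR.mem hg).1, ← tv_conj (hR.mem hg).2]
  exact hR.mul (hR.mul hg h5) (hR.inv hg)

/-- span of a family via double perp -/
theorem Cor.span1 {ι : Type} {x x' : ι → V} (h : ∀ i, Tr R (x i) (x' i)) {v v' : V} (hv : Tr R v v')
    (hs : v ∈ Submodule.span F (Set.range x)) : v' ∈ Submodule.span F (Set.range x') := by
  rw [← perp_perp (Submodule.span F (Set.range x')), mem_perp]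
  intro w' hw'
  by_cases h0 : w' = 0
  · simp [h0]
  obtain ⟨w, hw⟩ := hR.T' hC h0
  refine (hR.perp hC hw hv).1 ?_
  have : v ∈ LinearMap.ker (ω w) := by
    refine (Submodule.span_le.2 ?_) hs
    rintro _ ⟨i, rfl⟩
    exact (hR.perp hC hw (h i)).2 (mem_perp'.1 hw' _ (Submodule.subset_span ⟨i, rfl⟩))
  exact this
theorem Cor.span {ι : Type} {x x' : ι → V} (h : ∀ i, Tr R (x i) (x' i)) {v v' : V} (hv : Tr R v v') :
    v ∈ Submodule.span F (Set.range x) ↔ v' ∈ Submodule.span F (Set.range x') :=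
  ⟨hR.span1 hC h hv, hR.symm.span1 hC (fun i => (h i).symm) hv.symm⟩
theorem Cor.line {x x' y y' : V} (h : Tr R x x') (h' : Tr R y y') : (∃ c : F, y = c • x) ↔ ∃ c : F, y' = c • x' := by
  have := hR.span hC (ι := Unit) (x := fun _ => x) (x' := fun _ => x') (fun _ => h) h'
  simp only [Set.range_const, Submodule.mem_span_singleton] at this
  simpa [eq_comm] using this
theorem Cor.eig {x x' : V} {g g' : V ≃ₗ[F] V} (h : Tr R x x') (hg : R g g') :
    (∃ c : F, g x = c • x) ↔ ∃ c : F, g' x' = c • x' := hR.line hC h (hR.ap h hg)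
end
end P8

set_option linter.unusedSectionVars false
set_option linter.unusedSimpArgs false
set_option linter.unusedVariables false
set_option autoImplicit false
section P9
open Module

theorem crt {G : Type*} [Group G] {a b : G} (hc : Commute a b) {k l : ℕ} (ha : a ^ k = 1) (hb : b ^ l = 1)
    (hkl : Nat.Coprime k l) : (∃ i : ℕ, (a * b) ^ i = a) ∧ ∃ i : ℕ, (a * b) ^ i = b := by
  have h1 : ∀ {x : G} {n i j : ℕ}, x ^ n = 1 → i ≡ j [MOD n] → x ^ i = x ^ j := fun hx h =>
    pow_eq_pow_iff_modEq.2 (h.of_dvd (orderOf_dvd_of_pow_eq_one hx))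
  constructor
  · obtain ⟨i, h2, h3⟩ := Nat.chineseRemainder hkl 1 0
    exact ⟨i, by rw [hc.mul_pow, h1 ha h2, h1 hb h3, pow_one, pow_zero, mul_one]⟩
  · obtain ⟨i, h2, h3⟩ := Nat.chineseRemainder hkl 0 1
    exact ⟨i, by rw [hc.mul_pow, h1 ha h2, h1 hb h3, pow_one, pow_zero, one_mul]⟩

theorem orbit_dvd {α : Type*} [Finite α] (f : Equiv.Perm α) {d : ℕ}
    (h : ∀ x (k : ℕ), (f ^ k) x = x → d ∣ k) : d ∣ Nat.card α := by
  classical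
  have : Fintype α := Fintype.ofFinite α
  rw [Nat.card_congr (MulAction.selfEquivSigmaOrbits (Subgroup.zpowers f) α)]
  have : Fintype (MulAction.orbitRel.Quotient (Subgroup.zpowers f) α) := Fintype.ofFinite _
  rw [Nat.card_sigma]
  apply Finset.dvd_sum
  intro o _
  rw [Nat.card_congr (MulAction.orbitZPowersEquiv f o.out), Nat.card_zmod]
  apply h o.out
  have h1 := Function.isPeriodicPt_minimalPeriod (fun x => f • x) o.out
  have h3 : (fun x => f • x)^[Function.minimalPeriod (fun x => f • x) o.out] o.out = o.out := h1
  have h4 : ∀ k : ℕ, ∀ x, (fun x => f • x)^[k] x = (f ^ k) x := by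
    intro k
    induction k with
    | zero => intro x; rfl
    | succ k ih => intro x; rw [Function.iterate_succ_apply, ih, pow_succ]; rfl
  rwa [h4] at h3

section
variable {F V : Type*} [Field F] [AddCommGroup V] [Module F V] [Symp F V]
local notation "ω" => Symp.ω (F := F) (V := V)

theorem Split.inv_le {r : ℕ} {s : V ≃ₗ[F] V} {F0 W : Submodule F V} (h : Split r s F0 W) {U : Submodule F V}
    [FiniteDimensional F V]
    (hU : ∀ u ∈ U, s u ∈ U) (hd : finrank F U < finrank F W) : U ≤ F0 := by
  intro u hu
  rcases h.irr (U ⊓ W).toAddSubgroup (fun y hy => hy.2) (fun y hy => ⟨hU y hy.1, h.inv y hy.2⟩) with h1 | h1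
  · apply h.fix'
    rw [← sub_eq_zero]
    apply h1
    refine ⟨U.sub_mem (hU u hu) hu, ?_⟩
    obtain ⟨f, hf, w, hw, rfl⟩ := h.dec u
    have : s (f + w) - (f + w) = s w - w := by rw [map_add, h.fix f hf]; abel
    rw [this]
    exact W.sub_mem (h.inv w hw) hw
  · have : W ≤ U := fun w hw => (h1 w hw).1
    have := Submodule.finrank_mono this
    omega

variable [Finite F] [FiniteDimensional F V]
variable {p e m : ℕ} [CharP F p]

theorem fixed_vec (hp : p.Prime) {k : ℕ} {g : V ≃ₗ[F] V} (hg : g ^ p ^ k = 1) {U : Submodule F V} (hU : ∀ u ∈ U, g u ∈ U)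
    (h0 : U ≠ ⊥) : ∃ x ∈ U, g x = x ∧ x ≠ 0 := by
  have : Finite V := Module.finite_of_finite F
  let Z : AddSubgroup V := (U ⊓ fx g).toAddSubgroup
  have h1 := card_fix hp g hg U.toAddSubgroup Z hU
    (fun z => by
      change z ∈ U ⊓ fx g ↔ z ∈ U ∧ _
      rw [Submodule.mem_inf, mem_fx (g := g)])
  have h3 : p ∣ Nat.card U := by
    rw [Module.natCard_eq_pow_finrank (K := F)]
    refine dvd_pow ?_ (by rw [Ne, Submodule.finrank_eq_zero]; exact h0)
    have : Fintype F := Fintype.ofFinite F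
    rw [Nat.card_eq_fintype_card]
    have : Fact p.Prime := ⟨hp⟩
    obtain ⟨n, hn⟩ := FiniteField.card F p
    rw [hn.2]; exact dvd_pow_self p n.pos.ne'
  have h4 : p ∣ Nat.card Z := (Nat.modEq_zero_iff_dvd.1 (h1.symm.trans (Nat.modEq_zero_iff_dvd.2 h3)))
  have : Nontrivial Z := by
    apply Finite.one_lt_card_iff_nontrivial.1
    have := Nat.le_of_dvd Nat.card_pos h4
    have := hp.two_le
    omega
  obtain ⟨⟨z, hz⟩, hz0⟩ := exists_ne (0 : Z)
  have hz : z ∈ U ⊓ fx g := hz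
  exact ⟨z, hz.1, mem_fx.1 hz.2, fun h => hz0 (Subtype.ext h)⟩

variable (hC : Ctx F V p e m)
include hC
/-- the standard decomposition with block embeddings -/
theorem Ctx.exSplit {b r : ℕ} (hb : 0 < b) (hbm : 2 * b < m) (hr : Zs p (2 * (m - b) * e) r) :
    ∃ (S σ : V ≃ₗ[F] V) (K : ℕ) (Φ : ((Fin b ⊕ Fin b → F) ≃ₗ[F] (Fin b ⊕ Fin b → F)) →* (V ≃ₗ[F] V))
      (ι : (Fin b ⊕ Fin b → F) →ₗ[F] V), S ∈ Sp F V ∧ σ ∈ Sp F V ∧ S ^ (Nat.card F ^ (m - b) + 1) = 1 ∧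
      (S ^ K) ^ r = 1 ∧ S ^ K ≠ 1 ∧
      (∀ g ∈ Sp F (Fin b ⊕ Fin b → F), Φ g ∈ Sp F V) ∧ (∀ g, Commute (Φ g) S) ∧ (∀ g x, Φ g (ι x) = ι (g x)) ∧
      (∀ x y, ω (ι x) (ι y) = Symp.ω (F := F) x y) ∧ Function.Injective ι ∧
      (∀ v, v ∈ fx (S ^ K) ↔ ∃ x, v = ι x) ∧ (∀ x, S (ι x) = ι x) ∧
      (∀ g, ∀ w ∈ perp (fx (S ^ K)), Φ g w = w) ∧ (∀ g, Commute (Φ g) σ) ∧ Commute σ S ∧ σ ^ 2 = 1 ∧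
      (∀ v ∈ fx (S ^ K), σ v = v) ∧ (∀ v ∈ perp (fx (S ^ K)), σ v = -v) ∧
      (∀ (k : ℕ) (c : F), ∀ v ∈ perp (fx (S ^ K)), v ≠ 0 → (S ^ k) v = c • v →
        Nat.card F ^ (m - b) + 1 ∣ 2 * k) := by
  obtain ⟨ε, hε⟩ := hC.iso (b := b) (by omega)
  obtain ⟨s, hs, h1, h3⟩ := ML1 (V := Fin (m - b) ⊕ Fin (m - b) → F) hC.hp hC.h2 (a := m - b) (by omega) (by simp; ring)
  obtain ⟨k, hk⟩ := hC.dvd (by omega) hr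
  have hk0 : 0 < k := by
    rcases Nat.eq_zero_or_pos k with rfl | h
    · simp at hk
    · exact h
  have hfree : ∀ v, (s ^ k) v = v → v = 0 := by
    intro v hv
    by_contra h0
    have h5 := (h3 k v 1 h0 (by rw [hv]; simp)).2 rfl
    have h6 := Nat.le_of_dvd hk0 h5
    have h7 := hr.1.two_le
    rw [hk] at h6
    nlinarith
  let Φ : ((Fin b ⊕ Fin b → F) ≃ₗ[F] (Fin b ⊕ Fin b → F)) →* (V ≃ₗ[F] V) :=
    (trp ε).comp { toFun := fun g => pr g 1, map_one' := rfl, map_mul' := fun g h => rfl }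
  have hΦ : ∀ g x y, Φ g (ε (x, y)) = ε (g x, y) := fun g x y => trp_ap _ _ _
  let ι : (Fin b ⊕ Fin b → F) →ₗ[F] V := ε.toLinearMap.comp (LinearMap.inl F _ _)
  have hι : ∀ x, ι x = ε (x, 0) := fun _ => rfl
  let S := trp ε (pr 1 s)
  have hS : ∀ j : ℕ, S ^ j = trp ε (pr 1 (s ^ j)) := fun j => by
    rw [← map_pow, pr_pow, one_pow]
  have hSa : ∀ (j : ℕ) x y, (S ^ j) (ε (x, y)) = ε (x, (s ^ j) y) := fun j x y => by
    rw [hS, trp_ap]; rfl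
  have hSa1 : ∀ x y, S (ε (x, y)) = ε (x, s y) := fun x y => trp_ap _ _ _
  let σ := trp ε (pr 1 (ng F _))
  have hσ : ∀ x y, σ (ε (x, y)) = ε (x, -y) := fun x y => trp_ap _ _ _
  have hel : ∀ v, ∃ x y, v = ε (x, y) := fun v => by
    obtain ⟨⟨x, y⟩, h⟩ := ε.surjective v; exact ⟨x, y, h.symm⟩
  have hfx : ∀ v, v ∈ fx (S ^ k) ↔ ∃ x, v = ι x := by
    intro v
    rw [mem_fx]
    constructor
    · intro h
      obtain ⟨x, y, rfl⟩ := hel v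
      rw [hSa] at h
      have h := congrArg Prod.snd (ε.injective h)
      exact ⟨x, by rw [hι, hfree y h]⟩
    · rintro ⟨x, rfl⟩
      rw [hι, hSa, map_zero]
  have hpp : ∀ v ∈ perp (fx (S ^ k)), ∃ y, v = ε (0, y) := by
    intro v hv
    obtain ⟨x, y, rfl⟩ := hel v
    refine ⟨y, ?_⟩
    suffices x = 0 by rw [this]
    apply Symp.nd (F := F)
    intro w
    have := mem_perp'.1 hv (ι w) ((hfx _).2 ⟨w, rfl⟩)
    rw [hι, hε, prod_om] at this
    simpa using this
  refine ⟨S, σ, k, Φ, ι, trp_mem hε (pr_mem (one_mem _) hs), trp_mem hε (pr_mem (one_mem _) ng_mem), ?_, ?_, ?_,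
    fun g hg => trp_mem hε (pr_mem hg (one_mem _)), ?_, fun g x => hΦ g x 0, ?_, ?_, hfx, ?_, ?_, ?_, ?_, ?_, ?_, ?_, ?_⟩
  · rw [hS, h1, pr_one, map_one]
  · rw [← pow_mul, hS, mul_comm k, ← hk, h1, pr_one, map_one]
  · intro h
    have : Nontrivial (Fin (m - b) ⊕ Fin (m - b) → F) := by
      have : Nonempty (Fin (m - b)) := ⟨⟨0, by omega⟩⟩
      infer_instance
    obtain ⟨v, hv⟩ := exists_ne (0 : Fin (m - b) ⊕ Fin (m - b) → F)
    have h5 := hSa k 0 v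
    rw [h, one_ap] at h5
    exact hv (hfree v (congrArg Prod.snd (ε.injective h5)).symm)
  · intro g
    change _ * _ = _ * _
    ext v
    obtain ⟨x, y, rfl⟩ := hel v
    rw [mul_ap, mul_ap, hSa1, hΦ, hΦ, hSa1]
  · intro x y
    rw [hι, hι, hε, prod_om]; simp
  · intro x y h
    exact congrArg Prod.fst (ε.injective h)
  · intro x
    rw [hι, hSa1, map_zero]
  · intro g w hw
    obtain ⟨y, rfl⟩ := hpp w hw
    rw [hΦ, map_zero]
  · intro g
    change _ * _ = _ * _
    ext v
    obtain ⟨x, y, rfl⟩ := hel v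
    rw [mul_ap, mul_ap, hσ, hΦ, hΦ, hσ]
  · change _ * _ = _ * _
    ext v
    obtain ⟨x, y, rfl⟩ := hel v
    rw [mul_ap, mul_ap, hσ, hSa1, hSa1, hσ, map_neg]
  · ext v
    obtain ⟨x, y, rfl⟩ := hel v
    rw [pow_two, mul_ap, hσ, hσ, neg_neg, one_ap]
  · intro v hv
    obtain ⟨x, rfl⟩ := (hfx v).1 hv
    rw [hι, hσ, neg_zero]
  · intro v hv
    obtain ⟨y, rfl⟩ := hpp v hv
    rw [hσ, ← map_neg]; simp
  · intro j c v hv h0 h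
    obtain ⟨y, rfl⟩ := hpp v hv
    rw [hSa, ← map_smul] at h
    have h := congrArg Prod.snd (ε.injective h)
    exact (h3 j y c (by rintro rfl; apply h0; exact ε.map_zero) h).1
end
end P9

set_option linter.unusedSectionVars false
set_option linter.unusedSimpArgs false
set_option linter.unusedVariables false
set_option autoImplicit false
section P10
open Module
section
variable {F V : Type*} [Field F] [AddCommGroup V] [Module F V] [Symp F V]
local notation "ω" => Symp.ω (F := F) (V := V)

def NoLine (g : V ≃ₗ[F] V) : Prop := ∀ x : V, x ≠ 0 → ∀ c : F, g x ≠ c • x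
def NoPlane (g : V ≃ₗ[F] V) : Prop := ∀ x y : V, ω x y ≠ 0 →
  (∀ u ∈ Submodule.span F (Set.range ![x, y]), g u ∈ Submodule.span F (Set.range ![x, y])) → False

theorem eig_pow {g : V ≃ₗ[F] V} {x : V} {c : F} (h : g x = c • x) (k : ℕ) : (g ^ k) x = c ^ k • x := by
  induction k with
  | zero => simp
  | succ k ih => rw [pow_succ, mul_ap, h, map_smul, ih, smul_smul, pow_succ]; congr 1; ring

theorem fr2 (x y : V) : finrank F (Submodule.span F (Set.range ![x, y])) ≤ 2 := by
  have := finrank_range_le_card (R := F) ![x, y]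
  simpa [Set.finrank] using this

theorem tv_comm_fix {g : V ≃ₗ[F] V} (hg : g ∈ Sp F V) {x : V} {c : F} (hx : g x = x) : Commute (tv x c) g := by
  have := tv_conj hg x c
  rw [hx, mul_inv_eq_iff_eq_mul] at this
  exact this.symm

theorem line_le [FiniteDimensional F V] {r j : ℕ} {g : V ≃ₗ[F] V} {F0 W : Submodule F V} (h : Split r (g ^ j) F0 W) (hd : 2 < finrank F W)
    {x : V} {c : F} (hx : g x = c • x) : x ∈ F0 := by
  have : Submodule.span F {x} ≤ F0 := by
    apply h.inv_le
    · intro u hu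
      obtain ⟨a, rfl⟩ := Submodule.mem_span_singleton.1 hu
      rw [map_smul, eig_pow hx, smul_smul]
      exact Submodule.smul_mem _ _ (Submodule.mem_span_singleton_self x)
    · have := finrank_span_le_card (R := F) ({x} : Set V); simp at this; omega
  exact this (Submodule.mem_span_singleton_self x)

theorem plane_le [FiniteDimensional F V] {r j : ℕ} {g : V ≃ₗ[F] V} {F0 W : Submodule F V} (h : Split r (g ^ j) F0 W) (hd : 2 < finrank F W)
    {U : Submodule F V} (hU : finrank F U ≤ 2) (hi : ∀ u ∈ U, g u ∈ U) : U ≤ F0 :=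
  h.inv_le (pow_inv_mem hi j) (by omega)

theorem Split.eigc {r : ℕ} {s : V ≃ₗ[F] V} {F0 W : Submodule F V} (h : Split r s F0 W) {g : V ≃ₗ[F] V} (hf : ∀ v ∈ F0, g v ∈ F0)
    (hw : ∀ v ∈ W, g v ∈ W) {f w : V} (h1 : f ∈ F0) (h3 : w ∈ W) {c : F} (he : g (f + w) = c • (f + w)) : g f = c • f ∧ g w = c • w := by
  have h4 : g f - c • f = -(g w - c • w) := by
    rw [map_add, smul_add] at he
    have := sub_eq_zero.2 he
    rw [eq_neg_iff_add_eq_zero, ← this]; abel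
  have h5 : g f - c • f ∈ F0 := F0.sub_mem (hf _ h1) (F0.smul_mem _ h1)
  have h6 := h.inf _ h5 (by rw [h4]; exact W.neg_mem (W.sub_mem (hw _ h3) (W.smul_mem _ h3)))
  rw [h6, eq_comm, neg_eq_zero] at h4
  exact ⟨sub_eq_zero.1 h6, sub_eq_zero.1 h4⟩

theorem fx_inv {g s : V ≃ₗ[F] V} (hc : Commute g s) : ∀ v ∈ fx s, g v ∈ fx s := by
  intro v hv
  rw [mem_fx] at hv ⊢
  rw [← mul_ap, ← hc.eq, mul_ap, hv]

theorem perp_inv {g : V ≃ₗ[F] V} (hg : g ∈ Sp F V) [FiniteDimensional F V] {U : Submodule F V} (hU : ∀ v ∈ U, g v ∈ U) :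
    ∀ v ∈ perp U, g v ∈ perp U := by
  have h1 : U.map g.toLinearMap = U := by
    apply Submodule.eq_of_le_of_finrank_eq
    · rintro _ ⟨v, hv, rfl⟩; exact hU v hv
    · exact LinearEquiv.finrank_map_eq g U
  intro v hv
  rw [mem_perp] at hv ⊢
  intro u hu
  rw [← h1] at hu
  obtain ⟨u, hu, rfl⟩ := hu
  exact (hg u v).trans (hv u hu)

variable [Finite F] [FiniteDimensional F V]
variable {p e m : ℕ} [CharP F p] (hC : Ctx F V p e m)
include hC

theorem Ctx.q3 : 3 ≤ Nat.card F := (q_odd (F := F) hC.hp hC.h2).2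
theorem Ctx.qpow {a : ℕ} (ha : 0 < a) : 3 ≤ Nat.card F ^ a := le_trans hC.q3 (Nat.le_self_pow ha.ne' _)

theorem Ctx.sp {a r : ℕ} (ha : 0 < a) (ham : m < 2 * a) (hr : Zs p (2 * a * e) r) {s : V ≃ₗ[F] V} (hs : s ∈ Sp F V)
    (h1 : s ^ r = 1) (h3 : s ≠ 1) : Split r s (fx s) (perp (fx s)) ∧ finrank F (fx s) + 2 * a = 2 * m ∧
      finrank F (perp (fx s)) = 2 * a := by
  obtain ⟨hS, hd⟩ := lemZ hC.hp hC.hq hC.he ha ham hr hC.hV hs h3 h1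
  have := finrank_perp (fx s)
  rw [hC.hV] at this
  exact ⟨hS, hd, by omega⟩

theorem Ctx.exA {r : ℕ} (hr : Zs p (2 * m * e) r) : ∃ A ∈ Sp F V, NoLine A ∧ NoPlane A ∧
    (∀ (k : ℕ) (v : V) (c : F), v ≠ 0 → (A ^ k) v = c • v → Nat.card F ^ m + 1 ∣ 2 * k) ∧
    ∃ i : ℕ, (A ^ i) ^ r = 1 ∧ A ^ i ≠ 1 := by
  have hm := hC.hm
  obtain ⟨s, hs, h1, h3⟩ := ML1 (V := V) hC.hp hC.h2 (by omega) hC.hV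
  obtain ⟨k, hk⟩ := hC.dvd (by omega) hr
  have hk0 : 0 < k := by
    rcases Nat.eq_zero_or_pos k with rfl | h
    · simp at hk
    · exact h
  have hr1 : (s ^ k) ^ r = 1 := by rw [← pow_mul, mul_comm k, ← hk, h1]
  have hne : s ^ k ≠ 1 := by
    intro h4
    have := hC.ntv
    obtain ⟨v, hv⟩ := exists_ne (0 : V)
    have h5 := (h3 k v 1 hv (by rw [h4]; simp)).2 rfl
    have h6 := Nat.le_of_dvd hk0 h5
    have h7 := hr.1.two_le
    rw [hk] at h6
    nlinarith
  obtain ⟨hS, hd, hd'⟩ := hC.sp (by omega) (by omega) hr (pow_mem hs k) hr1 hne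
  have hb : fx (s ^ k) = ⊥ := by rw [← Submodule.finrank_eq_zero (R := F)]; omega
  refine ⟨s, hs, ?_, ?_, fun k v c hv h => (h3 k v c hv h).1, k, hr1, hne⟩
  · intro x hx c h
    have := line_le hS (by omega) h
    rw [hb] at this
    exact hx this
  · intro x y hxy h
    have := plane_le hS (by omega) (fr2 x y) h (Submodule.subset_span ⟨0, rfl⟩)
    rw [hb] at this
    have hx : x = 0 := this
    rw [hx] at hxy
    simp at hxy

theorem Ctx.exD : ∃ D ∈ Sp F V, NoLine D ∧
    (∀ (k : ℕ) (v : V) (c : F), v ≠ 0 → (D ^ k) v = c • v → Nat.card F ^ m - 1 ∣ k * (Nat.card F - 1)) := by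
  have hm := hC.hm
  obtain ⟨s, hs, h3⟩ := ML2 (V := V) hC.hp (by omega) hC.hV
  refine ⟨s, hs, ?_, h3⟩
  intro x hx c h
  have h1 := h3 1 x c hx (by rwa [pow_one])
  have hq := hC.q3
  have h4 := Nat.le_of_dvd (by omega) h1
  have h5 : Nat.card F ^ 2 ≤ Nat.card F ^ m := Nat.pow_le_pow_right (by omega) (by omega)
  have : Nat.card F * 3 ≤ Nat.card F ^ 2 := by nlinarith
  omega

theorem Ctx.not_dvd {a r : ℕ} (hr : Zs p (2 * a * e) r) {b : ℕ} (hb : 0 < b) (hba : b < a) : ¬ r ∣ Nat.card F ^ b + 1 := by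
  intro h
  rw [hC.hq, ← pow_mul] at h
  have h3 : p ^ (2 * (e * b)) - 1 = (p ^ (e * b) + 1) * (p ^ (e * b) - 1) := by
    rw [show 2 * (e * b) = (e * b) * 2 by ring, pow_mul, ← one_pow 2, Nat.sq_sub_sq, one_pow]
  have h4 : r ∣ p ^ (2 * (e * b)) - 1 := h3 ▸ Dvd.dvd.mul_right h _
  have h5 := Nat.le_of_dvd (by have := hC.he; positivity) ((hr.dvd_iff hC.hp.pos _).1 h4)
  have := hC.he
  nlinarith

theorem Ctx.exB {r : ℕ} (hr : Zs p (2 * (m - 1) * e) r) : ∃ B ∈ Sp F V, ∃ (i j k : ℕ) (x : V) (c : F),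
    B ^ i = tv x c ∧ x ≠ 0 ∧ c ≠ 0 ∧ (B ^ j) ^ r = 1 ∧ B ^ j ≠ 1 ∧
    (∀ v ∈ fx (B ^ j), (B ^ k) v = v) ∧ (∀ v ∈ perp (fx (B ^ j)), (B ^ k) v = -v) := by
  have hm := hC.hm
  obtain ⟨S, σ, K, Φ, ι, hS, hσ, e1, e2, e3, e4, e5, e6, e7, e8, e9, e10, e11, e12, e13, e14, e15, e16, e17⟩ :=
    hC.exSplit (b := 1) (by omega) (by omega) hr
  let x : V := ι 1
  have hx : x ≠ 0 := by
    intro h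
    have h1 : (1 : Fin 1 ⊕ Fin 1 → F) = 0 := e8 (by rw [map_zero]; exact h)
    have := congrFun h1 (.inl 0)
    simp at this
  have hxf : x ∈ fx (S ^ K) := (e9 x).2 ⟨_, rfl⟩
  have hc1 : Commute (tv x (1 : F)) σ := tv_comm_fix hσ (e15 x hxf)
  have hc3 : Commute (tv x (1 : F) * σ) (S ^ K) :=
    (tv_comm_fix (pow_mem hS K) (mem_fx.1 hxf)).mul_left (e13.pow_right K)
  have hp2 := hC.podd.coprime_two_right
  have hpw : (tv x (1 : F) * σ) ^ (p * 2) = 1 := by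
    rw [hc1.mul_pow, pow_mul, tv_p (p := p), mul_comm p 2, pow_mul, e14]; simp
  have hro := hC.r_odd (by omega) hr
  have hrp : Nat.Coprime (p * 2) r := by
    rw [Nat.coprime_mul_iff_left]
    exact ⟨(Nat.coprime_primes hC.hp hr.1).2 (hr.ne (Nat.mul_pos (by omega) hC.he)).symm, hro.coprime_two_left⟩
  obtain ⟨⟨i1, h1⟩, j1, h3⟩ := crt hc3 hpw e2 hrp
  obtain ⟨⟨i2, h4⟩, j2, h5⟩ := crt hc1 (tv_p (p := p) x 1) e14 hp2
  refine ⟨tv x 1 * σ * S ^ K, mul_mem (mul_mem (tv_mem _ _) hσ) (pow_mem hS K), i1 * i2, j1, i1 * j2, x, 1, ?_, hx, one_ne_zero, ?_⟩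
  · rw [pow_mul, h1, h4]
  · rw [h3, pow_mul, h1, h5]
    exact ⟨e2, e3, e15, e16⟩

theorem Ctx.exC1 {r : ℕ} (hr : Zs p (2 * (m - 1) * e) r) : ∃ C ∈ Sp F V, NoLine C ∧ ∃ j : ℕ,
    (C ^ j) ^ r = 1 ∧ C ^ j ≠ 1 ∧ ∀ (k : ℕ) (v : V) (c : F), v ∉ fx (C ^ j) → (C ^ k) v = c • v →
      Nat.card F ^ (m - 1) + 1 ∣ 2 * k := by
  have hm := hC.hm
  obtain ⟨S, σ, K, Φ, ι, hS, hσ, e1, e2, e3, e4, e5, e6, e7, e8, e9, e10, e11, e12, e13, e14, e15, e16, e17⟩ :=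
    hC.exSplit (b := 1) (by omega) (by omega) hr
  obtain ⟨z, hz, h1, h3⟩ := ML1 (V := Fin 1 ⊕ Fin 1 → F) hC.hp hC.h2 (a := 1) (by omega) (by simp)
  have hq := hC.q3
  have hnd := hC.not_dvd hr (b := 1) (by omega) (by omega)
  rw [pow_one] at h1 h3 hnd
  have hN : (Φ z * S) ^ ((Nat.card F + 1) * K) = (S ^ K) ^ (Nat.card F + 1) := by
    rw [(e5 z).mul_pow, pow_mul, ← map_pow, h1, map_one, one_pow, one_mul, mul_comm, pow_mul]
  have hco : Nat.Coprime r (Nat.card F + 1) := (Nat.Prime.coprime_iff_not_dvd hr.1).2 hnd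
  have hne : (S ^ K) ^ (Nat.card F + 1) ≠ 1 := by
    intro h
    have := pow_gcd_eq_one.2 ⟨e2, h⟩
    rw [hco, pow_one] at this
    exact e3 this
  have hR : ((S ^ K) ^ (Nat.card F + 1)) ^ r = 1 := by rw [← pow_mul, mul_comm, pow_mul, e2, one_pow]
  obtain ⟨hsp, hd, hd'⟩ := hC.sp (by omega) (by omega) hr (pow_mem hS K) e2 e3
  obtain ⟨_, hd1, _⟩ := hC.sp (by omega) (by omega) hr (pow_mem (pow_mem hS K) _) hR hne
  have hfx : fx (S ^ K) = fx ((S ^ K) ^ (Nat.card F + 1)) := by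
    apply Submodule.eq_of_le_of_finrank_eq
    · intro v hv
      have := eig_pow (c := 1) (g := S ^ K) (x := v) (by rw [mem_fx.1 hv]; simp) (Nat.card F + 1)
      rw [mem_fx, this]; simp
    · omega
  have hC1 : Φ z * S ∈ Sp F V := mul_mem (e4 z hz) hS
  have hcom : ∀ k : ℕ, Commute ((Φ z * S) ^ k) (S ^ K) := fun k => (((e5 z).mul_left (Commute.refl S)).pow_right K).pow_left k
  have hkey : ∀ (k : ℕ) (v : V) (c : F), v ∉ fx (S ^ K) → ((Φ z * S) ^ k) v = c • v → Nat.card F ^ (m - 1) + 1 ∣ 2 * k := by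
    intro k v c hv h
    obtain ⟨f, hf, w, hw, rfl⟩ := hsp.dec v
    obtain ⟨h5, h6⟩ := hsp.eigc (fx_inv (hcom k)) (perp_inv (pow_mem hC1 k) (fx_inv (hcom k))) hf hw h
    refine e17 k c w hw ?_ ?_
    · rintro rfl; rw [add_zero] at hv; exact hv hf
    · rw [← h6, ((e5 z).mul_pow k), ((e5 z).pow_pow k k).eq, mul_ap, ← map_pow, e11 _ w hw]
  refine ⟨Φ z * S, hC1, ?_, (Nat.card F + 1) * K, ?_⟩
  · intro v hv c h
    by_cases h0 : v ∈ fx (S ^ K)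
    · obtain ⟨x, rfl⟩ := (e9 v).1 h0
      rw [mul_ap, e10, e6, ← map_smul] at h
      have h5 := (h3 1 x c (by rintro rfl; simp at hv) (by rw [pow_one]; exact e8 h)).1
      have := Nat.le_of_dvd (by omega) h5
      omega
    · have h5 := hkey 1 v c h0 (by rwa [pow_one])
      have := Nat.le_of_dvd (by omega) h5
      have := hC.qpow (a := m - 1) (by omega)
      omega
  · rw [hN, ← hfx]
    exact ⟨hR, hne, hkey⟩
end
end P10

set_option linter.unusedSectionVars false
set_option linter.unusedSimpArgs false
set_option linter.unusedVariables false
set_option autoImplicit false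
section P11
open Module
section
variable {F V : Type*} [Field F] [AddCommGroup V] [Module F V] [Symp F V]
local notation "ω" => Symp.ω (F := F) (V := V)

theorem mem_pl {x y u : V} : u ∈ Submodule.span F (Set.range ![x, y]) ↔ ∃ a b : F, a • x + b • y = u := by
  have : Set.range ![x, y] = {x, y} := by ext z; simp [eq_comm]; tauto
  rw [this, Submodule.mem_span_pair]

theorem om_lin {x y : V} (a b c d : F) : ω (a • x + b • y) (c • x + d • y) = (a * d - b * c) * ω x y := by
  simp only [map_add, map_smul, LinearMap.add_apply, LinearMap.smul_apply, smul_eq_mul, om_self, om_neg x y]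
  ring

theorem plane_par {x y u v : V} (h : ω x y ≠ 0) (hu : u ∈ Submodule.span F (Set.range ![x, y]))
    (hv : v ∈ Submodule.span F (Set.range ![x, y])) (h0 : u ≠ 0) (huv : ω u v = 0) : ∃ c : F, v = c • u := by
  obtain ⟨a, b, rfl⟩ := mem_pl.1 hu
  obtain ⟨c, d, rfl⟩ := mem_pl.1 hv
  rw [om_lin] at huv
  have h1 : a * d - b * c = 0 := (mul_eq_zero.1 huv).resolve_right h
  by_cases ha : a = 0
  · have hb : b ≠ 0 := by rintro rfl; simp [ha] at h0
    have hc : c = 0 := by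
      rw [ha] at h1
      have : b * c = 0 := by linear_combination -h1
      exact (mul_eq_zero.1 this).resolve_left hb
    refine ⟨d / b, ?_⟩
    subst ha hc
    rw [smul_add, smul_smul, smul_smul, div_mul_cancel₀ _ hb]; simp
  · refine ⟨c / a, ?_⟩
    rw [smul_add, smul_smul, smul_smul, div_mul_cancel₀ _ ha]
    congr 2
    field_simp
    linear_combination h1

theorem plane_nd {x y u : V} (h : ω x y ≠ 0) (hu : u ∈ Submodule.span F (Set.range ![x, y]))
    (h1 : ω x u = 0) (h3 : ω y u = 0) : u = 0 := by
  obtain ⟨a, b, rfl⟩ := mem_pl.1 hu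
  simp only [map_add, map_smul, smul_eq_mul, om_self, mul_zero, zero_add, add_zero, om_neg x y] at h1 h3
  have h4 : a = 0 := (mul_eq_zero.1 h3).resolve_right (neg_ne_zero.2 h)
  have h5 : b = 0 := (mul_eq_zero.1 h1).resolve_right h
  simp [h4, h5]

variable [Finite F] [FiniteDimensional F V]
variable {p e m : ℕ} [CharP F p] 

theorem dim4C (hp : p.Prime) (h2 : (2 : F) ≠ 0) (hV : finrank F V = 4) : ∃ t ∈ Sp F V, ∃ d : ℕ, Nat.card F ^ 2 + 1 = 2 * d ∧ Odd d ∧ 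
    t ^ d = 1 ∧ NoLine t ∧ NoPlane t := by
  obtain ⟨s, hs, h1, h3⟩ := ML1 (V := V) hp h2 (a := 2) (by omega) hV
  obtain ⟨⟨k, hk⟩, hq⟩ := q_odd (F := F) hp h2
  have hd : Nat.card F ^ 2 + 1 = 2 * (2 * (k ^ 2 + k) + 1) := by rw [hk]; ring
  rw [hd] at h1 h3
  refine ⟨s ^ 2, pow_mem hs 2, _, hd, ⟨k ^ 2 + k, rfl⟩, by rw [← pow_mul, h1], ?_, ?_⟩
  · intro x hx c h
    have := Nat.le_of_dvd (by omega) (h3 2 x c hx h).1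
    nlinarith
  · intro x y hxy hU
    have hx0 : x ≠ 0 := by rintro rfl; simp at hxy
    set U := Submodule.span F (Set.range ![x, y]) with hUd
    have hxU : x ∈ U := mem_pl.2 ⟨1, 0, by simp⟩
    have h4 := fr2 (F := F) x y
    have := Module.finite_of_finite F (M := V)
    have hinj : Set.InjOn (s ^ 2 : V ≃ₗ[F] V) {u | u ∈ U ∧ u ≠ 0} := (s ^ 2 : V ≃ₗ[F] V).injective.injOn
    let f0 : {u // u ∈ U ∧ u ≠ 0} → {u // u ∈ U ∧ u ≠ 0} := fun u => ⟨(s ^ 2) u.1, hU _ u.2.1, fun h => u.2.2 (by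
      rwa [LinearEquiv.map_eq_zero_iff] at h)⟩
    have hf0 : Function.Bijective f0 := by
      apply Function.Injective.bijective_of_finite
      intro u v h
      have : (s ^ 2) u.1 = (s ^ 2) v.1 := congrArg Subtype.val h
      exact Subtype.ext ((s ^ 2 : V ≃ₗ[F] V).injective this)
    let f : Equiv.Perm {u // u ∈ U ∧ u ≠ 0} := Equiv.ofBijective f0 hf0
    have hf : ∀ (k : ℕ) u, ((f ^ k) u).1 = ((s ^ 2) ^ k) u.1 := by
      intro k
      induction k with
      | zero => intro u; rfl
      | succ k ih => intro u; rw [pow_succ f, Equiv.Perm.mul_apply, ih, pow_succ (s ^ 2), mul_ap]; rfl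
    have h5 := orbit_dvd (d := 2 * (k ^ 2 + k) + 1) f (by
      intro u j h
      have h6 := hf j u
      rw [h, ← pow_mul] at h6
      have := (h3 (2 * j) u.1 1 u.2.2 (by rw [← h6]; simp)).2 rfl
      exact Nat.dvd_of_mul_dvd_mul_left (by omega) this)
    have h6 : Nat.card {u // u ∈ U ∧ u ≠ 0} + 1 = Nat.card F ^ finrank F U := by
      rw [← Module.natCard_eq_pow_finrank (K := F) (V := U)]
      have h7 : Nat.card {u // u ∈ U ∧ u ≠ 0} = Nat.card {u : U // u ≠ 0} := Nat.card_congr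
        { toFun := fun u => ⟨⟨u.1, u.2.1⟩, fun h => u.2.2 (congrArg Subtype.val h)⟩
          invFun := fun u => ⟨u.1.1, u.1.2, fun h => u.2 (Subtype.ext h)⟩
          left_inv := fun u => rfl
          right_inv := fun u => rfl }
      rw [h7]
      have := Fintype.ofFinite U
      classical
      rw [Nat.card_eq_fintype_card, Nat.card_eq_fintype_card, Fintype.card_subtype_compl]
      have : 0 < Fintype.card U := Fintype.card_pos
      simp; omega
    have h8 : finrank F U ≠ 0 := by
      intro h
      rw [Submodule.finrank_eq_zero] at h
      rw [h] at hxU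
      exact hx0 hxU
    rw [← hUd] at h4
    have h9 : finrank F U = 1 ∨ finrank F U = 2 := by omega
    rcases h9 with h9 | h9
    · rw [h9, pow_one] at h6
      have := Nat.le_of_dvd (by omega) h5
      nlinarith
    · rw [h9] at h6
      have h10 : Nat.card {u // u ∈ U ∧ u ≠ 0} + 2 = 2 * (2 * (k ^ 2 + k) + 1) := by omega
      have h11 : 2 * (k ^ 2 + k) + 1 ∣ 2 := (Nat.dvd_add_right h5).1 (h10 ▸ Dvd.intro_left _ rfl)
      have := Nat.le_of_dvd (by omega) h11
      nlinarith

theorem cop_p {n : ℕ} (hp : p.Prime) (hpq : p ∣ Nat.card F) : Nat.Coprime p (Nat.card F + 1) := by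
  rw [Nat.Prime.coprime_iff_not_dvd hp]
  intro h
  have := (Nat.dvd_add_right hpq).1 h
  exact hp.one_lt.ne' (Nat.dvd_one.1 this)

theorem dim4Y (hp : p.Prime) (h2 : (2 : F) ≠ 0) (hpq : p ∣ Nat.card F) (hV : finrank F V = 4) : ∃ u ∈ Sp F V, ∃ z ∈ Sp F V, Commute u z ∧ u ^ p = 1 ∧ u ≠ 1 ∧
    z ^ (Nat.card F + 1) = 1 ∧ (∀ v, ω v (u v) = 0 → u v = v) ∧ NoLine (u * z) ∧ NoPlane (u * z) := by
  obtain ⟨u, hu, z, hz, hc, h1, h3, h4, h5, h6, h7⟩ := ML3 (V := V) hp h2 hV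
  obtain ⟨⟨i, hi⟩, j, hj⟩ := crt hc h1 h4 (cop_p (n := 0) hp hpq)
  refine ⟨u, hu, z, hz, hc, h1, h3, h4, h6, ?_, ?_⟩
  · intro x hx c h
    have := eig_pow h j
    rw [hj] at this
    exact h5 x _ hx this
  · intro x y hxy hU
    have hUu := pow_inv_mem hU i
    have hUz := pow_inv_mem hU j
    rw [hi] at hUu
    rw [hj] at hUz
    obtain ⟨a, ha, ha1, ha0⟩ := fixed_vec (k := 1) hp (by rw [pow_one]; exact h1) hUu (by
      intro h
      have : x ∈ (⊥ : Submodule F V) := h ▸ mem_pl.2 ⟨1, 0, by simp⟩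
      have : x = 0 := this
      rw [this] at hxy; simp at hxy)
    have hza : u (z a) = z a := by rw [← mul_ap, hc.eq, mul_ap, ha1]
    obtain ⟨c, hc⟩ := plane_par hxy ha (hUz a ha) ha0 (h7 _ _ ha1 hza)
    exact h5 a c ha0 hc

theorem dim4J (hp : p.Prime) (hV : finrank F V = 4) : ∃ n ∈ Sp F V, n ^ p ^ 4 = 1 ∧ NoPlane n ∧
    ∃ v0 : V, v0 ≠ 0 ∧ ∀ v, n v = v → ∃ c : F, v = c • v0 := by
  obtain ⟨n, hn, h1, v0, h0, h3⟩ := ML4 (V := V) hp hV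
  refine ⟨n, hn, h1, ?_, v0, h0, h3⟩
  intro x y hxy hU
  set U := Submodule.span F (Set.range ![x, y]) with hUd
  have hxU : x ∈ U := mem_pl.2 ⟨1, 0, by simp⟩
  have hyU : y ∈ U := mem_pl.2 ⟨0, 1, by simp⟩
  obtain ⟨a, ha, ha1, ha0⟩ := fixed_vec hp h1 hU (by
      intro h
      rw [h] at hxU
      have : x = 0 := hxU
      rw [this] at hxy; simp at hxy)
  obtain ⟨b, hb, hb1, hb0⟩ := fixed_vec hp h1 (perp_inv hn hU) (by
      intro h
      have := finrank_perp U
      have h5 := fr2 (F := F) x y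
      rw [← hUd] at h5
      rw [h, finrank_bot] at this
      omega)
  obtain ⟨c, rfl⟩ := h3 a ha1
  obtain ⟨d, rfl⟩ := h3 b hb1
  have hd : d ≠ 0 := by rintro rfl; simp at hb0
  have : c • v0 ∈ perp U := by
    have := (perp U).smul_mem (c / d) hb
    rwa [smul_smul, div_mul_cancel₀ _ hd] at this
  exact ha0 (plane_nd hxy ha (mem_perp.1 this x hxU) (mem_perp.1 this y hyU))
end

section
variable {F V : Type*} [Field F] [AddCommGroup V] [Module F V] [Symp F V]
local notation "ω" => Symp.ω (F := F) (V := V)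
variable [Finite F] [FiniteDimensional F V]

theorem lift_line {r j : ℕ} {g : V ≃ₗ[F] V} {F0 W : Submodule F V} (h : Split r (g ^ j) F0 W) (hd : 2 < finrank F W)
    {V0 : Type*} [AddCommGroup V0] [Module F V0] [Symp F V0] {ι : V0 →ₗ[F] V} {g0 : V0 ≃ₗ[F] V0} (hg : ∀ x, g (ι x) = ι (g0 x))
    (hi : Function.Injective ι) (hF : ∀ v, v ∈ F0 → ∃ x, v = ι x) (hl : NoLine g0) : NoLine g := by
  intro x hx c hc
  obtain ⟨x, rfl⟩ := hF _ (line_le h hd hc)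
  rw [hg, ← map_smul] at hc
  exact hl x (by rintro rfl; simp at hx) c (hi hc)

theorem lift_plane {r j : ℕ} {g : V ≃ₗ[F] V} {F0 W : Submodule F V} (h : Split r (g ^ j) F0 W) (hd : 2 < finrank F W)
    {V0 : Type*} [AddCommGroup V0] [Module F V0] [Symp F V0] {ι : V0 →ₗ[F] V} {g0 : V0 ≃ₗ[F] V0} (hg : ∀ x, g (ι x) = ι (g0 x))
    (ho : ∀ x y, ω (ι x) (ι y) = Symp.ω (F := F) x y)
    (hi : Function.Injective ι) (hF : ∀ v, v ∈ F0 → ∃ x, v = ι x) (hl : NoPlane g0) : NoPlane g := by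
  intro x y hxy hU
  have h1 := plane_le h hd (fr2 x y) hU
  obtain ⟨x, rfl⟩ := hF x (h1 (mem_pl.2 ⟨1, 0, by simp⟩))
  obtain ⟨y, rfl⟩ := hF y (h1 (mem_pl.2 ⟨0, 1, by simp⟩))
  rw [ho] at hxy
  refine hl x y hxy fun u hu => ?_
  obtain ⟨a, b, rfl⟩ := mem_pl.1 hu
  obtain ⟨c, d, hcd⟩ := mem_pl.1 (hU (ι (a • x + b • y)) (mem_pl.2 ⟨a, b, by simp⟩))
  rw [hg] at hcd
  exact mem_pl.2 ⟨c, d, hi (by rw [← hcd]; simp)⟩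

variable {p e m : ℕ} [CharP F p] (hC : Ctx F V p e m)
include hC

theorem Ctx.rp {a r : ℕ} (ha : 0 < a) (hr : Zs p (2 * a * e) r) : Nat.Coprime p r :=
  (Nat.coprime_primes hC.hp hr.1).2 (hr.ne (Nat.mul_pos (by omega) hC.he)).symm

theorem Ctx.pq : p ∣ Nat.card F := by rw [hC.hq]; exact dvd_pow_self p hC.he.ne'

theorem Ctx.exC2 {r : ℕ} (hr : Zs p (2 * (m - 2) * e) r) : ∃ C ∈ Sp F V, NoLine C ∧ NoPlane C ∧ ∃ j k : ℕ,
    (C ^ j) ^ r = 1 ∧ C ^ j ≠ 1 ∧ (∀ v ∈ fx (C ^ j), (C ^ k) v = v) ∧ (∀ v ∈ perp (fx (C ^ j)), (C ^ k) v = -v) := by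
  have hm := hC.hm
  obtain ⟨S, σ, K, Φ, ι, hS, hσ, e1, e2, e3, e4, e5, e6, e7, e8, e9, e10, e11, e12, e13, e14, e15, e16, e17⟩ :=
    hC.exSplit (b := 2) (by omega) (by omega) hr
  obtain ⟨t, ht, d, hd, hdo, h1, h3, h4⟩ := dim4C (V := Fin 2 ⊕ Fin 2 → F) hC.hp hC.h2 (by simp)
  obtain ⟨hsp, hd1, hd2⟩ := hC.sp (by omega) (by omega) hr (pow_mem hS K) e2 e3
  have hc3 : Commute (Φ t * σ) (S ^ K) := ((e5 t).pow_right K).mul_left (e13.pow_right K)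
  have hpw : (Φ t * σ) ^ (d * 2) = 1 := by
    rw [(e12 t).mul_pow, pow_mul, ← map_pow, h1, mul_comm d 2, pow_mul, e14]; simp
  have hro := hC.r_odd (by omega) hr
  have hrp : Nat.Coprime (d * 2) r := by
    rw [mul_comm, ← hd]
    exact ((Nat.Prime.coprime_iff_not_dvd hr.1).2 (hC.not_dvd hr (by omega) (by omega))).symm
  obtain ⟨⟨i1, h5⟩, j1, h6⟩ := crt hc3 hpw e2 hrp
  obtain ⟨⟨i2, h7⟩, j2, h8⟩ := crt (e12 t) (by rw [← map_pow, h1, map_one]) e14 hdo.coprime_two_right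
  have hg : ∀ x, (Φ t * σ * S ^ K) (ι x) = ι (t x) := by
    intro x
    have hx : ι x ∈ fx (S ^ K) := (e9 _).2 ⟨x, rfl⟩
    rw [mul_ap, mul_ap, mem_fx.1 hx, e15 _ hx, e6]
  have hsp' := hsp
  nth_rewrite 1 [← h6] at hsp'
  refine ⟨Φ t * σ * S ^ K, mul_mem (mul_mem (e4 t ht) hσ) (pow_mem hS K), lift_line hsp' (by omega) hg e8 (fun v => (e9 v).1) h3,
    lift_plane hsp' (by omega) hg e7 e8 (fun v => (e9 v).1) h4, j1, i1 * j2, ?_⟩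
  rw [h6, pow_mul, h5, h8]
  exact ⟨e2, e3, e15, e16⟩

theorem Ctx.exY {r : ℕ} (hr : Zs p (2 * (m - 2) * e) r) : ∃ C ∈ Sp F V, NoLine C ∧ NoPlane C ∧ ∃ j k : ℕ,
    (C ^ j) ^ r = 1 ∧ C ^ j ≠ 1 ∧ (C ^ k) ^ p = 1 ∧ C ^ k ≠ 1 ∧ (∀ v, ω v ((C ^ k) v) = 0 → (C ^ k) v = v) := by
  have hm := hC.hm
  obtain ⟨S, σ, K, Φ, ι, hS, hσ, e1, e2, e3, e4, e5, e6, e7, e8, e9, e10, e11, e12, e13, e14, e15, e16, e17⟩ :=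
    hC.exSplit (b := 2) (by omega) (by omega) hr
  obtain ⟨u, hu, z, hz, hc, h1, h3, h4, hA, hl, hP⟩ := dim4Y (V := Fin 2 ⊕ Fin 2 → F) hC.hp hC.h2 hC.pq (by simp)
  obtain ⟨hsp, hd1, hd2⟩ := hC.sp (by omega) (by omega) hr (pow_mem hS K) e2 e3
  have hcp := cop_p (F := F) (n := 0) hC.hp hC.pq
  have hnd := hC.not_dvd hr (b := 1) (by omega) (by omega)
  rw [pow_one] at hnd
  have hrp : Nat.Coprime (p * (Nat.card F + 1)) r := by
    rw [Nat.coprime_mul_iff_left]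
    exact ⟨hC.rp (by omega) hr, ((Nat.Prime.coprime_iff_not_dvd hr.1).2 hnd).symm⟩
  obtain ⟨⟨i1, h5⟩, j1, h6⟩ := crt ((e5 (u * z)).pow_right K) (k := p * (Nat.card F + 1)) (by
    rw [← map_pow, hc.mul_pow, pow_mul, h1, mul_comm p, pow_mul, h4]; simp) e2 hrp
  obtain ⟨⟨i2, h7⟩, j2, h8⟩ := crt hc h1 h4 hcp
  have hg : ∀ x, (Φ (u * z) * S ^ K) (ι x) = ι ((u * z) x) := by
    intro x
    have hx : ι x ∈ fx (S ^ K) := (e9 _).2 ⟨x, rfl⟩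
    rw [mul_ap, mem_fx.1 hx, e6]
  have hsp' := hsp
  nth_rewrite 1 [← h6] at hsp'
  refine ⟨Φ (u * z) * S ^ K, mul_mem (e4 _ (mul_mem hu hz)) (pow_mem hS K), lift_line hsp' (by omega) hg e8 (fun v => (e9 v).1) hl,
    lift_plane hsp' (by omega) hg e7 e8 (fun v => (e9 v).1) hP, j1, i1 * i2, ?_⟩
  rw [h6, pow_mul, h5, ← map_pow, h7]
  refine ⟨e2, e3, by rw [← map_pow, h1, map_one], ?_, ?_⟩
  · intro h
    apply h3
    ext1 x
    apply e8
    rw [← e6, h]; rfl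
  · intro v hv
    obtain ⟨f, hf, w, hw, rfl⟩ := hsp.dec v
    obtain ⟨x, rfl⟩ := (e9 f).1 hf
    have h9 : ω w (ι (u x)) = 0 := mem_perp'.1 hw _ ((e9 _).2 ⟨_, rfl⟩)
    have h10 : ω (ι x) w = 0 := mem_perp.1 hw _ ((e9 _).2 ⟨_, rfl⟩)
    rw [map_add (Φ u), e6, e11 _ w hw] at hv ⊢
    simp only [map_add, LinearMap.add_apply, om_self, h9, h10, e7, add_zero] at hv
    rw [hA x hv]

theorem Ctx.exJ {r : ℕ} (hr : Zs p (2 * (m - 2) * e) r) : ∃ C ∈ Sp F V, NoPlane C ∧ ∃ j k : ℕ,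
    (C ^ j) ^ r = 1 ∧ C ^ j ≠ 1 ∧ (C ^ k) ^ p ^ 4 = 1 ∧ ∃ v0 : V, v0 ≠ 0 ∧ ∀ v ∈ fx (C ^ j), (C ^ k) v = v → ∃ c : F, v = c • v0 := by
  have hm := hC.hm
  obtain ⟨S, σ, K, Φ, ι, hS, hσ, e1, e2, e3, e4, e5, e6, e7, e8, e9, e10, e11, e12, e13, e14, e15, e16, e17⟩ :=
    hC.exSplit (b := 2) (by omega) (by omega) hr
  obtain ⟨n, hn, h1, hP, v0, h0, h3⟩ := dim4J (F := F) (V := Fin 2 ⊕ Fin 2 → F) hC.hp (by simp)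
  obtain ⟨hsp, hd1, hd2⟩ := hC.sp (by omega) (by omega) hr (pow_mem hS K) e2 e3
  have hrp : Nat.Coprime (p ^ 4) r := (hC.rp (by omega) hr).pow_left 4
  obtain ⟨⟨i1, h5⟩, j1, h6⟩ := crt ((e5 n).pow_right K) (k := p ^ 4) (by rw [← map_pow, h1, map_one]) e2 hrp
  have hg : ∀ x, (Φ n * S ^ K) (ι x) = ι (n x) := by
    intro x
    have hx : ι x ∈ fx (S ^ K) := (e9 _).2 ⟨x, rfl⟩
    rw [mul_ap, mem_fx.1 hx, e6]
  have hsp' := hsp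
  nth_rewrite 1 [← h6] at hsp'
  refine ⟨Φ n * S ^ K, mul_mem (e4 _ hn) (pow_mem hS K),
    lift_plane hsp' (by omega) hg e7 e8 (fun v => (e9 v).1) hP, j1, i1, ?_⟩
  rw [h6, h5]
  refine ⟨e2, e3, by rw [← map_pow, h1, map_one], ι v0, ?_, ?_⟩
  · intro h
    exact h0 (e8 (by rw [h, map_zero]))
  · intro v hv h
    obtain ⟨x, rfl⟩ := (e9 v).1 hv
    rw [e6] at h
    obtain ⟨c, rfl⟩ := h3 x (e8 h)
    exact ⟨c, map_smul _ _ _⟩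
end
end P11

set_option linter.unusedSectionVars false
set_option linter.unusedSimpArgs false
set_option linter.unusedVariables false
set_option autoImplicit false
section P12
open Module
section
variable {F V : Type*} [Field F] [AddCommGroup V] [Module F V] [Symp F V]
local notation "ω" => Symp.ω (F := F) (V := V)

theorem scal_eig {g : V ≃ₗ[F] V} {U : Submodule F V} (h : ∀ v ∈ U, ∃ c : F, g v = c • v) : ∃ c : F, ∀ v ∈ U, g v = c • v := by
  by_cases hU : ∃ v ∈ U, v ≠ 0
  · obtain ⟨v0, h0, hn⟩ := hU
    obtain ⟨c0, hc0⟩ := h v0 h0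
    refine ⟨c0, fun v hv => ?_⟩
    obtain ⟨c, hc⟩ := h v hv
    obtain ⟨d, hd⟩ := h _ (U.add_mem hv h0)
    rw [map_add, hc, hc0] at hd
    have h1 : (c - d) • v + (c0 - d) • v0 = 0 := by
      rw [sub_smul, sub_smul, sub_add_sub_comm, hd, smul_add, sub_self]
    by_cases hcd : c = d
    · rw [hcd, sub_self, zero_smul, zero_add, smul_eq_zero_iff_left hn, sub_eq_zero] at h1
      rw [hc, hcd, h1]
    · have h3 : v = (-(c0 - d) / (c - d)) • v0 := by
        rw [div_eq_inv_mul, mul_smul, neg_smul, ← eq_neg_of_add_eq_zero_left h1, smul_smul, inv_mul_cancel₀ (sub_ne_zero.2 hcd), one_smul]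
      rw [h3, map_smul, hc0, smul_comm]
  · push Not at hU
    exact ⟨1, fun v hv => by rw [hU v hv]; simp⟩

def LineY (Y : Subgroup (V ≃ₗ[F] V)) : Prop := ∃ x : V, x ≠ 0 ∧ ∀ g ∈ Y, ∃ c : F, g x = c • x
def PlaneY (Y : Subgroup (V ≃ₗ[F] V)) : Prop := ∃ x y : V, ω x y ≠ 0 ∧
  ∀ g ∈ Y, ∀ u ∈ Submodule.span F (Set.range ![x, y]), g u ∈ Submodule.span F (Set.range ![x, y])
def Got (X : Subgroup (V ≃ₗ[F] V)) (g : V ≃ₗ[F] V) : Prop :=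
  ∃ R : (V ≃ₗ[F] V) → (V ≃ₗ[F] V) → Prop, Cor R ∧ ∃ g', R g g' ∧ g' ∈ X

variable [Finite F] [FiniteDimensional F V]

theorem eig1 {g : V ≃ₗ[F] V} {v : V} {c : F} {n : ℕ} (h : g v = c • v) (hn : g ^ n = 1) (hc : Nat.Coprime n (Nat.card F - 1)) : g v = v := by
  by_cases h0 : v = 0
  · simp [h0]
  have h1 := eig_pow h n
  rw [hn, one_ap] at h1
  have hcn : c ^ n = 1 := by
    have : (c ^ n - 1) • v = 0 := by rw [sub_smul, ← h1, one_smul, sub_self]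
    exact sub_eq_zero.1 ((smul_eq_zero.1 this).resolve_right h0)
  have hc0 : c ≠ 0 := by
    rintro rfl
    rw [zero_smul] at h
    exact h0 (by simpa using h)
  have := Fintype.ofFinite F
  have h3 := FiniteField.pow_card_sub_one_eq_one c hc0
  rw [← Nat.card_eq_fintype_card] at h3
  have h4 := pow_gcd_eq_one.2 ⟨hcn, h3⟩
  rw [hc, pow_one] at h4
  rw [h, h4, one_smul]

theorem pl_eq {x y : V} (h : ω x y ≠ 0) {U : Submodule F V} (hx : x ∈ U) (hy : y ∈ U) (hU : finrank F U ≤ 2) :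
    Submodule.span F (Set.range ![x, y]) = U := by
  have hle : Submodule.span F (Set.range ![x, y]) ≤ U := by
    rw [Submodule.span_le]; rintro _ ⟨i, rfl⟩; fin_cases i
    · exact hx
    · exact hy
  have hli : LinearIndependent F ![x, y] := by
    rw [LinearIndependent.pair_iff]
    intro s t hst
    have h1 := congrArg (ω x) hst
    have h3 := congrArg (ω y) hst
    simp only [map_add, map_smul, smul_eq_mul, om_self, mul_zero, zero_add, add_zero, om_neg x y, map_zero] at h1 h3
    exact ⟨(mul_eq_zero.1 h3).resolve_right (neg_ne_zero.2 h), (mul_eq_zero.1 h1).resolve_right h⟩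
  have := finrank_span_eq_card hli
  apply Submodule.eq_of_le_of_finrank_le hle
  rw [this]; simpa using hU

variable {p e m : ℕ} [CharP F p] (hC : Ctx F V p e m)
include hC

theorem Ctx.cop_r {a r : ℕ} (ha : 0 < a) (hr : Zs p (2 * a * e) r) : Nat.Coprime r (Nat.card F - 1) := by
  rw [Nat.Prime.coprime_iff_not_dvd hr.1, hC.hq, hr.dvd_iff hC.hp.pos]
  intro h
  have := Nat.le_of_dvd hC.he h
  have := hC.he
  nlinarith

theorem Ctx.cop_pk (k : ℕ) : Nat.Coprime (p ^ k) (Nat.card F - 1) := by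
  apply Nat.Coprime.pow_left
  rw [Nat.Prime.coprime_iff_not_dvd hC.hp]
  intro h
  have h1 : Nat.card F - 1 + 1 = Nat.card F := by have := hC.q3; omega
  have := (Nat.dvd_add_right h).1 (h1 ▸ hC.pq)
  exact hC.hp.one_lt.ne' (Nat.dvd_one.1 this)

variable {R : (V ≃ₗ[F] V) → (V ≃ₗ[F] V) → Prop} (hR : Cor R)
include hR

theorem Cor.fixt {g g' : V ≃ₗ[F] V} {n : ℕ} (h : R g g') (h1 : g ^ n = 1) (h3 : g' ^ n = 1) (hc : Nat.Coprime n (Nat.card F - 1))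
    {v v' : V} (hv : Tr R v v') : g v = v ↔ g' v' = v' := by
  constructor
  · intro h4
    obtain ⟨c, h5⟩ := (hR.eig hC hv h).1 ⟨1, by rw [h4, one_smul]⟩
    exact eig1 h5 h3 hc
  · intro h4
    obtain ⟨c, h5⟩ := (hR.eig hC hv h).2 ⟨1, by rw [h4, one_smul]⟩
    exact eig1 h5 h1 hc

theorem Cor.perpt {s s' : V ≃ₗ[F] V} (h : ∀ {v v'}, Tr R v v' → (s v = v ↔ s' v' = v')) {v v' : V} (hv : Tr R v v') :
    v' ∈ _root_.perp (fx s') → v ∈ _root_.perp (fx s) := by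
  intro h1
  rw [mem_perp] at h1 ⊢
  intro w hw
  by_cases h0 : w = 0
  · simp [h0]
  obtain ⟨w', hw'⟩ := hR.T hC h0
  exact (hR.perp hC hw' hv).2 (h1 w' (mem_fx.2 ((h hw').1 (mem_fx.1 hw))))

theorem Cor.getP {X : Subgroup (V ≃ₗ[F] V)} (hn : ng F V ∈ X) {g g' : V ≃ₗ[F] V} (h : R g g') (hg : g' ∈ X) (j : ℕ) {k : ℕ} (hk : Odd k)
    (h1 : (g ^ j) ^ k = 1) : ∃ s' ∈ X, R (g ^ j) s' ∧ s' ^ k = 1 ∧ (g ^ j ≠ 1 → s' ≠ 1) := by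
  obtain ⟨s', h3, h4, h5⟩ := hR.odd (hR.pow h j) hk h1
  refine ⟨s', ?_, h4, h5, fun h => hR.ne_one hC.ng_ne h4 hk h1 h⟩
  rcases h3 with rfl | rfl
  · exact pow_mem hg j
  · exact mul_mem hn (pow_mem hg j)

theorem Cor.getσ {X : Subgroup (V ≃ₗ[F] V)} (hn : ng F V ∈ X) {r : ℕ} {s s' σ σ' : V ≃ₗ[F] V} (h : R σ σ') (hg : σ' ∈ X)
    (hst : ∀ {v v'}, Tr R v v' → (s v = v ↔ s' v' = v')) (hs : Split r s' (fx s') (_root_.perp (fx s'))) (hb : fx s' ≠ ⊥)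
    (h1 : ∀ v ∈ fx s, σ v = v) (h3 : ∀ v ∈ _root_.perp (fx s), σ v = -v) :
    ∃ σ'' ∈ X, (∀ v ∈ fx s', σ'' v = v) ∧ ∀ v ∈ _root_.perp (fx s'), σ'' v = -v := by
  have hσ := (hR.mem h).2
  obtain ⟨f, hf, hf0⟩ := (Submodule.ne_bot_iff _).1 hb
  obtain ⟨f', hf', hff⟩ := not_mem_perp (F := F) (v := f) (U := fx s') (fun h => hf0 (hs.inf f hf h))
  obtain ⟨w, hw, hw0⟩ : ∃ w ∈ _root_.perp (fx s'), w ≠ 0 := by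
    apply (Submodule.ne_bot_iff _).1
    intro h
    have := hs.lt
    rw [h, finrank_bot] at this
    omega
  obtain ⟨w', hw', hww⟩ := hs.nd hw hw0
  have hsq : ∀ {c : F} {x y : V}, ω x y ≠ 0 → σ' x = c • x → σ' y = c • y → c = 1 ∨ c = -1 := by
    intro c x y h4 hx hy
    have h5 := hσ x y
    rw [hx, hy] at h5
    simp only [map_smul, LinearMap.smul_apply, smul_eq_mul] at h5
    rw [← mul_assoc] at h5
    exact mul_self_eq_one_iff.1 (mul_right_cancel₀ h4 (by rw [h5, one_mul]))
  obtain ⟨a, ha⟩ := scal_eig (g := σ') (U := fx s') (by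
    intro v' hv'
    by_cases h0 : v' = 0
    · exact ⟨0, by simp [h0]⟩
    obtain ⟨v, hv⟩ := hR.T' hC h0
    exact (hR.eig hC hv h).1 ⟨1, by rw [one_smul]; exact h1 v (mem_fx.2 ((hst hv).2 (mem_fx.1 hv')))⟩)
  obtain ⟨b, hb'⟩ := scal_eig (g := σ') (U := _root_.perp (fx s')) (by
    intro v' hv'
    by_cases h0 : v' = 0
    · exact ⟨0, by simp [h0]⟩
    obtain ⟨v, hv⟩ := hR.T' hC h0
    exact (hR.eig hC hv h).1 ⟨-1, by rw [neg_smul, one_smul]; exact h3 v (hR.perpt hC hst hv hv')⟩)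
  have ha1 := hsq hff (ha f hf) (ha f' hf')
  have hb1 := hsq hww (hb' w hw) (hb' w' hw')
  have hne : a ≠ b := by
    intro hab
    have h4 : σ' = 1 ∨ σ' = ng F V := by
      rw [hab] at ha ha1
      refine hb1.imp (fun h5 => ?_) (fun h5 => ?_) <;> ext1 v <;> obtain ⟨x, hx, y, hy, rfl⟩ := hs.dec v
      · rw [map_add, ha x hx, hb' y hy, h5]; simp
      · rw [map_add, ha x hx, hb' y hy, h5]; simp; abel
    have h5 : σ = 1 ∨ σ = ng F V := by
      rcases h4 with rfl | rfl
      · exact hR.one'.1 h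
      · have := hR.neg h
        rw [ng_mul_ng] at this
        exact hR.one'.1 this
    obtain ⟨x, hx⟩ := hR.T' hC hf0
    obtain ⟨y, hy⟩ := hR.T' hC hw0
    have e1 := h1 x (mem_fx.2 ((hst hx).2 (mem_fx.1 hf)))
    have e3 := h3 y (hR.perpt hC hst hy hw)
    have h2 := hC.h2
    have key : ∀ z : V, z ≠ 0 → z ≠ -z := by
      intro z hz h
      have : (2 : F) • z = 0 := by rw [two_smul]; nth_rewrite 1 [h]; simp
      exact hz ((smul_eq_zero.1 this).resolve_left h2)
    rcases h5 with rfl | rfl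
    · exact key y hy.1 e3
    · rw [ng_ap] at e1
      exact key x hx.1 e1.symm
  rcases ha1 with rfl | rfl <;> rcases hb1 with rfl | rfl
  · exact absurd rfl hne
  · exact ⟨σ', hg, fun v hv => by rw [ha v hv, one_smul], fun v hv => by rw [hb' v hv, neg_smul, one_smul]⟩
  · exact ⟨ng F V * σ', mul_mem hn hg, fun v hv => by rw [mul_ap, ha v hv]; simp, fun v hv => by rw [mul_ap, hb' v hv]; simp⟩
  · exact absurd rfl hne

theorem Cor.noLine {Y : Subgroup (V ≃ₗ[F] V)} (hY : LineY Y) {g g' : V ≃ₗ[F] V} (h : R g g') (hg : NoLine g) : g' ∉ Y := by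
  intro hg'
  obtain ⟨x', hx', h1⟩ := hY
  obtain ⟨x, hx⟩ := hR.T' hC hx'
  obtain ⟨c, hc⟩ := (hR.eig hC hx h).2 (h1 g' hg')
  exact hg x hx.1 c hc

theorem Cor.noPlane {Y : Subgroup (V ≃ₗ[F] V)} (hY : PlaneY Y) {g g' : V ≃ₗ[F] V} (h : R g g') (hg : NoPlane g) : g' ∉ Y := by
  intro hg'
  obtain ⟨x', y', h0, h1⟩ := hY
  obtain ⟨x, hx⟩ := hR.T' hC (x' := x') (by rintro rfl; simp at h0)
  obtain ⟨y, hy⟩ := hR.T' hC (x' := y') (by rintro rfl; simp at h0)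
  have hf : ∀ i, Tr R (![x, y] i) (![x', y'] i) := by intro i; fin_cases i; exacts [hx, hy]
  refine hg x y (fun h3 => h0 ((hR.perp hC hx hy).1 h3)) fun u hu => ?_
  by_cases hu0 : u = 0
  · simp [hu0]
  obtain ⟨u', hu'⟩ := hR.T hC hu0
  exact (hR.span hC hf (hR.ap hu' h)).2 (h1 g' hg' u' ((hR.span hC hf hu').1 hu))
end
end P12

set_option linter.unusedSectionVars false
set_option linter.unusedSimpArgs false
set_option linter.unusedVariables false
set_option autoImplicit false
section P13
open Module
section
variable {F V : Type*} [Field F] [AddCommGroup V] [Module F V] [Symp F V]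
local notation "ω" => Symp.ω (F := F) (V := V)
variable [Finite F] [FiniteDimensional F V]
variable {p e m : ℕ} [CharP F p] (hC : Ctx F V p e m)

theorem Split.sub {r : ℕ} {s : V ≃ₗ[F] V} {F0 W : Submodule F V} (h : Split r s F0 W) {U : Submodule F V} (hU : ∀ u ∈ U, s u ∈ U) :
    (∀ y ∈ U, y ∈ W → y = 0) ∨ W ≤ U := by
  rcases h.irr (U ⊓ W).toAddSubgroup (fun y hy => hy.2) (fun y hy => ⟨hU y hy.1, h.inv y hy.2⟩) with h1 | h1
  · exact .inl fun y hy hw => h1 y ⟨hy, hw⟩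
  · exact .inr fun w hw => (h1 w hw).1

theorem sub_le (h2 : (2 : F) ≠ 0) {r : ℕ} {s σ : V ≃ₗ[F] V} {F0 W : Submodule F V} (h : Split r s F0 W)
    (hσF : ∀ v ∈ F0, σ v = v) (hσW : ∀ v ∈ W, σ v = -v) {U : Submodule F V} (hU : ∀ u ∈ U, s u ∈ U) (hUσ : ∀ u ∈ U, σ u ∈ U) :
    U ≤ F0 ∨ perp U ≤ F0 := by
  rcases h.sub hU with h1 | h1
  · left
    intro v hv
    obtain ⟨f, hf, w, hw, rfl⟩ := h.dec v
    have h3 := U.sub_mem hv (hUσ _ hv)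
    rw [map_add, hσF f hf, hσW w hw] at h3
    have h4 : f + w - (f + -w) = (2 : F) • w := by rw [two_smul]; abel
    rw [h4, Submodule.smul_mem_iff _ h2] at h3
    rw [h1 w h3 hw, add_zero]
    exact hf
  · right
    rw [← h.perpW]
    exact perp_anti h1

theorem line_or_plane (h2 : (2 : F) ≠ 0) {X : Subgroup (V ≃ₗ[F] V)} (hX : X ≤ Sp F V) {r : ℕ} {s σ : V ≃ₗ[F] V} {F0 W : Submodule F V}
    (h : Split r s F0 W) (hs : s ∈ X) (hσ : σ ∈ X) (hσF : ∀ v ∈ F0, σ v = v) (hσW : ∀ v ∈ W, σ v = -v) (hd : finrank F F0 = 2)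
    (hI : ¬ Irr X) : LineY X ∨ PlaneY X := by
  obtain ⟨U, hU, hUb, hUF⟩ : ∃ U : Submodule F V, (∀ g ∈ X, ∀ u ∈ U, g u ∈ U) ∧ U ≠ ⊥ ∧ U ≤ F0 := by
    unfold Irr at hI
    push Not at hI
    obtain ⟨U, hU, h1, h3⟩ := hI
    rcases sub_le h2 h hσF hσW (hU s hs) (hU σ hσ) with h4 | h4
    · exact ⟨U, hU, h1, h4⟩
    · refine ⟨perp U, fun g hg => perp_inv (hX hg) (hU g hg), fun h5 => h3 ?_, h4⟩
      apply Submodule.eq_top_of_finrank_eq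
      have := finrank_perp U
      rw [h5, finrank_bot] at this
      omega
  by_cases hti : ∃ x ∈ U, ∃ y ∈ U, ω x y ≠ 0
  · obtain ⟨x, hx, y, hy, hxy⟩ := hti
    right
    have := pl_eq hxy hx hy (le_trans (Submodule.finrank_mono hUF) hd.le)
    exact ⟨x, y, hxy, by rw [this]; exact hU⟩
  · left
    push Not at hti
    obtain ⟨x, hx, hx0⟩ := (Submodule.ne_bot_iff _).1 hUb
    obtain ⟨y, hy, hxy⟩ := not_mem_perp (F := F) (v := x) (U := F0) (fun h' => hx0 (h.inf x (hUF hx) (h.perpF ▸ h')))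
    have := pl_eq hxy (hUF hx) hy hd.le
    refine ⟨x, hx0, fun g hg => ?_⟩
    exact plane_par hxy (this ▸ hUF hx) (this ▸ hUF (hU g hg x hx)) hx0 (hti _ hx _ (hU g hg x hx))

include hC
theorem Ctx.exBX {r : ℕ} (hr : Zs p (2 * (m - 1) * e) r) : ∃ B ∈ Sp F V, ∀ X : Subgroup (V ≃ₗ[F] V), X ≤ Sp F V → ng F V ∈ X → Got X B →
    Sp F V ≤ X ∨ LineY X ∨ PlaneY X := by
  have hm := hC.hm
  obtain ⟨B, hB, i, j, k, x, c, h1, hx, hc, h3, h4, h5, h6⟩ := hC.exB hr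
  refine ⟨B, hB, fun X hX hn hG => ?_⟩
  obtain ⟨R, hR, B', hBB, hB'⟩ := hG
  obtain ⟨s', hs', hss, hr', hne⟩ := hR.getP hC hn hBB hB' j (hC.r_odd (by omega) hr) h3
  obtain ⟨hsp, hd, hd'⟩ := hC.sp (by omega) (by omega) hr (hX hs') hr' (hne h4)
  obtain ⟨σ, hσ, hσ1, hσ3⟩ := hR.getσ hC hn (hR.pow hBB k) (pow_mem hB' k)
    (fun hv => hR.fixt hC hss h3 hr' (hC.cop_r (by omega) hr) hv) hsp (by
      intro h; rw [h, finrank_bot] at hd; omega) h5 h6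
  obtain ⟨x', c', hx', hc', hxx⟩ := hR.tv hC hx hc
  have ht : tv x' c' ∈ X := by
    have h7 := hR.mul (hR.pow hBB i) (hR.inv hxx)
    rw [h1, mul_inv_cancel] at h7
    rcases hR.one.1 h7 with h8 | h8
    · rw [mul_inv_eq_one] at h8
      rw [← h8]; exact pow_mem hB' i
    · rw [mul_inv_eq_iff_eq_mul] at h8
      have h9 : ng F V * B' ^ i = tv x' c' := by rw [h8, ← mul_assoc, ng_mul_ng, one_mul]
      rw [← h9]; exact mul_mem hn (pow_mem hB' i)
  by_cases hI : Irr X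
  · exact .inl (L4 hC.h2 hX hI hsp hs' (by intro h; rw [h, finrank_bot] at hd; omega) hσ hσ1 hσ3 hx' hc' ht)
  · exact .inr (line_or_plane hC.h2 hX hsp hs' hσ hσ1 hσ3 (by omega) hI)

theorem Ctx.exAX {r : ℕ} (hr : Zs p (2 * m * e) r) : ∃ A ∈ Sp F V, NoLine A ∧ NoPlane A ∧ 
    ∀ X : Subgroup (V ≃ₗ[F] V), X ≤ Sp F V → ng F V ∈ X → Got X A → Irr X ∧ ∃ A' ∈ X,
    (∀ (k : ℕ) (v : V) (c : F), v ≠ 0 → (A' ^ k) v = c • v → Nat.card F ^ m + 1 ∣ 2 * k) := by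
  have hm := hC.hm
  obtain ⟨A, hA, h1, h3, h4, i, h5, h6⟩ := hC.exA hr
  refine ⟨A, hA, h1, h3, fun X hX hn hG => ?_⟩
  obtain ⟨R, hR, A', hAA, hA'⟩ := hG
  obtain ⟨s', hs', hss, hr', hne⟩ := hR.getP hC hn hAA hA' i (hC.r_odd (by omega) hr) h5
  obtain ⟨hsp, hd, hd'⟩ := hC.sp (by omega) (by omega) hr (hX hs') hr' (hne h6)
  have htop : perp (fx s') = ⊤ := Submodule.eq_top_of_finrank_eq (by rw [hd', hC.hV])
  rw [htop] at hsp
  refine ⟨fun U hU => ?_, A', hA', fun k v c hv h => ?_⟩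
  · rcases hsp.sub (hU s' hs') with h7 | h7
    · exact .inl ((Submodule.eq_bot_iff _).2 fun y hy => h7 y hy trivial)
    · exact .inr (top_le_iff.1 h7)
  · obtain ⟨v0, hv0⟩ := hR.T' hC hv
    obtain ⟨c0, hc0⟩ := (hR.eig hC hv0 (hR.pow hAA k)).2 ⟨c, h⟩
    exact h4 k v0 c0 hv0.1 hc0

theorem Ctx.exDX : ∃ D ∈ Sp F V, NoLine D ∧ ∀ X : Subgroup (V ≃ₗ[F] V), Got X D → ∃ D' ∈ X,
    (∀ (k : ℕ) (v : V) (c : F), v ≠ 0 → (D' ^ k) v = c • v → Nat.card F ^ m - 1 ∣ k * (Nat.card F - 1)) := by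
  obtain ⟨A, hA, h1, h4⟩ := hC.exD
  refine ⟨A, hA, h1, fun X hG => ?_⟩
  obtain ⟨R, hR, A', hAA, hA'⟩ := hG
  refine ⟨A', hA', fun k v c hv h => ?_⟩
  obtain ⟨v0, hv0⟩ := hR.T' hC hv
  obtain ⟨c0, hc0⟩ := (hR.eig hC hv0 (hR.pow hAA k)).2 ⟨c, h⟩
  exact h4 k v0 c0 hv0.1 hc0

theorem Ctx.exC1X {r : ℕ} (hr : Zs p (2 * (m - 1) * e) r) : ∃ C ∈ Sp F V, NoLine C ∧ 
    ∀ X : Subgroup (V ≃ₗ[F] V), X ≤ Sp F V → ng F V ∈ X → Got X C → ∃ C' ∈ X, ∃ h ∈ X, h ^ r = 1 ∧ h ≠ 1 ∧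
      ∀ (k : ℕ) (v : V) (c : F), v ∉ fx h → (C' ^ k) v = c • v → Nat.card F ^ (m - 1) + 1 ∣ 2 * k := by
  have hm := hC.hm
  obtain ⟨C, hCS, h1, j, h3, h4, h5⟩ := hC.exC1 hr
  refine ⟨C, hCS, h1, fun X hX hn hG => ?_⟩
  obtain ⟨R, hR, C', hCC, hC'⟩ := hG
  obtain ⟨s', hs', hss, hr', hne⟩ := hR.getP hC hn hCC hC' j (hC.r_odd (by omega) hr) h3
  refine ⟨C', hC', s', hs', hr', hne h4, fun k v c hv h => ?_⟩
  have hv0 : v ≠ 0 := by rintro rfl; exact hv (Submodule.zero_mem _)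
  obtain ⟨v0, hv0⟩ := hR.T' hC hv0
  obtain ⟨c0, hc0⟩ := (hR.eig hC hv0 (hR.pow hCC k)).2 ⟨c, h⟩
  refine h5 k v0 c0 (fun h6 => hv ?_) hc0
  rw [mem_fx] at h6 ⊢
  exact (hR.fixt hC hss h3 hr' (hC.cop_r (by omega) hr) hv0).1 h6

theorem Ctx.exC2X {r : ℕ} (hr : Zs p (2 * (m - 2) * e) r) : ∃ C ∈ Sp F V, NoLine C ∧ NoPlane C ∧
    ∀ X : Subgroup (V ≃ₗ[F] V), X ≤ Sp F V → ng F V ∈ X → Got X C → ∃ s ∈ X, s ^ r = 1 ∧ s ≠ 1 ∧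
    ∃ σ ∈ X, (∀ v ∈ fx s, σ v = v) ∧ (∀ v ∈ perp (fx s), σ v = -v) := by
  have hm := hC.hm
  obtain ⟨C, hCS, h1, h1', j, k, h3, h4, h5, h6⟩ := hC.exC2 hr
  refine ⟨C, hCS, h1, h1', fun X hX hn hG => ?_⟩
  obtain ⟨R, hR, C', hCC, hC'⟩ := hG
  obtain ⟨s', hs', hss, hr', hne⟩ := hR.getP hC hn hCC hC' j (hC.r_odd (by omega) hr) h3
  obtain ⟨hsp, hd, hd'⟩ := hC.sp (by omega) (by omega) hr (hX hs') hr' (hne h4)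
  exact ⟨s', hs', hr', hne h4, hR.getσ hC hn (hR.pow hCC k) (pow_mem hC' k)
    (fun hv => hR.fixt hC hss h3 hr' (hC.cop_r (by omega) hr) hv) hsp (by
      intro h; rw [h, finrank_bot] at hd; omega) h5 h6⟩

theorem Ctx.exYX {r : ℕ} (hr : Zs p (2 * (m - 2) * e) r) : ∃ C ∈ Sp F V, NoLine C ∧ NoPlane C ∧
    ∀ X : Subgroup (V ≃ₗ[F] V), X ≤ Sp F V → ng F V ∈ X → Got X C → ∃ s ∈ X, s ^ r = 1 ∧ s ≠ 1 ∧
    ∃ u ∈ X, Commute u s ∧ u ^ p = 1 ∧ u ≠ 1 ∧ ∀ v, ω v (u v) = 0 → u v = v := by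
  have hm := hC.hm
  obtain ⟨C, hCS, h1, h1', j, k, h3, h4, h5, h6, h7⟩ := hC.exY hr
  refine ⟨C, hCS, h1, h1', fun X hX hn hG => ?_⟩
  obtain ⟨R, hR, C', hCC, hC'⟩ := hG
  have hro := hC.r_odd (by omega) hr
  obtain ⟨s', hs', hss, hr', hne⟩ := hR.getP hC hn hCC hC' j hro h3
  obtain ⟨u', hu', huu, hp', hne'⟩ := hR.getP hC hn hCC hC' k hC.podd h5
  refine ⟨s', hs', hr', hne h4, u', hu', hR.comm hC.ng_ne huu hss ((Commute.refl C).pow_pow _ _) hro hr', hp', hne' h6, ?_⟩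
  intro v hv
  by_cases h0 : v = 0
  · simp [h0]
  obtain ⟨v0, hv0⟩ := hR.T' hC h0
  have h8 := hC.cop_pk 1
  rw [pow_one] at h8
  exact (hR.fixt hC huu h5 hp' h8 hv0).1 (h7 v0 ((hR.perp hC hv0 (hR.ap hv0 huu)).2 hv))

theorem Ctx.exJX {r : ℕ} (hr : Zs p (2 * (m - 2) * e) r) : ∃ C ∈ Sp F V, NoPlane C ∧
    ∀ X : Subgroup (V ≃ₗ[F] V), X ≤ Sp F V → ng F V ∈ X → Got X C → ∃ s ∈ X, s ^ r = 1 ∧ s ≠ 1 ∧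
    ∃ n ∈ X, Commute n s ∧ n ^ p ^ 4 = 1 ∧ ∃ v0 : V, v0 ≠ 0 ∧ ∀ v ∈ fx s, n v = v → ∃ c : F, v = c • v0 := by
  have hm := hC.hm
  obtain ⟨C, hCS, h1, j, k, h3, h4, h5, w, hw, h7⟩ := hC.exJ hr
  refine ⟨C, hCS, h1, fun X hX hn hG => ?_⟩
  obtain ⟨R, hR, C', hCC, hC'⟩ := hG
  have hro := hC.r_odd (by omega) hr
  obtain ⟨s', hs', hss, hr', hne⟩ := hR.getP hC hn hCC hC' j hro h3
  obtain ⟨u', hu', huu, hp', hne'⟩ := hR.getP hC hn hCC hC' k (hC.podd.pow (n := 4)) h5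
  obtain ⟨w', hww⟩ := hR.T hC hw
  refine ⟨s', hs', hr', hne h4, u', hu', hR.comm hC.ng_ne huu hss ((Commute.refl C).pow_pow _ _) hro hr', hp', w', hww.2.1, ?_⟩
  intro v hv h
  by_cases h0 : v = 0
  · exact ⟨0, by simp [h0]⟩
  obtain ⟨v0, hv0⟩ := hR.T' hC h0
  refine (hR.line hC hww hv0).1 (h7 v0 ?_ ((hR.fixt hC huu h5 hp' (hC.cop_pk 4) hv0).2 h))
  rw [mem_fx] at hv ⊢
  exact (hR.fixt hC hss h3 hr' (hC.cop_r (by omega) hr) hv0).2 hv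
end
end P13

set_option linter.unusedSectionVars false
set_option linter.unusedSimpArgs false
set_option linter.unusedVariables false
set_option autoImplicit false
section P14
open Module
theorem sylow_conj {G : Type*} [Group G] [Finite G] {r : ℕ} (hr : r.Prime) {P Q : Subgroup G} (hP : IsPGroup r P) (hQ : IsPGroup r Q) :
    ∃ g : G, ∃ S : Subgroup G, IsPGroup r S ∧ Q ≤ S ∧ ∀ x ∈ P, g * x * g⁻¹ ∈ S := by
  have : Fact r.Prime := ⟨hr⟩
  obtain ⟨SP, h1⟩ := hP.exists_le_sylow
  obtain ⟨SQ, h3⟩ := hQ.exists_le_sylow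
  obtain ⟨g, hg⟩ := MulAction.exists_smul_eq G SP SQ
  refine ⟨g, SQ, SQ.2, h3, fun x hx => ?_⟩
  rw [← hg]
  exact ⟨x, h1 hx, rfl⟩

theorem isP {G : Type*} [Group G] {r k : ℕ} {x : G} (h : x ^ r ^ k = 1) : IsPGroup r (Subgroup.zpowers x) := by
  rintro ⟨_, n, rfl⟩
  refine ⟨k, Subtype.ext ?_⟩
  simp only [Subgroup.coe_pow, Subgroup.coe_one]
  rw [← zpow_natCast, ← zpow_mul, mul_comm, zpow_mul, zpow_natCast, h, one_zpow]

theorem sylow_c {G : Type*} [Group G] [Finite G] {r : ℕ} (hr : r.Prime) {x y : G} (hx : x ^ r = 1) (hy : y ^ r = 1) (hy1 : y ≠ 1) :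
    ∃ g c : G, c ^ r = 1 ∧ c ≠ 1 ∧ Commute (g * x * g⁻¹) c ∧ Commute y c := by
  have : Fact r.Prime := ⟨hr⟩
  obtain ⟨g, S, hS, h1, h3⟩ := sylow_conj hr (isP (k := 1) (by rwa [pow_one]) : IsPGroup r (Subgroup.zpowers x)) (isP (k := 1) (by rwa [pow_one]) : IsPGroup r (Subgroup.zpowers y))
  have hyS : y ∈ S := h1 (Subgroup.mem_zpowers y)
  have hnt : Nontrivial S := ⟨⟨y, hyS⟩, 1, fun h => hy1 (congrArg Subtype.val h)⟩
  have hct := hS.center_nontrivial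
  have hpc : IsPGroup r (Subgroup.center S) := hS.to_subgroup _
  obtain ⟨n, hn, hcard⟩ := hpc.nontrivial_iff_card.1 hct
  obtain ⟨c, hc⟩ := exists_prime_orderOf_dvd_card' r (hcard ▸ dvd_pow_self r hn.ne')
  refine ⟨g, c.1.1, ?_, ?_, ?_, ?_⟩
  · have := pow_orderOf_eq_one c
    rw [hc] at this
    exact congrArg (fun z => z.1.1) this
  · intro h
    have : c = 1 := Subtype.ext (Subtype.ext h)
    rw [this, orderOf_one] at hc
    exact hr.one_lt.ne hc
  · exact congrArg Subtype.val (Subgroup.mem_center_iff.1 c.2 ⟨_, h3 x (Subgroup.mem_zpowers x)⟩)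
  · exact congrArg Subtype.val (Subgroup.mem_center_iff.1 c.2 ⟨y, hyS⟩)

section
variable {F V : Type*} [Field F] [AddCommGroup V] [Module F V] [Symp F V]
local notation "ω" => Symp.ω (F := F) (V := V)
variable [Finite F] [FiniteDimensional F V]

theorem norm_fix {g : V ≃ₗ[F] V} {r : ℕ} (h : g ^ r = 1) (w : V) : g (∑ j ∈ Finset.range r, (g ^ j) w) = ∑ j ∈ Finset.range r, (g ^ j) w := by
  have h1 := Finset.sum_range_succ (fun j => (g ^ j) w) r
  have h3 := Finset.sum_range_succ' (fun j => (g ^ j) w) r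
  rw [h1, h, pow_zero] at h3
  have h4 := add_right_cancel h3
  rw [map_sum, h4]
  refine Finset.sum_congr rfl fun j _ => ?_
  rw [← mul_ap, ← pow_succ']

theorem finGL : Finite (V ≃ₗ[F] V) := by
  have : Finite V := Module.finite_of_finite F
  exact Finite.of_injective (fun g : V ≃ₗ[F] V => (g : V → V)) DFunLike.coe_injective

variable {p e m : ℕ} [CharP F p] (hC : Ctx F V p e m)
include hC

theorem Ctx.fx_eq {r : ℕ} (hr : Zs p (2 * (m - 2) * e) r) {a c : V ≃ₗ[F] V} (ha : a ∈ Sp F V) (hc : c ∈ Sp F V) (h1 : a ^ r = 1) (h3 : a ≠ 1)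
    (h4 : c ^ r = 1) (h5 : c ≠ 1) (hac : Commute a c) : fx a = fx c := by
  have hm := hC.hm
  obtain ⟨hsp, hd, hd'⟩ := hC.sp (by omega) (by omega) hr ha h1 h3
  obtain ⟨_, hd1, _⟩ := hC.sp (by omega) (by omega) hr hc h4 h5
  exact (Submodule.eq_of_le_of_finrank_eq (hsp.inv_le (fx_inv hac) (by omega)) (by omega)).symm

theorem Ctx.pow_eq {r : ℕ} (hr : Zs p (2 * (m - 2) * e) r) {a c : V ≃ₗ[F] V} (ha : a ∈ Sp F V) (hc : c ∈ Sp F V) (h1 : a ^ r = 1)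
    (h4 : c ^ r = 1) (h5 : c ≠ 1) (hac : Commute a c) : ∃ k : ℕ, a = c ^ k := by
  have hm := hC.hm
  obtain ⟨hsp, hd, hd'⟩ := hC.sp (by omega) (by omega) hr hc h4 h5
  by_cases hi : ∃ i : ℕ, a * c ^ i = 1
  · obtain ⟨i, hi⟩ := hi
    refine ⟨i * (r - 1), ?_⟩
    have : c ^ i * c ^ (i * (r - 1)) = 1 := by
      have hr2 := hr.1.pos
      rw [← pow_add, show i + i * (r - 1) = r * i by obtain ⟨t, rfl⟩ : ∃ t, r = t + 1 := ⟨r - 1, by omega⟩; simp; ring, pow_mul, h4, one_pow]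
    calc a = a * (c ^ i * c ^ (i * (r - 1))) := by rw [this, mul_one]
      _ = _ := by rw [← mul_assoc, hi, one_mul]
  exfalso
  push Not at hi
  have hac' : ∀ i : ℕ, Commute (a * c ^ i) c := fun i => hac.mul_left ((Commute.refl c).pow_left i)
  have key : ∀ g ∈ Sp F V, g ^ r = 1 → g ≠ 1 → Commute g c → ∀ w ∈ perp (fx c), ∑ j ∈ Finset.range r, (g ^ j) w = 0 := by
    intro g hg hgr hg1 hgc w hw
    apply hsp.inf
    · rw [← hC.fx_eq hr hg hc hgr hg1 h4 h5 hgc]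
      exact mem_fx.2 (norm_fix hgr w)
    · exact Submodule.sum_mem _ fun j _ => pow_inv_mem (perp_inv hg (fx_inv hgc)) j w hw
  obtain ⟨w, hw, hw0⟩ : ∃ w ∈ perp (fx c), w ≠ 0 := by
    apply (Submodule.ne_bot_iff _).1
    intro h
    rw [h, finrank_bot] at hd'
    omega
  have h6 : ∑ i ∈ Finset.range r, ∑ j ∈ Finset.range r, ((a * c ^ i) ^ j) w = 0 := by
    refine Finset.sum_eq_zero fun i _ => key _ (mul_mem ha (pow_mem hc i)) ?_ (hi i) (hac' i) w hw
    rw [(hac.pow_right i).mul_pow, h1, one_mul, ← pow_mul, mul_comm, pow_mul, h4, one_pow]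
  rw [Finset.sum_comm] at h6
  obtain ⟨t, ht⟩ : ∃ t, r = t + 1 := ⟨r - 1, by have := hr.1.pos; omega⟩
  rw [Finset.sum_eq_single 0] at h6
  · simp only [pow_zero, one_ap, Finset.sum_const, Finset.card_range] at h6
    rw [← Nat.cast_smul_eq_nsmul F] at h6
    have h7 := (smul_eq_zero.1 h6).resolve_right hw0
    rw [CharP.cast_eq_zero_iff F p] at h7
    exact hr.ne (Nat.mul_pos (by omega) hC.he) ((Nat.prime_dvd_prime_iff_eq hC.hp hr.1).1 h7).symm
  · intro j hj hj0
    have h8 : ∀ i ∈ Finset.range r, ((a * c ^ i) ^ j) w = (a ^ j) (((c ^ j) ^ i) w) := by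
      intro i _
      rw [(hac.pow_right i).mul_pow, mul_ap, ← pow_mul, ← pow_mul, mul_comm]
    rw [Finset.sum_congr rfl h8, ← map_sum, key (c ^ j) (pow_mem hc j) (by rw [← pow_mul, mul_comm, pow_mul, h4, one_pow]) ?_ ((Commute.refl c).pow_left j) w hw, map_zero]
    intro h9
    have := pow_gcd_eq_one.2 ⟨h4, h9⟩
    rw [Nat.coprime_of_lt_prime hj0 (Finset.mem_range.1 hj) hr.1, pow_one] at this
    exact h5 this
  · intro h; simp [ht] at h

theorem Ctx.align {r : ℕ} (hr : Zs p (2 * (m - 2) * e) r) {X : Subgroup (V ≃ₗ[F] V)} (hX : X ≤ Sp F V) {s t : V ≃ₗ[F] V} (hs : s ∈ X) (ht : t ∈ X)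
    (h1 : s ^ r = 1) (h3 : s ≠ 1) (h4 : t ^ r = 1) (h5 : t ≠ 1) : ∃ g ∈ X, (∃ k : ℕ, s = (g * t * g⁻¹) ^ k) ∧ fx s = fx (g * t * g⁻¹) := by
  have := finGL (F := F) (V := V)
  obtain ⟨g, c, hc, hc1, hc3, hc4⟩ := sylow_c hr.1 (x := (⟨t, ht⟩ : X)) (y := ⟨s, hs⟩) (Subtype.ext h4) (Subtype.ext h1) (fun h => h3 (congrArg Subtype.val h))
  have hc' : c.1 ^ r = 1 := congrArg Subtype.val hc
  have hc1' : c.1 ≠ 1 := fun h => hc1 (Subtype.ext h)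
  have hc3' : Commute (g.1 * t * g.1⁻¹) c.1 := congrArg Subtype.val hc3
  have hc4' : Commute s c.1 := congrArg Subtype.val hc4
  have hgt : g.1 * t * g.1⁻¹ ∈ Sp F V := hX (X.mul_mem (X.mul_mem g.2 ht) (X.inv_mem g.2))
  have h6 : (g.1 * t * g.1⁻¹) ^ r = 1 := by rw [conj_pow, h4]; simp
  have h7 : g.1 * t * g.1⁻¹ ≠ 1 := by rwa [Ne, conj_eq_one_iff]
  refine ⟨g.1, g.2, ?_, ?_⟩
  · obtain ⟨k, hk⟩ := hC.pow_eq hr (hX hs) (hX c.2) h1 hc' hc1' hc4'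
    obtain ⟨l, hl⟩ := hC.pow_eq hr (hX c.2) hgt hc' h6 h7 hc3'.symm
    exact ⟨l * k, by rw [pow_mul, ← hl, ← hk]⟩
  · rw [hC.fx_eq hr (hX hs) (hX c.2) h1 h3 hc' hc1' hc4', hC.fx_eq hr hgt (hX c.2) h6 h7 hc' hc1' hc3']
end
end P14

set_option linter.unusedSectionVars false
set_option linter.unusedSimpArgs false
set_option linter.unusedVariables false
set_option autoImplicit false
section P15
open Module
variable {F V : Type*} [Field F] [AddCommGroup V] [Module F V] [Symp F V]
local notation "ω" => Symp.ω (F := F) (V := V)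

def rg (u : V ≃ₗ[F] V) : Submodule F V := LinearMap.range ((u : V →ₗ[F] V) - LinearMap.id)

theorem mem_rg {u : V ≃ₗ[F] V} {x : V} : x ∈ rg u ↔ ∃ v, u v - v = x := by
  simp [rg, LinearMap.mem_range]

theorem rg_conj {u g : V ≃ₗ[F] V} {x : V} : x ∈ rg (g * u * g⁻¹) ↔ g⁻¹ x ∈ rg u := by
  rw [mem_rg, mem_rg]
  constructor
  · rintro ⟨v, rfl⟩
    exact ⟨g⁻¹ v, by simp⟩
  · rintro ⟨v, hv⟩
    exact ⟨g v, by rw [mul_ap, mul_ap, inv_ap, ← map_sub, hv, ap_inv]⟩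

theorem fx_conj {u g : V ≃ₗ[F] V} {x : V} : x ∈ fx (g * u * g⁻¹) ↔ g⁻¹ x ∈ fx u := by
  rw [mem_fx, mem_fx, mul_ap, mul_ap]
  constructor
  · intro h
    rw [← inv_ap_iff.2 h.symm]
  · intro h
    rw [h, ap_inv]

theorem pfx_conj {s g : V ≃ₗ[F] V} (hg : g ∈ Sp F V) {x : V} : x ∈ perp (fx (g * s * g⁻¹)) ↔ g⁻¹ x ∈ perp (fx s) := by
  rw [mem_perp, mem_perp]
  constructor
  · intro h v hv
    have := h (g v) (fx_conj.2 (by simpa using hv))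
    rwa [← hg v (g⁻¹ x), ap_inv]
  · intro h v hv
    have := h _ (fx_conj.1 hv)
    rwa [Sp_inv_om hg, ap_inv] at this

structure Dat (p : ℕ) (X : Subgroup (V ≃ₗ[F] V)) (r : ℕ) (s σ u : V ≃ₗ[F] V) : Prop where
  hX : X ≤ Sp F V
  irr : Irr X
  hs : s ∈ X
  sr : s ^ r = 1
  s1 : s ≠ 1
  hσ : σ ∈ X
  σF : ∀ v ∈ fx s, σ v = v
  σW : ∀ v ∈ perp (fx s), σ v = -v
  hu : u ∈ X
  cm : Commute u s
  up : u ^ p = 1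
  u1 : u ≠ 1
  an : ∀ v, ω v (u v) = 0 → u v = v

variable {p : ℕ} {X : Subgroup (V ≃ₗ[F] V)} {r : ℕ} {s σ u : V ≃ₗ[F] V}

theorem Dat.conj (D : Dat p X r s σ u) {g : V ≃ₗ[F] V} (hg : g ∈ X) : Dat p X r (g * s * g⁻¹) (g * σ * g⁻¹) (g * u * g⁻¹) where
  hX := D.hX
  irr := D.irr
  hs := X.mul_mem (X.mul_mem hg D.hs) (X.inv_mem hg)
  sr := by rw [conj_pow, D.sr]; simp
  s1 := fun h => D.s1 (by simpa using h)
  hσ := X.mul_mem (X.mul_mem hg D.hσ) (X.inv_mem hg)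
  σF := fun v hv => by
    rw [mul_ap, mul_ap, D.σF _ (fx_conj.1 hv), ap_inv]
  σW := fun v hv => by
    rw [mul_ap, mul_ap, D.σW _ ((pfx_conj (D.hX hg)).1 hv), map_neg, ap_inv]
  hu := X.mul_mem (X.mul_mem hg D.hu) (X.inv_mem hg)
  cm := by
    have := D.cm.eq
    change _ = _
    calc _ = g * (u * s) * g⁻¹ := by group
      _ = _ := by rw [this]; group
  up := by rw [conj_pow, D.up]; simp
  u1 := fun h => D.u1 (by simpa using h)
  an := fun v hv => by
    rw [mul_ap, mul_ap] at hv ⊢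
    rw [D.an (g⁻¹ v) ?_, ap_inv]
    rwa [← D.hX hg, ap_inv]

theorem Dat.om_fx (D : Dat p X r s σ u) {x k : V} (hx : x ∈ rg u) (hk : k ∈ fx u) : ω x k = 0 := by
  obtain ⟨v, rfl⟩ := mem_rg.1 hx
  have := D.hX D.hu v k
  rw [mem_fx.1 hk] at this
  simp [this]

variable [Finite F] [FiniteDimensional F V] {e m : ℕ} [CharP F p] (hC : Ctx F V p e m)
include hC

theorem Dat.le_fx (D : Dat p X r s σ u) {x : V} (hx : x ∈ rg u) : x ∈ fx u := by
  by_contra hc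
  let U : Submodule F V := (rg u).map ((u : V →ₗ[F] V) - LinearMap.id)
  have hmU : ∀ {y}, y ∈ U ↔ ∃ v, u (u v - v) - (u v - v) = y := by
    intro y
    constructor
    · rintro ⟨z, hz, rfl⟩
      obtain ⟨v, rfl⟩ := mem_rg.1 hz
      exact ⟨v, by simp⟩
    · rintro ⟨v, rfl⟩
      exact ⟨u v - v, mem_rg.2 ⟨v, rfl⟩, by simp⟩
  obtain ⟨y, hy, hyu, hy0⟩ := fixed_vec hC.hp (k := 1) (by rw [pow_one]; exact D.up) (U := U) (by
    intro y hy
    obtain ⟨v, rfl⟩ := hmU.1 hy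
    exact hmU.2 ⟨u v, by simp⟩) (by
    intro h0
    obtain ⟨v, rfl⟩ := mem_rg.1 hx
    have : u (u v - v) - (u v - v) ∈ U := hmU.2 ⟨v, rfl⟩
    rw [h0, Submodule.mem_bot, sub_eq_zero] at this
    exact hc (mem_fx.2 this))
  obtain ⟨v, rfl⟩ := hmU.1 hy
  have h1 := D.om_fx (mem_rg.2 ⟨v, rfl⟩) (mem_fx.2 hyu)
  have h3 := D.an (u v - v) (by
    rw [map_sub, om_self, sub_zero] at h1
    exact h1)
  exact hy0 (by rw [h3, sub_self])

theorem Dat.ti (D : Dat p X r s σ u) {x y : V} (hx : x ∈ rg u) (hy : y ∈ rg u) : ω x y = 0 :=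
  D.om_fx hx (D.le_fx hC hy)

theorem Dat.skew (D : Dat p X r s σ u) (v w : V) : ω (u v - v) w = - ω v (u w - w) := by
  have h1 := D.om_fx (mem_rg.2 ⟨v, rfl⟩) (D.le_fx hC (mem_rg.2 ⟨w, rfl⟩))
  have h3 := D.hX D.hu v w
  simp only [map_sub, LinearMap.sub_apply] at *
  linear_combination h3 - h1

variable (hr : Zs p (2 * (m - 2) * e) r)
include hr

theorem Dat.spl (D : Dat p X r s σ u) : Split r s (fx s) (perp (fx s)) ∧ finrank F (fx s) = 4 := by
  have hm := hC.hm
  obtain ⟨h1, h3, h4⟩ := hC.sp (by omega) (by omega) hr (D.hX D.hs) D.sr D.s1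
  exact ⟨h1, by omega⟩

theorem Dat.tW (D : Dat p X r s σ u) : ∀ w ∈ perp (fx s), u w = w :=
  triv_W hC.hp (D.spl hC hr).1 D.cm (D.hX D.hu) (k := 1) (by rw [pow_one]; exact D.up)

theorem Dat.rgF (D : Dat p X r s σ u) {x : V} (hx : x ∈ rg u) : x ∈ fx s := by
  obtain ⟨v, rfl⟩ := mem_rg.1 hx
  obtain ⟨f, hf, w, hw, rfl⟩ := (D.spl hC hr).1.dec v
  rw [map_add, D.tW hC hr w hw]
  have := (fx s).sub_mem (fx_inv D.cm f hf) hf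
  convert this using 1
  abel

theorem Dat.rg2 (D : Dat p X r s σ u) : finrank F (rg u) ≤ 2 := by
  have hm := hC.hm
  obtain ⟨h1, h4⟩ := D.spl hC hr
  have h5 : rg u ⊔ perp (fx s) ≤ perp (rg u) := sup_le
    (fun x hx => mem_perp.2 fun y hy => D.ti hC hy hx)
    (perp_anti fun x hx => D.rgF hC hr hx)
  have h6 : rg u ⊓ perp (fx s) = ⊥ := (Submodule.eq_bot_iff _).2 fun x hx => h1.inf x (D.rgF hC hr hx.1) hx.2
  have h7 := Submodule.finrank_sup_add_finrank_inf_eq (rg u) (perp (fx s))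
  rw [h6, finrank_bot] at h7
  have h8 := Submodule.finrank_mono h5
  have h9 := finrank_perp (rg u)
  have h10 := finrank_perp (fx s)
  omega

theorem pair_le {U : Submodule F V} (hU : finrank F U ≤ 2) {a b : V} (ha : a ∈ U) (hb : b ∈ U) (ha0 : a ≠ 0) (hab : ¬ ∃ c : F, b = c • a)
    {v : V} (hv : v ∈ U) : ∃ x y : F, v = x • a + y • b := by
  have hli : LinearIndependent F ![a, b] := by
    rw [LinearIndependent.pair_iff' ha0]
    intro c hc
    exact hab ⟨c, hc.symm⟩
  have h1 : Submodule.span F (Set.range ![a, b]) ≤ U := by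
    rw [Submodule.span_le]
    rintro _ ⟨i, rfl⟩
    fin_cases i
    · exact ha
    · exact hb
  have h3 : Submodule.span F (Set.range ![a, b]) = U := by
    refine Submodule.eq_of_le_of_finrank_le h1 ?_
    rw [finrank_span_eq_card hli]
    simpa using hU
  rw [← h3, mem_pl] at hv
  obtain ⟨x, y, h⟩ := hv
  exact ⟨x, y, h.symm⟩

theorem Dat.form' (D : Dat p X r s σ u) {a : V} (ha : a ∈ rg u) (ha0 : a ≠ 0) :
    (∃ α : F, α ≠ 0 ∧ ∀ v, u v = v + (α * ω a v) • a) ∨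
    ∃ w0 ∈ rg u, (¬ ∃ c : F, w0 = c • a) ∧ ∃ α γ : F, α ≠ 0 ∧ γ ≠ 0 ∧ ∀ v, u v = v + (α * ω a v) • a + (γ * ω w0 v) • w0 := by
  obtain ⟨b, hb⟩ := mem_rg.1 ha
  have hub : u b = b + a := by rw [← hb]; abel
  have hk : ω b a ≠ 0 := by
    intro h
    have := D.an b (by rw [hub, map_add, om_self, h, add_zero])
    rw [this, sub_self] at hb
    exact ha0 hb.symm
  have hk' : ω a b ≠ 0 := fun h => hk (om_zero_comm.1 h)
  by_cases hall : ∀ x ∈ rg u, ∃ c : F, x = c • a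
  · left
    refine ⟨(ω a b)⁻¹, inv_ne_zero hk', fun v => ?_⟩
    obtain ⟨x, hx⟩ := hall _ (mem_rg.2 ⟨v, rfl⟩)
    have h1 : v - x • b ∈ fx u := mem_fx.2 (by
      rw [map_sub, map_smul, hub, smul_add, ← hx]; abel)
    have h3 := D.om_fx ha h1
    rw [map_sub, map_smul, smul_eq_mul, sub_eq_zero] at h3
    rw [h3, mul_comm x, ← mul_assoc, inv_mul_cancel₀ hk', one_mul, ← hx]
    abel
  · right
    push Not at hall
    obtain ⟨y1, hy1, hna⟩ := hall
    obtain ⟨c1, rfl⟩ := mem_rg.1 hy1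
    set c := c1 - (ω b (u c1 - c1) / ω b a) • b with hc
    set w := u c - c with hw
    have hwe : w = (u c1 - c1) - (ω b (u c1 - c1) / ω b a) • a := by
      rw [hw, hc, map_sub, map_smul, hub, smul_add]; abel
    have huc : u c = c + w := by rw [hw]; abel
    have hwr : w ∈ rg u := mem_rg.2 ⟨c, rfl⟩
    have hwa : ¬ ∃ d : F, w = d • a := by
      rintro ⟨d, hd⟩
      refine hna (d + ω b (u c1 - c1) / ω b a) ?_
      rw [add_smul, ← hd, hwe]; abel
    have hw0 : w ≠ 0 := fun h => hwa ⟨0, by rw [h, zero_smul]⟩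
    have hbw : ω b w = 0 := by
      rw [hwe, map_sub, map_smul, smul_eq_mul, div_mul_cancel₀ _ hk, sub_self]
    have hwb : ω w b = 0 := om_zero_comm.1 hbw
    have hac : ω a c = 0 := by
      have := D.skew hC b c
      rw [hb, ← hw, hbw, neg_zero] at this
      exact this
    have hwc : ω w c ≠ 0 := by
      intro h
      have := D.an c (by rw [huc, map_add, om_self, om_zero_comm.1 h, add_zero])
      exact hw0 (by rw [hw, this, sub_self])
    refine ⟨w, hwr, hwa, (ω a b)⁻¹, (ω w c)⁻¹, inv_ne_zero hk', inv_ne_zero hwc, fun v => ?_⟩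
    obtain ⟨x, y, hxy⟩ := pair_le hC hr (D.rg2 hC hr) ha hwr ha0 hwa (mem_rg.2 ⟨v, rfl⟩)
    have h1 : v - x • b - y • c ∈ fx u := mem_fx.2 (by
      have : u v = v + (x • a + y • w) := by rw [← hxy]; abel
      rw [map_sub, map_sub, map_smul, map_smul, hub, huc, this]
      module)
    have h3 := D.om_fx ha h1
    have h4 := D.om_fx hwr h1
    simp only [map_sub, map_smul, smul_eq_mul, hac, hwb, mul_zero, sub_zero] at h3 h4
    have e1 : (ω a b)⁻¹ * ω a v = x := by
      rw [sub_eq_zero.1 h3]; field_simp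
    have e2 : (ω w c)⁻¹ * ω w v = y := by
      rw [sub_eq_zero.1 h4]; field_simp
    rw [e1, e2, add_assoc, ← hxy]
    abel

theorem Dat.ne_bot (D : Dat p X r s σ u) : fx s ≠ ⊥ := by
  intro h
  have := (D.spl hC hr).2
  rw [h, finrank_bot] at this
  omega

theorem Dat.tv_done (D : Dat p X r s σ u) {x : V} {c : F} (hx : x ≠ 0) (hc : c ≠ 0) (ht : tv x c ∈ X) : Sp F V ≤ X :=
  L4 hC.h2 D.hX D.irr (D.spl hC hr).1 D.hs (D.ne_bot hC hr) D.hσ D.σF D.σW hx hc ht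

theorem Dat.form (D : Dat p X r s σ u) (hn : ¬ Sp F V ≤ X) {a : V} (ha : a ∈ rg u) (ha0 : a ≠ 0) :
    ∃ w0 ∈ rg u, (¬ ∃ c : F, w0 = c • a) ∧ ∃ α γ : F, α ≠ 0 ∧ γ ≠ 0 ∧ ∀ v, u v = v + (α * ω a v) • a + (γ * ω w0 v) • w0 := by
  rcases D.form' hC hr ha ha0 with ⟨α, h0, h⟩ | h
  · exfalso
    refine hn (D.tv_done hC hr ha0 h0 ?_)
    have : u = tv a α := LinearEquiv.ext fun v => by rw [h, tv_ap]
    rw [← this]; exact D.hu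
  · exact h

end P15

set_option linter.unusedSectionVars false
set_option linter.unusedSimpArgs false
set_option linter.unusedVariables false
set_option autoImplicit false
section P16
open Module
variable {F V : Type*} [Field F] [AddCommGroup V] [Module F V] [Symp F V]
local notation "ω" => Symp.ω (F := F) (V := V)

theorem comm_conj {G : Type*} [Group G] {u s g : G} (h : Commute u s) : Commute (g * u * g⁻¹) (g * s * g⁻¹) := by
  have := h.eq
  change _ = _
  calc _ = g * (u * s) * g⁻¹ := by group
    _ = _ := by rw [this]; group

variable [Finite F] [FiniteDimensional F V] {p e m : ℕ} [CharP F p]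

theorem pfix (hp : p.Prime) {G : Type*} [Group G] [Finite G] (hG : IsPGroup p G) (ρ : G →* (V ≃ₗ[F] V)) {U K : Submodule F V}
    (hU : ∀ g, ∀ v ∈ U, ρ g v ∈ U) (hK : ∀ g, ∀ v ∈ K, ρ g v ∈ K) (hn : ¬ U ≤ K) : ∃ b ∈ U, b ∉ K ∧ ∀ g, ρ g b - b ∈ K := by
  have : Fact p.Prime := ⟨hp⟩
  have : Finite V := Module.finite_of_finite F
  let Q := ↥(U.map K.mkQ)
  let act : MulAction G Q :=
    { smul := fun g x => ⟨K.mapQ K (ρ g : V →ₗ[F] V) (fun v hv => hK g v hv) x.1, by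
        obtain ⟨v, hv, h⟩ := x.2
        rw [← h]
        exact ⟨ρ g v, hU g v hv, rfl⟩⟩
      one_smul := fun x => Subtype.ext (by
        obtain ⟨v, hv, h⟩ := x.2
        change K.mapQ K (ρ 1 : V →ₗ[F] V) _ x.1 = x.1
        rw [← h, Submodule.mkQ_apply, Submodule.mapQ_apply, map_one]; rfl)
      mul_smul := fun g g' x => Subtype.ext (by
        obtain ⟨v, hv, h⟩ := x.2
        change K.mapQ K (ρ (g * g') : V →ₗ[F] V) _ x.1 = K.mapQ K (ρ g : V →ₗ[F] V) _ (K.mapQ K (ρ g' : V →ₗ[F] V) _ x.1)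
        rw [← h, Submodule.mkQ_apply, Submodule.mapQ_apply, Submodule.mapQ_apply, Submodule.mapQ_apply, map_mul]; rfl) }
  have hcd : p ∣ Nat.card Q := by
    rw [Module.natCard_eq_pow_finrank (K := F)]
    refine dvd_pow ?_ ?_
    · have : Fintype F := Fintype.ofFinite F
      rw [Nat.card_eq_fintype_card]
      exact (CharP.cast_eq_zero_iff F p _).1 (by simp)
    · rw [Ne, Submodule.finrank_eq_zero]
      intro h
      refine hn fun v hv => ?_
      have : K.mkQ v ∈ U.map K.mkQ := ⟨v, hv, rfl⟩
      rw [h] at this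
      simpa using this
  have : Finite (V ⧸ K) := Module.finite_of_finite F
  have : Finite Q := Subtype.finite
  obtain ⟨⟨y, hy'⟩, hy, hne⟩ := hG.exists_fixed_point_of_prime_dvd_card_of_fixed_point Q hcd (a := 0) (fun g => by
    refine Subtype.ext ?_
    change K.mapQ K (ρ g : V →ₗ[F] V) _ 0 = 0
    rw [map_zero])
  obtain ⟨b, hb, rfl⟩ := hy'
  refine ⟨b, hb, fun h => hne (Subtype.ext ?_), fun g => ?_⟩
  · exact ((Submodule.Quotient.mk_eq_zero K).2 h).symm
  · have := congrArg Subtype.val (hy g)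
    change K.mapQ K (ρ g : V →ₗ[F] V) _ (K.mkQ b) = K.mkQ b at this
    rw [Submodule.mkQ_apply, Submodule.mapQ_apply] at this
    exact (Submodule.Quotient.eq K).1 this

variable (hC : Ctx F V p e m) {r : ℕ} (hr : Zs p (2 * (m - 2) * e) r) {X : Subgroup (V ≃ₗ[F] V)}
include hC hr

theorem Ctx.getDat (hX : X ≤ Sp F V) (hI : Irr X)
    (h1 : ∃ s ∈ X, s ^ r = 1 ∧ s ≠ 1 ∧ ∃ σ ∈ X, (∀ v ∈ fx s, σ v = v) ∧ (∀ v ∈ perp (fx s), σ v = -v))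
    (h3 : ∃ s ∈ X, s ^ r = 1 ∧ s ≠ 1 ∧ ∃ u ∈ X, Commute u s ∧ u ^ p = 1 ∧ u ≠ 1 ∧ ∀ v, ω v (u v) = 0 → u v = v) :
    ∃ s σ u, Dat p X r s σ u := by
  obtain ⟨s, hs, sr, s1, σ, hσ, σF, σW⟩ := h1
  obtain ⟨t, ht, tr, t1, u, hu, cm, up, u1, an⟩ := h3
  obtain ⟨g, hg, ⟨k, hk⟩, -⟩ := hC.align hr hX hs ht sr s1 tr t1
  refine ⟨s, σ, g * u * g⁻¹, hX, hI, hs, sr, s1, hσ, σF, σW, X.mul_mem (X.mul_mem hg hu) (X.inv_mem hg), ?_, ?_, ?_, ?_⟩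
  · rw [hk]; exact (comm_conj cm).pow_right k
  · rw [conj_pow, up]; simp
  · exact fun h => u1 (by simpa using h)
  · intro v hv
    rw [mul_ap, mul_ap] at hv ⊢
    rw [an (g⁻¹ v) ?_, ap_inv]
    rwa [← hX hg, ap_inv]

theorem Dat.L12a {s σ u n : V ≃ₗ[F] V} (D : Dat p X r s σ u) (hn : n ∈ X) {S : Subgroup (V ≃ₗ[F] V)} (hS : IsPGroup p S) (hnS : n ∈ S) (huS : u ∈ S)
    (hSX : S ≤ X) (hSs : ∀ g ∈ S, Commute g s)
    {v0 : V} (hv : ∀ v ∈ fx s, n v = v → ∃ c : F, v = c • v0) : Sp F V ≤ X := by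
  have hm := hC.hm
  have := finGL (F := F) (V := V)
  by_contra hnX
  obtain ⟨spl, h4⟩ := D.spl hC hr
  have hFi : ∀ g : S, ∀ v ∈ fx s, S.subtype g v ∈ fx s := fun g v hv => fx_inv (hSs g g.2) v hv
  obtain ⟨a, haF, ha0, haS⟩ := pfix hC.hp hS S.subtype (U := fx s) (K := ⊥) hFi (fun g v hv => by
    rw [Submodule.mem_bot] at hv ⊢; rw [hv, map_zero]) (fun h => D.ne_bot hC hr (le_bot_iff.1 h))
  have ha0 : a ≠ 0 := ha0
  have haS : ∀ g ∈ S, g a = a := fun g hg => sub_eq_zero.1 (haS ⟨g, hg⟩)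
  have hva : ∀ v ∈ fx s, n v = v → ∃ c : F, v = c • a := by
    intro v hv1 hv3
    obtain ⟨c, hc⟩ := hv a haF (haS n hnS)
    obtain ⟨d, hd⟩ := hv v hv1 hv3
    have : c ≠ 0 := fun h => ha0 (by rw [hc, h, zero_smul])
    refine ⟨d * c⁻¹, ?_⟩
    rw [hc, hd, smul_smul, mul_assoc, inv_mul_cancel₀ this, mul_one]
  have hfa : finrank F (Submodule.span F {a}) = 1 := finrank_span_singleton ha0
  have hpa : ∀ v, v ∈ perp (Submodule.span F {a}) ↔ ω a v = 0 := by
    intro v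
    rw [mem_perp]
    constructor
    · exact fun h => h a (Submodule.mem_span_singleton_self a)
    · intro h u hu
      obtain ⟨c, rfl⟩ := Submodule.mem_span_singleton.1 hu
      simp [h]
  obtain ⟨b, hbU, hba, hbS⟩ := pfix hC.hp hS S.subtype (U := fx s ⊓ perp (Submodule.span F {a})) (K := Submodule.span F {a})
    (fun g v hv => ⟨hFi g v hv.1, by
      have h1 := (hpa v).1 hv.2
      refine (hpa _).2 ?_
      have h3 := D.hX (hSX g.2) a v
      rw [haS g g.2, h1] at h3
      exact h3⟩)
    (fun g v hv => by
      obtain ⟨c, rfl⟩ := Submodule.mem_span_singleton.1 hv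
      rw [map_smul]
      change c • g.1 a ∈ _
      rw [haS g g.2]; exact hv)
    (fun hle => by
      have h1 := Submodule.finrank_mono hle
      have h3 := Submodule.finrank_sup_add_finrank_inf_eq (fx s) (perp (Submodule.span F {a}))
      have h5 := finrank_perp (Submodule.span F {a})
      have h6 := Submodule.finrank_le (fx s ⊔ perp (Submodule.span F {a}))
      omega)
  have hbF := hbU.1
  have hab := (hpa b).1 hbU.2
  have hba' : ¬ ∃ c : F, b = c • a := fun ⟨c, hc⟩ => hba (Submodule.mem_span_singleton.2 ⟨c, hc.symm⟩)
  obtain ⟨x, hx⟩ := Submodule.mem_span_singleton.1 (hbS ⟨n, hnS⟩)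
  obtain ⟨y, hy⟩ := Submodule.mem_span_singleton.1 (hbS ⟨u, huS⟩)
  change _ = n b - b at hx
  change _ = u b - b at hy
  have hub : u b = b := D.an b (by
    have : u b = b + y • a := by rw [hy]; abel
    rw [this, map_add, map_smul, om_self, om_zero_comm.1 hab]; simp)
  have hua : u a = a := haS u huS
  have hna : n a = a := haS n hnS
  -- the plane
  let Z : Submodule F V := fx s ⊓ perp (Submodule.span F (Set.range ![a, b]))
  have hZm : ∀ v, v ∈ Z ↔ v ∈ fx s ∧ ω a v = 0 ∧ ω b v = 0 := by
    intro v
    change v ∈ fx s ∧ v ∈ perp _ ↔ _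
    rw [mem_perp]
    refine and_congr_right fun _ => ⟨fun h => ⟨h a (mem_pl.2 ⟨1, 0, by simp⟩), h b (mem_pl.2 ⟨0, 1, by simp⟩)⟩, fun h u hu => ?_⟩
    obtain ⟨c, d, rfl⟩ := mem_pl.1 hu
    simp [h.1, h.2]
  have hZ2 : finrank F Z ≤ 2 := by
    have hli : LinearIndependent F ![a, b] := by
      rw [LinearIndependent.pair_iff' ha0]
      intro c hc
      exact hba' ⟨c, hc.symm⟩
    have h1 : finrank F (Submodule.span F (Set.range ![a, b])) = 2 := by
      rw [finrank_span_eq_card hli]; simp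
    have h3 : Submodule.span F (Set.range ![a, b]) ≤ fx s := by
      rw [Submodule.span_le]
      rintro _ ⟨i, rfl⟩
      fin_cases i
      · exact haF
      · exact hbF
    have h5 : Submodule.span F (Set.range ![a, b]) ⊔ perp (fx s) ≤ perp Z := by
      refine sup_le (fun u hu => ?_) (perp_anti inf_le_left)
      rw [mem_perp']
      intro v hv
      exact mem_perp.1 hv.2 u hu
    have h6 : Submodule.span F (Set.range ![a, b]) ⊓ perp (fx s) = ⊥ := (Submodule.eq_bot_iff _).2 fun x hx => spl.inf x (h3 hx.1) hx.2
    have h7 := Submodule.finrank_sup_add_finrank_inf_eq (Submodule.span F (Set.range ![a, b])) (perp (fx s))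
    rw [h6, finrank_bot] at h7
    have h8 := Submodule.finrank_mono h5
    have h9 := finrank_perp Z
    have h10 := finrank_perp (fx s)
    omega
  have haZ : a ∈ Z := (hZm a).2 ⟨haF, om_self a, om_zero_comm.1 hab⟩
  have hbZ : b ∈ Z := (hZm b).2 ⟨hbF, hab, om_self b⟩
  have hrZ : ∀ v ∈ rg u, v ∈ Z := fun v hv => (hZm v).2 ⟨D.rgF hC hr hv,
    om_zero_comm.1 (D.om_fx hv (mem_fx.2 hua)), om_zero_comm.1 (D.om_fx hv (mem_fx.2 hub))⟩
  have har : a ∈ rg u := by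
    obtain ⟨c, hc, hc0⟩ : ∃ c ∈ rg u, c ≠ 0 := by
      by_contra hcon
      push Not at hcon
      exact D.u1 (LinearEquiv.ext fun v => sub_eq_zero.1 (hcon _ (mem_rg.2 ⟨v, rfl⟩)))
    obtain ⟨d, hd, hdc, -⟩ := D.form hC hr hnX hc hc0
    obtain ⟨x, y, h⟩ := pair_le hC hr hZ2 (hrZ c hc) (hrZ d hd) hc0 hdc haZ
    rw [h]
    exact (rg u).add_mem ((rg u).smul_mem _ hc) ((rg u).smul_mem _ hd)
  obtain ⟨w, hw, hwa, α, γ, hα, hγ, hf⟩ := D.form hC hr hnX har ha0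
  obtain ⟨x', y', hwe⟩ := pair_le hC hr hZ2 haZ hbZ ha0 hba' (hrZ w hw)
  have hnb : n b = b + x • a := by rw [hx]; abel
  have hnw : n w = w + (y' * x) • a := by
    rw [hwe, map_add, map_smul, map_smul, hna, hnb]; module
  set κ := y' * x with hκ
  have hκ0 : κ ≠ 0 := fun h => hwa (hva w (D.rgF hC hr hw) (by rw [hnw, h, zero_smul, add_zero]))
  have hnS' := D.hX hn
  have haw : ω a w = 0 := D.ti hC har hw
  have hwa0 : ω w a = 0 := D.ti hC hw har
  have e1 : ∀ g ∈ Sp F V, ∀ v, (g * u * g⁻¹) v = v + (α * ω (g a) v) • g a + (γ * ω (g w) v) • g w := by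
    intro g hg v
    have h1 : ∀ z, ω z (g⁻¹ v) = ω (g z) v := fun z => by rw [← hg, ap_inv]
    rw [mul_ap, mul_ap, hf, map_add, map_add, ap_inv, map_smul, map_smul, h1, h1]
  have h2w : (n * n) w = w + (2 * κ) • a := by
    rw [mul_ap, hnw, map_add, map_smul, hnw, hna]; module
  have h2a : (n * n) a = a := by rw [mul_ap, hna, hna]
  have key : ((n * n) * u * (n * n)⁻¹) * u = tv a (2 * γ * κ ^ 2) * ((n * u * n⁻¹) * (n * u * n⁻¹)) := by
    refine LinearEquiv.ext fun v => ?_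
    change ((n * n) * u * (n * n)⁻¹) (u v) = tv a (2 * γ * κ ^ 2) ((n * u * n⁻¹) ((n * u * n⁻¹) v))
    rw [e1 _ ((Sp F V).mul_mem hnS' hnS'), hf v, tv_ap]
    rw [e1 n hnS', e1 n hnS', h2w, h2a, hnw, hna]
    simp only [map_add, map_smul, LinearMap.add_apply, LinearMap.smul_apply, smul_eq_mul, om_self, haw, hwa0]
    module
  refine hnX (D.tv_done hC hr ha0 (c := 2 * γ * κ ^ 2) (mul_ne_zero (mul_ne_zero hC.h2 hγ) (pow_ne_zero _ hκ0)) ?_)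
  rw [eq_mul_inv_iff_mul_eq.2 key.symm]
  have m1 : n * u * n⁻¹ ∈ X := X.mul_mem (X.mul_mem hn D.hu) (X.inv_mem hn)
  have hnn := X.mul_mem hn hn
  exact X.mul_mem (X.mul_mem (X.mul_mem (X.mul_mem hnn D.hu) (X.inv_mem hnn)) D.hu) (X.inv_mem (X.mul_mem m1 m1))

theorem Dat.L12 {s σ u : V ≃ₗ[F] V} (D : Dat p X r s σ u)
    (h3 : ∃ s ∈ X, s ^ r = 1 ∧ s ≠ 1 ∧ ∃ n ∈ X, Commute n s ∧ n ^ p ^ 4 = 1 ∧ ∃ v0 : V, v0 ≠ 0 ∧ ∀ v ∈ fx s, n v = v → ∃ c : F, v = c • v0) :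
    Sp F V ≤ X := by
  have := finGL (F := F) (V := V)
  obtain ⟨t, ht, tr, t1, n, hn, cm, np, v0, -, hv⟩ := h3
  obtain ⟨g, hg, ⟨k, hk⟩, hfe⟩ := hC.align hr D.hX D.hs ht D.sr D.s1 tr t1
  set n' := g * n * g⁻¹ with hn'
  have hnX : n' ∈ X := X.mul_mem (X.mul_mem hg hn) (X.inv_mem hg)
  have hns : Commute n' s := by rw [hk]; exact (comm_conj cm).pow_right k
  have hnp : n' ^ p ^ 4 = 1 := by rw [conj_pow, np]; simp
  have hv' : ∀ v ∈ fx s, n' v = v → ∃ c : F, v = c • g v0 := by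
    intro v h1 h4
    rw [hfe] at h1
    obtain ⟨c, hc⟩ := hv (g⁻¹ v) (fx_conj.1 h1) (mem_fx.1 (fx_conj.1 (mem_fx.2 h4)))
    refine ⟨c, ?_⟩
    rw [← map_smul, ← hc, ap_inv]
  let G : Subgroup (V ≃ₗ[F] V) := X ⊓ Subgroup.centralizer {s}
  have hG : ∀ x, x ∈ G ↔ x ∈ X ∧ Commute x s := by
    intro x
    change x ∈ X ∧ x ∈ Subgroup.centralizer {s} ↔ _
    rw [Subgroup.mem_centralizer_singleton_iff]
    exact Iff.rfl
  obtain ⟨h, S, hS, hnS, huS⟩ := sylow_conj hC.hp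
    (isP (k := 1) (by rw [pow_one]; exact Subtype.ext D.up) : IsPGroup p (Subgroup.zpowers (⟨u, (hG u).2 ⟨D.hu, D.cm⟩⟩ : G)))
    (isP (k := 4) (Subtype.ext hnp) : IsPGroup p (Subgroup.zpowers (⟨n', (hG n').2 ⟨hnX, hns⟩⟩ : G)))
  have hh := (hG h).1 h.2
  have hD := D.conj hh.1
  have hse : h.1 * s * h.1⁻¹ = s := by rw [hh.2.eq]; group
  rw [hse] at hD
  refine hD.L12a hC hr hnX (S := S.map G.subtype) (hS.map _) ⟨_, hnS (Subgroup.mem_zpowers _), rfl⟩ ⟨_, huS _ (Subgroup.mem_zpowers _), rfl⟩ ?_ ?_ hv'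
  · rintro _ ⟨x, -, rfl⟩
    exact ((hG x).1 x.2).1
  · rintro _ ⟨x, -, rfl⟩
    exact ((hG x).1 x.2).2

end P16

set_option linter.unusedSectionVars false
set_option linter.unusedSimpArgs false
set_option linter.unusedVariables false
set_option autoImplicit false
section P17
open Module

theorem count_false {q m N X1 X2 X3 : ℕ} (hq : 3 ≤ q) (hm : 5 ≤ m) (h1 : 2 * X1 = q ^ m + 1) (h2 : X2 * (q - 1) = q ^ m - 1)
    (h3 : 2 * X3 = q ^ (m - 1) + 1) (hN : 0 < N) (d1 : X1 ∣ N) (d2 : X2 ∣ N) (d3 : X3 ∣ N) (hle : N ≤ 2 * X1 * X2) : False := by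
  have hqm : 1 ≤ q ^ m := Nat.one_le_pow _ _ (by omega)
  have hqm' : q ^ m = q * q ^ (m - 1) := by
    rw [← pow_succ']; congr 1; omega
  have hd1 : ∀ d, d ∣ X1 → d ∣ q ^ m + 1 := fun d h => by rw [← h1]; exact h.mul_left 2
  have hd2 : ∀ d, d ∣ X2 → d ∣ q ^ m - 1 := fun d h => by rw [← h2]; exact h.mul_right _
  have hd3 : ∀ d, d ∣ X3 → d ∣ q ^ (m - 1) + 1 := fun d h => by rw [← h3]; exact h.mul_left 2
  have g12 : Nat.gcd X1 X2 ∣ 2 := by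
    have a := hd1 _ (Nat.gcd_dvd_left X1 X2)
    have b := hd2 _ (Nat.gcd_dvd_right X1 X2)
    have := Nat.dvd_sub a b
    rwa [show q ^ m + 1 - (q ^ m - 1) = 2 by omega] at this
  have g13 : Nat.gcd X1 X3 ∣ 2 := by
    have a := hd1 _ (Nat.gcd_dvd_left X1 X3)
    have b := hd3 _ (Nat.gcd_dvd_right X1 X3)
    have := Nat.dvd_sub (b.mul_left q) a
    rw [mul_add, ← hqm', mul_one, show q ^ m + q - (q ^ m + 1) = q - 1 by omega] at this
    have h := Nat.dvd_sub a (this.trans (Nat.sub_one_dvd_pow_sub_one q m))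
    rwa [show q ^ m + 1 - (q ^ m - 1) = 2 by omega] at h
  have g23 : Nat.gcd X2 X3 ∣ q + 1 := by
    have a := hd2 _ (Nat.gcd_dvd_left X2 X3)
    have b := hd3 _ (Nat.gcd_dvd_right X2 X3)
    have := Nat.dvd_sub (b.mul_left q) a
    rwa [mul_add, ← hqm', mul_one, show q ^ m + q - (q ^ m - 1) = q + 1 by omega] at this
  have hl : Nat.lcm (Nat.lcm X1 X2) X3 ≤ N := Nat.le_of_dvd hN (Nat.lcm_dvd (Nat.lcm_dvd d1 d2) d3)
  have e1 := Nat.gcd_mul_lcm X1 X2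
  have e2 := Nat.gcd_mul_lcm (Nat.lcm X1 X2) X3
  have g12' := Nat.le_of_dvd (by omega) g12
  have gL : Nat.gcd (Nat.lcm X1 X2) X3 ≤ 2 * (q + 1) := by
    refine Nat.le_of_dvd (by positivity) ?_
    refine (Nat.gcd_dvd_gcd_of_dvd_left X3 (Nat.lcm_dvd_mul X1 X2)).trans ?_
    rw [Nat.gcd_comm]
    refine (Nat.gcd_mul_right_dvd_mul_gcd X3 X1 X2).trans ?_
    rw [Nat.gcd_comm X3, Nat.gcd_comm X3]
    exact mul_dvd_mul g13 g23
  have hX12 : X1 * X2 ≤ 2 * Nat.lcm X1 X2 := by rw [← e1]; exact Nat.mul_le_mul_right _ g12'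
  have hX : X1 * X2 * X3 ≤ X1 * X2 * (8 * (q + 1)) := by
    calc X1 * X2 * X3 ≤ 2 * Nat.lcm X1 X2 * X3 := Nat.mul_le_mul_right _ hX12
      _ = 2 * (Nat.lcm X1 X2 * X3) := by ring
      _ ≤ 2 * (2 * (q + 1) * N) := by rw [← e2]; gcongr
      _ ≤ 2 * (2 * (q + 1) * (2 * X1 * X2)) := by gcongr
      _ = _ := by ring
  have hpos : 0 < X1 * X2 := by
    rcases Nat.eq_zero_or_pos (X1 * X2) with h | h
    · rw [mul_assoc, h] at hle; omega
    · exact h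
  have hX3 := Nat.le_of_mul_le_mul_left hX hpos
  have h4 : q ^ 4 ≤ q ^ (m - 1) := Nat.pow_le_pow_right (by omega) (by omega)
  have h5 : 27 * q ≤ q ^ 4 := by
    rw [pow_succ]
    exact Nat.mul_le_mul_right _ (Nat.pow_le_pow_left hq 3)
  omega

variable {F V : Type*} [Field F] [AddCommGroup V] [Module F V] [Symp F V]
local notation "ω" => Symp.ω (F := F) (V := V)

variable [Finite F] [FiniteDimensional F V] {p e m : ℕ} [CharP F p]
variable (hC : Ctx F V p e m) {r : ℕ} (hr : Zs p (2 * (m - 2) * e) r) {X : Subgroup (V ≃ₗ[F] V)}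
include hC hr

theorem form_conj {τ g : V ≃ₗ[F] V} (hg : g ∈ Sp F V) {a w : V} {α γ : F} (hf : ∀ v, τ v = v + (α * ω a v) • a + (γ * ω w v) • w) (v : V) :
    (g * τ * g⁻¹) v = v + (α * ω (g a) v) • g a + (γ * ω (g w) v) • g w := by
  have h1 : ∀ z, ω z (g⁻¹ v) = ω (g z) v := fun z => by rw [← hg, ap_inv]
  rw [mul_ap, mul_ap, hf, map_add, map_add, ap_inv, map_smul, map_smul, h1, h1]

theorem Dat.Q {s σ u τ : V ≃ₗ[F] V} (D : Dat p X r s σ u) (hn : ¬ Sp F V ≤ X) (hτ : τ ∈ X) {a w : V} {α γ : F} (hγ : γ ≠ 0)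
    (hf : ∀ v, τ v = v + (α * ω a v) • a + (γ * ω w v) • w) (ha : a ∈ fx s) (haw : ω a w = 0) : w ∈ fx s ∨ w ∈ perp (fx s) := by
  obtain ⟨spl, h4⟩ := D.spl hC hr
  obtain ⟨b, hb, w, hw, rfl⟩ := spl.dec w
  by_cases hw0 : w = 0
  · left; rwa [hw0, add_zero]
  by_cases hb0 : b = 0
  · right; rwa [hb0, zero_add]
  exfalso
  have haw' : ω a w = 0 := spl.om ha hw
  have hbw : ω b w = 0 := spl.om hb hw
  have hwb : ω w b = 0 := om_zero_comm.1 hbw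
  have hab : ω a b = 0 := by rw [map_add, haw', add_zero] at haw; exact haw
  have hba : ω b a = 0 := om_zero_comm.1 hab
  have hwa : ω w a = 0 := om_zero_comm.1 haw'
  have e1 := form_conj hC hr (D.hX D.hσ) hf
  rw [map_add, D.σF _ ha, D.σF _ hb, D.σW _ hw] at e1
  refine hn (L3 hC.h2 D.hX D.irr spl D.hs (u := (2 * γ) • b) (w := w) ((fx s).smul_mem _ hb)
    (smul_ne_zero (mul_ne_zero hC.h2 hγ) hb0) hw hw0 (c := 0) ⟨τ * (σ * τ * σ⁻¹)⁻¹, X.mul_mem hτ (X.inv_mem (X.mul_mem (X.mul_mem D.hσ hτ) (X.inv_mem D.hσ))), fun v => ?_⟩)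
  obtain ⟨v', rfl⟩ : ∃ v', v = (σ * τ * σ⁻¹) v' := ⟨(σ * τ * σ⁻¹)⁻¹ v, by rw [ap_inv]⟩
  rw [mul_ap τ, inv_ap, hf, e1]
  simp only [map_add, map_neg, map_smul, LinearMap.add_apply, LinearMap.neg_apply, LinearMap.smul_apply, smul_eq_mul, om_self, haw', hbw, hwb, hab, hba, hwa]
  module

theorem Dat.P1 {s σ u s' σ' u' : V ≃ₗ[F] V} (D : Dat p X r s σ u) (D' : Dat p X r s' σ' u') (hn : ¬ Sp F V ≤ X) {a : V} (ha : a ∈ rg u') (ha0 : a ≠ 0)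
    (haF : a ∈ fx s) : rg u' ≤ fx s := by
  have hm := hC.hm
  obtain ⟨w, hw, hwa, α, γ, hα, hγ, hf⟩ := D'.form hC hr hn ha ha0
  have hw0 : w ≠ 0 := fun h => hwa ⟨0, by rw [h, zero_smul]⟩
  have haw := D'.ti hC ha hw
  rcases D.Q hC hr hn D'.hu hγ hf haF haw with h | h
  · intro x hx
    obtain ⟨v, rfl⟩ := mem_rg.1 hx
    rw [hf, add_assoc, add_sub_cancel_left]
    exact (fx s).add_mem ((fx s).smul_mem _ haF) ((fx s).smul_mem _ h)
  · exfalso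
    obtain ⟨spl, h4⟩ := D.spl hC hr
    obtain ⟨spl', h4'⟩ := D'.spl hC hr
    have hle := L5 spl h hw0 (F' := fx s') (D'.rgF hC hr hw) (fun i => by
      have hsi : s ^ i ∈ X := pow_mem D.hs i
      have hsa : (s ^ i) a = a := by
        have := eig_pow (F := F) (g := s) (x := a) (c := 1) (by rw [one_smul]; exact mem_fx.1 haF) i
        rwa [one_pow, one_smul] at this
      have e1 := form_conj hC hr (D.hX hsi) hf
      refine D'.Q hC hr hn (X.mul_mem (X.mul_mem hsi D'.hu) (X.inv_mem hsi)) hγ e1 ?_ ?_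
      · rw [hsa]; exact D'.rgF hC hr ha
      · rw [D.hX hsi]; exact haw)
    have h5 := Submodule.finrank_mono hle
    have h6 := finrank_perp (fx s)
    have := hC.hV
    omega

theorem Dat.P2 {s σ u h : V ≃ₗ[F] V} (D : Dat p X r s σ u) (hn : ¬ Sp F V ≤ X) {r' : ℕ} (hr' : Zs p (2 * (m - 1) * e) r') (hh : h ∈ X) (hhr : h ^ r' = 1) (hh1 : h ≠ 1)
    {v : V} (hv : v ∈ rg u) (hv0 : v ≠ 0) : v ∉ fx h := by
  intro hvh
  have hm := hC.hm
  obtain ⟨spl, hd, hd'⟩ := hC.sp (by omega) (by omega) hr' (D.hX hh) hhr hh1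
  have hs4 := (D.spl hC hr).2
  let Y : Submodule F V := Submodule.span F {y | ∃ g ∈ X, v ∈ rg (g * u * g⁻¹) ∧ y ∈ rg (g * u * g⁻¹)}
  have hYF : Y ≤ fx s := by
    refine Submodule.span_le.2 ?_
    rintro y ⟨g, hg, hvg, hy⟩
    exact D.P1 hC hr (D.conj hg) hn hvg hv0 (D.rgF hC hr hv) hy
  have hYi : ∀ y ∈ Y, h y ∈ Y := by
    intro y hy
    induction hy using Submodule.span_induction with
    | mem y hy =>
      obtain ⟨g, hg, hvg, hy⟩ := hy
      refine Submodule.subset_span ⟨h * g, X.mul_mem hh hg, ?_, ?_⟩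
      · rw [rg_conj] at hvg ⊢
        rw [mul_inv_rev, mul_ap, ← mem_fx.1 hvh, inv_ap]
        exact hvg
      · rw [rg_conj] at hy ⊢
        rw [mul_inv_rev, mul_ap, inv_ap]
        exact hy
    | zero => rw [map_zero]; exact Y.zero_mem
    | add x y _ _ hx hy => rw [map_add]; exact Y.add_mem hx hy
    | smul c x _ hx => rw [map_smul]; exact Y.smul_mem _ hx
  have hYh : Y ≤ fx h := spl.inv_le hYi (by
    have := Submodule.finrank_mono hYF
    omega)
  have hrY : rg u ≤ Y := fun y hy => Submodule.subset_span ⟨1, X.one_mem, by simpa using hv, by simpa using hy⟩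
  obtain ⟨w, hw, hwv, -⟩ := D.form hC hr hn hv hv0
  refine hv0 (spl.inf v hvh (mem_perp'.2 fun z hz => ?_))
  obtain ⟨x, y, rfl⟩ := pair_le hC hr (by omega) hvh (hYh (hrY hw)) hv0 hwv hz
  rw [map_add, map_smul, map_smul, om_self, D.ti hC hv hw]; simp

theorem Dat.edvd {u f : V ≃ₗ[F] V} (hf : f ∈ X) {d : ℕ}
    (hd : ∀ (k : ℕ) (v : V) (c : F), v ≠ 0 → (∃ g ∈ X, v ∈ rg (g * u * g⁻¹)) → (f ^ k) v = c • v → d ∣ k) :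
    d ∣ Nat.card {l : Projectivization F V // ∃ g ∈ X, ∃ (v : V) (hv : v ≠ 0), v ∈ rg (g * u * g⁻¹) ∧ l = Projectivization.mk F v hv} := by
  have : Finite V := Module.finite_of_finite F
  have step : ∀ f ∈ X, ∀ l : Projectivization F V, (∃ g ∈ X, ∃ (v : V) (hv : v ≠ 0), v ∈ rg (g * u * g⁻¹) ∧ l = Projectivization.mk F v hv) →
      (∃ g ∈ X, ∃ (v : V) (hv : v ≠ 0), v ∈ rg (g * u * g⁻¹) ∧ f • l = Projectivization.mk F v hv) := by
    rintro f hf _ ⟨g, hg, v, hv, hvg, rfl⟩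
    refine ⟨f * g, X.mul_mem hf hg, f v, (by simpa using hv), ?_, rfl⟩
    rw [rg_conj] at hvg ⊢
    rw [mul_inv_rev, mul_ap, inv_ap]
    exact hvg
  refine orbit_dvd ((MulAction.toPerm f : Equiv.Perm (Projectivization F V)).subtypePerm fun l => ⟨fun h => ?_, fun h => step f hf l h⟩) ?_
  · have := step f⁻¹ (X.inv_mem hf) _ h
    simpa using this
  · rintro ⟨_, g, hg, v, hv, hvg, rfl⟩ k hk
    rw [Equiv.Perm.subtypePerm_pow] at hk
    have h1 := congrArg Subtype.val hk
    rw [Equiv.Perm.subtypePerm_apply] at h1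
    have h2 : (MulAction.toPerm f : Equiv.Perm (Projectivization F V)) ^ k = MulAction.toPerm (f ^ k) :=
      (map_pow (MulAction.toPermHom (V ≃ₗ[F] V) (Projectivization F V)) f k).symm
    simp only [h2, MulAction.toPerm_apply] at h1
    rw [Projectivization.smul_mk, Projectivization.mk_eq_mk_iff'] at h1
    obtain ⟨c, hc⟩ := h1
    exact hd k v c hv ⟨g, hg, hvg⟩ hc.symm

theorem Dat.L13 {s σ u : V ≃ₗ[F] V} (D : Dat p X r s σ u)
    (hA : ∃ A' ∈ X, (∀ (k : ℕ) (v : V) (c : F), v ≠ 0 → (A' ^ k) v = c • v → Nat.card F ^ m + 1 ∣ 2 * k))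
    (hD : ∃ D' ∈ X, (∀ (k : ℕ) (v : V) (c : F), v ≠ 0 → (D' ^ k) v = c • v → Nat.card F ^ m - 1 ∣ k * (Nat.card F - 1)))
    {r' : ℕ} (hr' : Zs p (2 * (m - 1) * e) r')
    (hC1 : ∃ C' ∈ X, ∃ h ∈ X, h ^ r' = 1 ∧ h ≠ 1 ∧
      ∀ (k : ℕ) (v : V) (c : F), v ∉ fx h → (C' ^ k) v = c • v → Nat.card F ^ (m - 1) + 1 ∣ 2 * k) : Sp F V ≤ X := by
  by_contra hn
  have hm := hC.hm
  have : Finite V := Module.finite_of_finite F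
  obtain ⟨A', hA, hA'⟩ := hA
  obtain ⟨D', hD, hD'⟩ := hD
  obtain ⟨C', hC', h, hh, hhr, hh1, hC1⟩ := hC1
  obtain ⟨hqo, hq3⟩ := q_odd hC.hp hC.h2
  obtain ⟨X1, h1⟩ : 2 ∣ Nat.card F ^ m + 1 := (hqo.pow.add_odd odd_one).two_dvd
  obtain ⟨X3, h3⟩ : 2 ∣ Nat.card F ^ (m - 1) + 1 := (hqo.pow.add_odd odd_one).two_dvd
  obtain ⟨X2, h2⟩ : Nat.card F - 1 ∣ Nat.card F ^ m - 1 := Nat.sub_one_dvd_pow_sub_one _ _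
  rw [mul_comm] at h2
  let E := {l : Projectivization F V // ∃ g ∈ X, ∃ (v : V) (hv : v ≠ 0), v ∈ rg (g * u * g⁻¹) ∧ l = Projectivization.mk F v hv}
  obtain ⟨c, hc, hc0⟩ : ∃ c ∈ rg u, c ≠ 0 := by
    by_contra hcon
    push Not at hcon
    exact D.u1 (LinearEquiv.ext fun v => sub_eq_zero.1 (hcon _ (mem_rg.2 ⟨v, rfl⟩)))
  have hne : Nonempty E := ⟨⟨Projectivization.mk F c hc0, 1, X.one_mem, c, hc0, by simpa using hc, rfl⟩⟩
  refine count_false (N := Nat.card E) hq3 hm h1.symm h2.symm h3.symm Nat.card_pos ?_ ?_ ?_ ?_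
  · refine Dat.edvd hC hr hA fun k v c hv _ hk => ?_
    have := hA' k v c hv hk
    rw [h1] at this
    exact Nat.dvd_of_mul_dvd_mul_left (by norm_num) this
  · refine Dat.edvd hC hr hD fun k v c hv _ hk => ?_
    have := hD' k v c hv hk
    rw [h2] at this
    exact Nat.dvd_of_mul_dvd_mul_right (by omega) this
  · refine Dat.edvd hC hr hC' fun k v c hv hg hk => ?_
    obtain ⟨g, hg, hvg⟩ := hg
    have := hC1 k v c ((D.conj hg).P2 hC hr hn hr' hh hhr hh1 hvg hv) hk
    rw [h3] at this
    exact Nat.dvd_of_mul_dvd_mul_left (by norm_num) this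
  · have hEc : Nat.card E ≤ Nat.card (Projectivization F V) := Nat.card_le_card_of_injective Subtype.val Subtype.val_injective
    refine hEc.trans ?_
    refine Nat.le_of_mul_le_mul_right (c := Nat.card F - 1) ?_ (by omega)
    rw [← Projectivization.card, Module.natCard_eq_pow_finrank (K := F), hC.hV, mul_assoc, ← h2, ← h1]
    have : 1 ≤ Nat.card F ^ m := Nat.one_le_pow _ _ (by omega)
    obtain ⟨z, hz⟩ := Nat.exists_eq_add_of_le this
    rw [two_mul, pow_add, hz]
    apply le_of_eq
    rw [Nat.add_sub_cancel_left]
    have : (1 + z) * (1 + z) = (1 + z + 1) * z + 1 := by ring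
    omega

end P17

set_option linter.unusedSectionVars false
set_option linter.unusedSimpArgs false
set_option linter.unusedVariables false
set_option autoImplicit false
section P18
open Module
section MT
variable {F V : Type*} [Field F] [AddCommGroup V] [Module F V] [Symp F V]
local notation "ω" => Symp.ω (F := F) (V := V)

variable [Finite F] [FiniteDimensional F V] {p e m : ℕ} [CharP F p]
variable (hC : Ctx F V p e m)
include hC

theorem Ctx.half {X Y : Subgroup (V ≃ₗ[F] V)} (hX : X ≤ Sp F V) (hXn : ng F V ∈ X)
    (hG : ∀ g ∈ Sp F V, ∃ R : (V ≃ₗ[F] V) → (V ≃ₗ[F] V) → Prop, Cor R ∧ ∃ g', R g g' ∧ (g' ∈ X ∨ g' ∈ Y))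
    (hY : LineY Y ∨ PlaneY Y) : Sp F V ≤ X := by
  have hm := hC.hm
  obtain ⟨r0, hr0⟩ := hC.zs m (by omega)
  obtain ⟨r1, hr1⟩ := hC.zs (m - 1) (by omega)
  obtain ⟨r2, hr2⟩ := hC.zs (m - 2) (by omega)
  obtain ⟨A, hA, A1, A2, A3⟩ := hC.exAX hr0
  obtain ⟨D, hD, D1, D3⟩ := hC.exDX
  obtain ⟨C1, hC1, C11, C13⟩ := hC.exC1X hr1
  obtain ⟨C2, hC2, C21, C22, C23⟩ := hC.exC2X hr2
  obtain ⟨U, hU, U1, U2, U3⟩ := hC.exYX hr2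
  obtain ⟨J, hJ, J2, J3⟩ := hC.exJX hr2
  rcases hY with hY | hY
  · have key : ∀ g ∈ Sp F V, NoLine g → Got X g := by
      intro g hg hgl
      obtain ⟨R, hR, g', h, h'⟩ := hG g hg
      exact ⟨R, hR, g', h, h'.resolve_right (hR.noLine hC hY h hgl)⟩
    obtain ⟨hI, hA'⟩ := A3 X hX hXn (key A hA A1)
    obtain ⟨s, σ, u, Dt⟩ := hC.getDat hr2 hX hI (C23 X hX hXn (key _ hC2 C21)) (U3 X hX hXn (key _ hU U1))
    exact Dt.L13 hC hr2 hA' (D3 X (key _ hD D1)) hr1 (C13 X hX hXn (key _ hC1 C11))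
  · have key : ∀ g ∈ Sp F V, NoPlane g → Got X g := by
      intro g hg hgl
      obtain ⟨R, hR, g', h, h'⟩ := hG g hg
      exact ⟨R, hR, g', h, h'.resolve_right (hR.noPlane hC hY h hgl)⟩
    obtain ⟨hI, hA'⟩ := A3 X hX hXn (key A hA A2)
    obtain ⟨s, σ, u, Dt⟩ := hC.getDat hr2 hX hI (C23 X hX hXn (key _ hC2 C22)) (U3 X hX hXn (key _ hU U2))
    exact Dt.L12 hC hr2 (J3 X hX hXn (key _ hJ J2))

theorem Ctx.main {X Y : Subgroup (V ≃ₗ[F] V)} (hX : X ≤ Sp F V) (hXn : ng F V ∈ X) (hY : Y ≤ Sp F V) (hYn : ng F V ∈ Y)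
    (hG : ∀ g ∈ Sp F V, ∃ R : (V ≃ₗ[F] V) → (V ≃ₗ[F] V) → Prop, Cor R ∧ ∃ g', R g g' ∧ (g' ∈ X ∨ g' ∈ Y)) :
    Sp F V ≤ X ∨ Sp F V ≤ Y := by
  have hm := hC.hm
  obtain ⟨r1, hr1⟩ := hC.zs (m - 1) (by omega)
  obtain ⟨B, hB, hB1⟩ := hC.exBX hr1
  obtain ⟨R, hR, B', h, h' | h'⟩ := hG B hB
  · rcases hB1 X hX hXn ⟨R, hR, B', h, h'⟩ with h1 | h1
    · exact Or.inl h1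
    · refine Or.inr (hC.half hY hYn (Y := X) (fun g hg => ?_) h1)
      obtain ⟨R, hR, g', h, h'⟩ := hG g hg
      exact ⟨R, hR, g', h, h'.symm⟩
  · rcases hB1 Y hY hYn ⟨R, hR, B', h, h'⟩ with h1 | h1
    · exact Or.inr h1
    · exact Or.inl (hC.half hX hXn hG h1)

theorem Ctx.scal {g : V ≃ₗ[F] V} (hg : g ∈ Sp F V) (h : ∀ x, Commute g (tv x 1)) : g = 1 ∨ g = ng F V := by
  have hm := hC.hm
  have h1 : ∀ x ∈ (⊤ : Submodule F V), ∃ c : F, g x = c • x := by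
    intro x _
    by_cases hx : x = 0
    · exact ⟨0, by simp [hx]⟩
    have hgx : g x ≠ 0 := by simpa using hx
    have h3 : tv (g x) (1 : F) = tv x (1 : F) := by
      rw [← tv_conj hg, (h x).eq]; group
    obtain ⟨w, hw⟩ := om_nd (F := F) hgx
    have h4 := congrArg (fun f : V ≃ₗ[F] V => f w) h3
    simp only [tv_ap, one_mul, add_right_inj] at h4
    refine ⟨(ω (g x) w)⁻¹ * ω x w, ?_⟩
    rw [mul_smul, ← h4, smul_smul, inv_mul_cancel₀ hw, one_smul]
  obtain ⟨c, hc⟩ := scal_eig h1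
  have : Nontrivial V := Module.nontrivial_of_finrank_pos (R := F) (by rw [hC.hV]; omega)
  obtain ⟨x, hx⟩ := exists_ne (0 : V)
  obtain ⟨w, hw⟩ := om_nd (F := F) hx
  have h5 := hg x w
  rw [hc x trivial, hc w trivial] at h5
  simp only [map_smul, LinearMap.smul_apply, smul_eq_mul] at h5
  have h6 : (c - 1) * (c + 1) = 0 := by
    refine (mul_eq_zero.1 (?_ : ((c - 1) * (c + 1)) * ω x w = 0)).resolve_right hw
    linear_combination h5
  rcases mul_eq_zero.1 h6 with h7 | h7
  · left
    refine LinearEquiv.ext fun v => ?_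
    rw [hc v trivial, sub_eq_zero.1 h7, one_smul, one_ap]
  · right
    refine LinearEquiv.ext fun v => ?_
    rw [hc v trivial, eq_neg_of_add_eq_zero_left h7, ng_ap, neg_smul, one_smul]

end MT

section Fin
variable (m : ℕ) (F : Type*) [Field F]

def psi : ↥(Matrix.symplecticGroup (Fin m) F) →* ((Fin m ⊕ Fin m → F) ≃ₗ[F] (Fin m ⊕ Fin m → F)) :=
  (LinearMap.GeneralLinearGroup.generalLinearEquiv F (Fin m ⊕ Fin m → F)).toMonoidHom.comp
    (MonoidHom.toHomUnits ((Matrix.toLinAlgEquiv' (R := F) (n := Fin m ⊕ Fin m)).toRingEquiv.toRingHom.toMonoidHom.comp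
      (Matrix.symplecticGroup (Fin m) F).subtype))

variable {m F}
theorem psi_ap (A : ↥(Matrix.symplecticGroup (Fin m) F)) (v : Fin m ⊕ Fin m → F) : psi m F A v = A.1.mulVec v := rfl

theorem psi_inj : Function.Injective (psi m F) := by
  intro A B h
  refine Subtype.ext (Matrix.toLin'.injective (LinearMap.ext fun v => ?_))
  exact congrArg (fun f : (Fin m ⊕ Fin m → F) ≃ₗ[F] (Fin m ⊕ Fin m → F) => f v) h

theorem om_J (v w : Fin m ⊕ Fin m → F) : Symp.ω (F := F) v w = v ⬝ᵥ (Matrix.J (Fin m) F).mulVec w := by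
  rw [std_om]
  simp [dotProduct, Matrix.mulVec, Matrix.J, Fintype.sum_sum_type, Matrix.one_apply, Finset.sum_sub_distrib]
  ring

theorem om_mul (A : Matrix (Fin m ⊕ Fin m) (Fin m ⊕ Fin m) F) (v w : Fin m ⊕ Fin m → F) :
    Symp.ω (F := F) (A.mulVec v) (A.mulVec w) = v ⬝ᵥ (A.transpose * Matrix.J (Fin m) F * A).mulVec w := by
  rw [om_J, ← Matrix.mulVec_mulVec, ← Matrix.mulVec_mulVec, Matrix.dotProduct_mulVec v A.transpose, Matrix.vecMul_transpose]

theorem psi_mem (A : ↥(Matrix.symplecticGroup (Fin m) F)) : psi m F A ∈ Sp F (Fin m ⊕ Fin m → F) := by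
  intro v w
  rw [psi_ap, psi_ap, om_mul, SymplecticGroup.mem_iff'.1 A.2, om_J]

theorem psi_surj {g : (Fin m ⊕ Fin m → F) ≃ₗ[F] (Fin m ⊕ Fin m → F)} (hg : g ∈ Sp F (Fin m ⊕ Fin m → F)) : ∃ A, psi m F A = g := by
  have h1 : ∀ v, (LinearMap.toMatrix' (g : (Fin m ⊕ Fin m → F) →ₗ[F] (Fin m ⊕ Fin m → F))).mulVec v = g v := fun v => by
    rw [LinearMap.toMatrix'_mulVec]; rfl
  refine ⟨⟨LinearMap.toMatrix' (g : (Fin m ⊕ Fin m → F) →ₗ[F] (Fin m ⊕ Fin m → F)), SymplecticGroup.mem_iff'.2 ?_⟩, LinearEquiv.ext fun v => h1 v⟩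
  ext i j
  have h3 := hg (Pi.single i 1) (Pi.single j 1)
  rw [← h1, ← h1, om_mul, om_J] at h3
  simpa using h3

variable [Finite F] {p e : ℕ} [CharP F p] (hC : Ctx F (Fin m ⊕ Fin m → F) p e m)
include hC

theorem psi_center (A : ↥(Matrix.symplecticGroup (Fin m) F)) : A ∈ Subgroup.center ↥(Matrix.symplecticGroup (Fin m) F) ↔
    psi m F A = 1 ∨ psi m F A = ng F _ := by
  rw [Subgroup.mem_center_iff]
  constructor
  · intro h
    refine hC.scal (psi_mem A) fun x => ?_
    obtain ⟨T, hT⟩ := psi_surj (tv_mem (F := F) x 1)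
    rw [← hT]
    change _ = _
    rw [← map_mul, ← map_mul, h T]
  · intro h T
    refine psi_inj ?_
    rw [map_mul, map_mul]
    rcases h with h | h
    · rw [h, one_mul, mul_one]
    · rw [h, ng_comm]

theorem psi_cor (φ : (↥(Matrix.symplecticGroup (Fin m) F) ⧸ Subgroup.center ↥(Matrix.symplecticGroup (Fin m) F)) ≃*
    (↥(Matrix.symplecticGroup (Fin m) F) ⧸ Subgroup.center ↥(Matrix.symplecticGroup (Fin m) F))) :
    Cor (F := F) (V := Fin m ⊕ Fin m → F) (fun g g' => ∃ A A', psi m F A = g ∧ psi m F A' = g' ∧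
      φ (QuotientGroup.mk A) = QuotientGroup.mk A') where
  mem := by
    rintro _ _ ⟨A, A', rfl, rfl, -⟩
    exact ⟨psi_mem A, psi_mem A'⟩
  ex := by
    intro g hg
    obtain ⟨A, rfl⟩ := psi_surj hg
    obtain ⟨A', h⟩ := QuotientGroup.mk_surjective (φ (QuotientGroup.mk A))
    exact ⟨_, A, A', rfl, rfl, h.symm⟩
  ex' := by
    intro g hg
    obtain ⟨A, rfl⟩ := psi_surj hg
    obtain ⟨A', h⟩ := QuotientGroup.mk_surjective (φ.symm (QuotientGroup.mk A))
    exact ⟨_, A', A, rfl, rfl, by rw [h, φ.apply_symm_apply]⟩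
  mul := by
    rintro _ _ _ _ ⟨A, A', rfl, rfl, h⟩ ⟨B, B', rfl, rfl, h'⟩
    exact ⟨A * B, A' * B', map_mul _ _ _, map_mul _ _ _, by
      rw [QuotientGroup.mk_mul, map_mul, h, h', QuotientGroup.mk_mul]⟩
  inv := by
    rintro _ _ ⟨A, A', rfl, rfl, h⟩
    exact ⟨A⁻¹, A'⁻¹, map_inv _ _, map_inv _ _, by rw [QuotientGroup.mk_inv, map_inv, h, QuotientGroup.mk_inv]⟩
  one := by
    intro g
    constructor
    · rintro ⟨A, A', h1, rfl, h⟩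
      have hA : A = 1 := psi_inj (by rw [h1, map_one])
      rw [hA, QuotientGroup.mk_one, map_one] at h
      exact (psi_center hC A').1 ((QuotientGroup.eq_one_iff A').1 h.symm)
    · intro h
      obtain ⟨A', rfl⟩ := psi_surj (g := g) (by
        rcases h with rfl | rfl
        · exact Subgroup.one_mem _
        · exact ng_mem)
      refine ⟨1, A', map_one _, rfl, ?_⟩
      rw [QuotientGroup.mk_one, map_one, (QuotientGroup.eq_one_iff A').2 ((psi_center hC A').2 h)]
  one' := by
    intro g
    constructor
    · rintro ⟨A, A', rfl, h1, h⟩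
      have hA : A' = 1 := psi_inj (by rw [h1, map_one])
      rw [hA, QuotientGroup.mk_one, map_eq_one_iff φ φ.injective] at h
      exact (psi_center hC A).1 ((QuotientGroup.eq_one_iff A).1 h)
    · intro h
      obtain ⟨A, rfl⟩ := psi_surj (g := g) (by
        rcases h with rfl | rfl
        · exact Subgroup.one_mem _
        · exact ng_mem)
      refine ⟨A, 1, rfl, map_one _, ?_⟩
      rw [QuotientGroup.mk_one, (QuotientGroup.eq_one_iff A).2 ((psi_center hC A).2 h), map_one]

theorem psi_final (H K : Subgroup (↥(Matrix.symplecticGroup (Fin m) F) ⧸ Subgroup.center ↥(Matrix.symplecticGroup (Fin m) F))) (hH : H ≠ ⊤) (hK : K ≠ ⊤) :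
    ∃ g, ∀ φ : (↥(Matrix.symplecticGroup (Fin m) F) ⧸ Subgroup.center ↥(Matrix.symplecticGroup (Fin m) F)) ≃*
    (↥(Matrix.symplecticGroup (Fin m) F) ⧸ Subgroup.center ↥(Matrix.symplecticGroup (Fin m) F)), φ g ∉ H ∧ φ g ∉ K := by
  by_contra hcon
  push Not at hcon
  let Z := fun H : Subgroup (↥(Matrix.symplecticGroup (Fin m) F) ⧸ Subgroup.center ↥(Matrix.symplecticGroup (Fin m) F)) =>
    (H.comap (QuotientGroup.mk' _)).map (psi m F)
  have hZ : ∀ H, Z H ≤ Sp F _ := by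
    rintro H _ ⟨A, -, rfl⟩
    exact psi_mem A
  have hZn : ∀ H, ng F _ ∈ Z H := by
    intro H
    obtain ⟨A, hA⟩ := psi_surj (m := m) (F := F) ng_mem
    refine ⟨A, ?_, hA⟩
    change (QuotientGroup.mk A) ∈ H
    rw [(QuotientGroup.eq_one_iff A).2 ((psi_center hC A).2 (Or.inr hA))]
    exact H.one_mem
  have hZt : ∀ H, Sp F _ ≤ Z H → H = ⊤ := by
    intro H h
    refine (Subgroup.eq_top_iff' H).2 fun x => ?_
    obtain ⟨A, rfl⟩ := QuotientGroup.mk_surjective x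
    obtain ⟨B, hB, hBA⟩ := h (psi_mem A)
    rw [← psi_inj hBA]
    exact hB
  rcases hC.main (hZ H) (hZn H) (hZ K) (hZn K) (fun g hg => by
    obtain ⟨A, rfl⟩ := psi_surj hg
    obtain ⟨φ, hφ⟩ := hcon (QuotientGroup.mk A)
    obtain ⟨A', hA'⟩ := QuotientGroup.mk_surjective (φ (QuotientGroup.mk A))
    refine ⟨_, psi_cor hC φ, psi m F A', ⟨A, A', rfl, rfl, hA'.symm⟩, ?_⟩
    by_cases h : φ (QuotientGroup.mk A) ∈ H
    · left
      refine ⟨A', ?_, rfl⟩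
      change QuotientGroup.mk A' ∈ H
      rwa [hA']
    · right
      refine ⟨A', ?_, rfl⟩
      change QuotientGroup.mk A' ∈ K
      rw [hA']
      exact hφ h) with h | h
  · exact hH (hZt H h)
  · exact hK (hZt K h)

end Fin
end P18

/-- **The weak normal covering number of `PSp_{2m}(q)` is at least 3** for every `m ≥ 5`
and every odd prime power `q`: for any two proper subgroups `H`, `K` there is an element
`g` with `φ g ∉ H` and `φ g ∉ K` for every automorphism `φ`. -/
theorem gammaW_PSp2m_ge_three (m : ℕ) (hm : 5 ≤ m) (q : ℕ) (hq : IsPrimePow q)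
    (hodd : Odd q)
    (F : Type*) [Field F] [Fintype F] (hF : Fintype.card F = q)
    (H K : Subgroup (ProjSp m F)) (hH : H ≠ ⊤) (hK : K ≠ ⊤) :
    ∃ g : ProjSp m F, ∀ φ : ProjSp m F ≃* ProjSp m F, φ g ∉ H ∧ φ g ∉ K := by
  have hp' := CharP.char_is_prime F (ringChar F)
  obtain ⟨n, hp, hn⟩ := FiniteField.card F (ringChar F)
  have hC : Ctx F (Fin m ⊕ Fin m → F) (ringChar F) n m :=
    { hp := hp
      h2 := by
        apply Ring.two_ne_zero
        intro h
        rw [h, hF] at hn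
        rw [hn] at hodd
        exact Nat.not_even_iff_odd.2 hodd ((Nat.even_pow).2 ⟨even_two, n.pos.ne'⟩)
      hq := by rw [Nat.card_eq_fintype_card, hn]
      he := n.pos
      hm := hm
      hV := by simp [two_mul] }
  exact psi_final hC H K hH hK
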